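/- arXiv:2405.14041 — 2 statements merged into one kernel-verified Lean document; each statement's English description precedes it below -/
import Mathlib

section
/- Each of the following twelve pattern sets is Wilf-equivalent to {12345, 12354}: {12354, 12435}, {12354, 12453}, {12354, 21354}, {12435, 12453}, {12453, 12534}, {12453, 12543}, {12543, 21543}, {13254, 21354}, {13254, 23154}, {21354, 21453}, {21453, 21534}, and {21453, 21543}. -/
/-- A pattern is a permutation of `Fin k` for some `k : ℕ` (a permutation of length `k`,
written 0-indexed). -/
def Pattern : Type := Σ k : ℕ, Equiv.Perm (Fin k)

/-- Build a pattern from an explicit vector of values (0-indexed one-line notation). -/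
noncomputable def mkPattern {k : ℕ} (v : Fin k → Fin k) (h : Function.Bijective v := by decide) : Pattern :=
  ⟨k, Equiv.ofBijective v h⟩

/-- The permutation `π` of length `n` contains an occurrence of the pattern `p`:
there are indices `i₁ < ⋯ < i_k` (given by a strictly monotone `f`) such that
`π (f a) < π (f b) ↔ p a < p b` for all `a b`. -/
def PermContains {n : ℕ} (π : Equiv.Perm (Fin n)) (p : Pattern) : Prop :=
  ∃ f : Fin p.1 → Fin n, StrictMono f ∧
    ∀ a b : Fin p.1, π (f a) < π (f b) ↔ p.2 a < p.2 b

/-- `π` avoids every pattern in the set `S`. -/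
def AvoidsSet {n : ℕ} (π : Equiv.Perm (Fin n)) (S : Set Pattern) : Prop :=
  ∀ p ∈ S, ¬ PermContains π p

/-- Two sets of patterns are Wilf-equivalent: for every `n ≥ 1`, the number of
permutations of length `n` avoiding every pattern of `S1` equals the number of
permutations of length `n` avoiding every pattern of `S2`. -/
def WilfEquiv (S1 S2 : Set Pattern) : Prop :=
  ∀ n : ℕ, 1 ≤ n →
    Nat.card {π : Equiv.Perm (Fin n) // AvoidsSet π S1} =
    Nat.card {π : Equiv.Perm (Fin n) // AvoidsSet π S2}

/-- Append a last entry of value `r` to `τ`, shifting the values `≥ r` of `τ` up by one. -/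
def snocPerm {n : ℕ} (r : Fin (n + 1)) (τ : Equiv.Perm (Fin n)) : Equiv.Perm (Fin (n + 1)) :=
  (finSuccEquiv' (Fin.last n)).trans ((Equiv.optionCongr τ).trans (finSuccEquiv' r).symm)

/-- The order embedding of `ℕ` into itself whose range misses exactly `r`. -/
def skip (r x : ℕ) : ℕ := if x < r then x else x + 1

lemma snocPerm_last {n : ℕ} (r : Fin (n + 1)) (τ : Equiv.Perm (Fin n)) :
    snocPerm r τ (Fin.last n) = r := by
  simp [snocPerm]

lemma snocPerm_castSucc {n : ℕ} (r : Fin (n + 1)) (τ : Equiv.Perm (Fin n)) (i : Fin n) :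
    (snocPerm r τ i.castSucc : ℕ) = skip r (τ i) := by
  have h := finSuccEquiv'_succAbove (Fin.last n) i
  rw [Fin.succAbove_last] at h
  simp only [snocPerm, Equiv.trans_apply, h, Equiv.optionCongr_apply, Option.map_some,
    finSuccEquiv'_symm_some, skip, Fin.succAbove, Fin.lt_def, Fin.val_castSucc]
  split_ifs <;> simp

lemma snocPerm_bijective (n : ℕ) :
    Function.Bijective fun p : Fin (n + 1) × Equiv.Perm (Fin n) => snocPerm p.1 p.2 := by
  rw [Fintype.bijective_iff_injective_and_card]
  constructor
  · rintro ⟨r, τ⟩ ⟨r', τ'⟩ h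
    simp only at h
    have hr : r = r' := by rw [← snocPerm_last r τ, h, snocPerm_last]
    subst hr
    congr 1
    ext i
    have h2 := congrArg (fun σ : Equiv.Perm (Fin (n + 1)) => (σ i.castSucc : ℕ)) h
    simp only [snocPerm_castSucc, skip] at h2
    split_ifs at h2 <;> omega
  · simp [Fintype.card_perm, Nat.factorial_succ]

lemma card_filter_snocPerm {n : ℕ} (P : Equiv.Perm (Fin (n + 1)) → Prop) [DecidablePred P] :
    (Finset.univ.filter P).card =
      ∑ τ : Equiv.Perm (Fin n), (Finset.univ.filter fun r => P (snocPerm r τ)).card := by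
  simp only [Finset.card_filter]
  rw [← (Equiv.ofBijective _ (snocPerm_bijective n)).sum_comp, Fintype.sum_prod_type_right]
  rfl

open Classical in
/-- Permutations inside the Ferrers board with column heights `h` without `i ≤ j < k` whose values
satisfy `Q` and fit in column `k`. -/
noncomputable def placements (Q : ℕ → ℕ → ℕ → Prop) (n : ℕ) (h : ℕ → ℕ) :
    Finset (Equiv.Perm (Fin n)) :=
  Finset.univ.filter fun σ => (∀ i, (σ i : ℕ) < h i) ∧
    ∀ i j k, i ≤ j → j < k → (σ i : ℕ) < h k → (σ j : ℕ) < h k → ¬ Q (σ i) (σ j) (σ k)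

/-- Appending `r` to the entries of `τ` smaller than `m` creates no `Q`. -/
def Extends (Q : ℕ → ℕ → ℕ → Prop) {n : ℕ} (m : ℕ) (τ : Equiv.Perm (Fin n)) (r : ℕ) : Prop :=
  r ≤ m ∧ ∀ i j, i ≤ j → (τ i : ℕ) < m → (τ j : ℕ) < m → ¬ Q (skip r (τ i)) (skip r (τ j)) r

/-- `Q` only depends on the relative order of its arguments. -/
def SkipInvariant (Q : ℕ → ℕ → ℕ → Prop) : Prop :=
  ∀ r x y z, Q (skip r x) (skip r y) (skip r z) ↔ Q x y z

lemma skip_lt_iff {r m x : ℕ} (h : r < m) : skip r x < m ↔ x < m - 1 := by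
  unfold skip; split_ifs <;> omega

lemma mem_placements_snocPerm {Q : ℕ → ℕ → ℕ → Prop} (hQ : SkipInvariant Q) {n : ℕ} {h : ℕ → ℕ}
    (hh : Antitone h) (r : Fin (n + 1)) (τ : Equiv.Perm (Fin n)) :
    snocPerm r τ ∈ placements Q (n + 1) h ↔
      0 < h n ∧ τ ∈ placements Q n (fun i => h i - 1) ∧ Extends Q (h n - 1) τ r := by
  have key : ∀ i : Fin n, (r : ℕ) < h n → (r : ℕ) < h i := fun i hr =>
    lt_of_lt_of_le hr (hh i.isLt.le)
  simp only [placements, Finset.mem_filter, Finset.mem_univ, true_and, Fin.forall_fin_succ',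
    snocPerm_castSucc, snocPerm_last, Extends, Fin.val_castSucc, Fin.val_last]
  constructor
  · rintro ⟨⟨h1, h2⟩, h3⟩
    refine ⟨by omega, ⟨fun i => (skip_lt_iff (key i h2)).1 (h1 i), ?_⟩, by omega, ?_⟩
    · intro i j k hij hjk hi hj
      have := (h3.1 i).1 j |>.1 k (by simpa using hij) (by simpa using hjk)
        ((skip_lt_iff (key k h2)).2 hi) ((skip_lt_iff (key k h2)).2 hj)
      rwa [hQ] at this
    · intro i j hij hi hj
      exact (h3.1 i).1 j |>.2 (by simpa using hij) (Fin.castSucc_lt_last j)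
        ((skip_lt_iff h2).2 hi) ((skip_lt_iff h2).2 hj)
  · rintro ⟨h0, ⟨h1, h2⟩, h3, h4⟩
    have hr : (r : ℕ) < h n := by omega
    refine ⟨⟨fun i => (skip_lt_iff (key i hr)).2 (h1 i), hr⟩, fun i => ⟨fun j => ⟨fun k => ?_, ?_⟩,
      ?_, ?_⟩, fun j => ⟨?_, ?_⟩, ?_, ?_⟩
    · intro hij hjk hi hj
      rw [hQ]
      exact h2 i j k (by simpa using hij) (by simpa using hjk) ((skip_lt_iff (key k hr)).1 hi)
        ((skip_lt_iff (key k hr)).1 hj)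
    · intro hij _ hi hj
      exact h4 i j (by simpa using hij) ((skip_lt_iff hr).1 hi) ((skip_lt_iff hr).1 hj)
    all_goals
      intros
      simp only [Fin.lt_def, Fin.le_def, Fin.val_castSucc, Fin.val_last] at *
      omega

open Classical in
/-- In every permutation whose entries smaller than `m` avoid `Q` there are exactly `κ m` ways to
append an entry to these without creating `Q`. -/
def HasSites (Q : ℕ → ℕ → ℕ → Prop) (κ : ℕ → ℕ) : Prop :=
  ∀ (n : ℕ) (τ : Equiv.Perm (Fin n)) (m : ℕ), m ≤ n →
    (∀ i j k, i ≤ j → j < k → (τ i : ℕ) < m → (τ j : ℕ) < m → (τ k : ℕ) < m →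
      ¬ Q (τ i) (τ j) (τ k)) →
    (Finset.univ.filter fun r : Fin (n + 1) => Extends Q m τ r).card = κ m

lemma low_avoids_of_mem_placements {Q : ℕ → ℕ → ℕ → Prop} {n : ℕ} {h : ℕ → ℕ} {m : ℕ}
    {τ : Equiv.Perm (Fin n)} (hτ : τ ∈ placements Q n h) (hm : ∀ i < n, m ≤ h i) :
    ∀ i j k, i ≤ j → j < k → (τ i : ℕ) < m → (τ j : ℕ) < m → (τ k : ℕ) < m →
      ¬ Q (τ i) (τ j) (τ k) := by
  simp only [placements, Finset.mem_filter, Finset.mem_univ, true_and] at hτ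
  intro i j k hij hjk hi hj hk
  have := hm k k.isLt
  exact hτ.2 i j k hij hjk (by omega) (by omega)

open Classical in
lemma card_placements_succ {Q : ℕ → ℕ → ℕ → Prop} (hQ : SkipInvariant Q) {n : ℕ} {h : ℕ → ℕ}
    (hh : Antitone h) (h0 : 0 < h n) (P : Equiv.Perm (Fin (n + 1)) → Prop) :
    ((placements Q (n + 1) h).filter P).card =
      ∑ τ ∈ placements Q n (fun i => h i - 1),
        (Finset.univ.filter fun r : Fin (n + 1) =>
          Extends Q (h n - 1) τ r ∧ P (snocPerm r τ)).card := by
  have : (placements Q (n + 1) h).filter P =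
      Finset.univ.filter fun σ => σ ∈ placements Q (n + 1) h ∧ P σ := by
    ext; simp
  rw [this, card_filter_snocPerm, ← Finset.sum_subset (Finset.subset_univ _)]
  · refine Finset.sum_congr rfl fun τ hτ => ?_
    simp only [mem_placements_snocPerm hQ hh, h0, hτ, true_and]
  · intro τ _ hτ
    simp [mem_placements_snocPerm hQ hh, hτ]

lemma placements_eq_empty {Q : ℕ → ℕ → ℕ → Prop} {n : ℕ} {h : ℕ → ℕ} (h0 : h n = 0) :
    placements Q (n + 1) h = ∅ := by
  simp only [placements, Finset.filter_eq_empty_iff, not_and]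
  intro σ _ h1
  have := h1 (Fin.last n)
  simp only [Fin.val_last] at this
  omega

theorem card_placements_eq_of_hasSites {Q Q' : ℕ → ℕ → ℕ → Prop} {κ : ℕ → ℕ}
    (hQ : SkipInvariant Q) (hQ' : SkipInvariant Q') (hκ : HasSites Q κ) (hκ' : HasSites Q' κ)
    (n : ℕ) (h : ℕ → ℕ) (hh : Antitone h) (hn : ∀ i, h i ≤ n) :
    (placements Q n h).card = (placements Q' n h).card := by
  induction n generalizing h with
  | zero => simp [placements]
  | succ n ih =>
    rcases Nat.eq_zero_or_pos (h n) with h0 | h0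
    · simp [placements_eq_empty h0]
    · have step : ∀ {Q}, SkipInvariant Q → HasSites Q κ → (placements Q (n + 1) h).card =
          (placements Q n fun i => h i - 1).card * κ (h n - 1) := by
        intro Q hQ hκ
        have := card_placements_succ hQ hh h0 (fun _ => True)
        simp only [Finset.filter_true, and_true] at this
        rw [this, ← smul_eq_mul]
        refine Finset.sum_const_nat fun τ hτ => ?_
        convert hκ n τ (h n - 1) (by have := hn n; omega) (low_avoids_of_mem_placements hτ ?_)
        · simp
        · intro i hi
          exact Nat.sub_le_sub_right (hh (le_of_lt hi)) 1
      rw [step hQ hκ, step hQ' hκ', ih]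
      · exact fun a b hab => Nat.sub_le_sub_right (hh hab) 1
      · intro i
        have := hn i
        omega

lemma card_filter_fin_eq_two {n a b : ℕ} {P : ℕ → Prop} [DecidablePred P] (ha : a ≤ n) (hb : b ≤ n)
    (hab : a ≠ b) (hP : ∀ r, P r ↔ r = a ∨ r = b) :
    (Finset.univ.filter fun r : Fin (n + 1) => P r).card = 2 := by
  rw [Finset.card_eq_two]
  refine ⟨⟨a, by omega⟩, ⟨b, by omega⟩, by simpa using hab, ?_⟩
  ext r
  simp [hP, Fin.ext_iff]

lemma card_filter_fin_eq_one {n a : ℕ} {P : ℕ → Prop} [DecidablePred P] (ha : a ≤ n)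
    (hP : ∀ r, P r ↔ r = a) :
    (Finset.univ.filter fun r : Fin (n + 1) => P r).card = 1 := by
  rw [Finset.card_eq_one]
  refine ⟨⟨a, by omega⟩, ?_⟩
  ext r
  simp [hP, Fin.ext_iff]

lemma exists_val_apply_eq {n : ℕ} (τ : Equiv.Perm (Fin n)) {y : ℕ} (hy : y < n) :
    ∃ i, (τ i : ℕ) = y :=
  ⟨τ.symm ⟨y, hy⟩, by simp⟩

lemma exists_last_low {n m : ℕ} (τ : Equiv.Perm (Fin n)) (h0 : 0 < m) (hm : m ≤ n) :
    ∃ l, (τ l : ℕ) < m ∧ ∀ i, (τ i : ℕ) < m → i ≤ l := by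
  classical
  obtain ⟨i, hi⟩ := exists_val_apply_eq τ (h0.trans_le hm)
  obtain ⟨l, hl, hmax⟩ := (Finset.univ.filter fun i => (τ i : ℕ) < m).exists_max_image id
    ⟨i, by simp [hi, h0]⟩
  simp only [Finset.mem_filter, Finset.mem_univ, true_and, id] at hl hmax
  exact ⟨l, hl, hmax⟩

lemma val_perm_inj {n : ℕ} (τ : Equiv.Perm (Fin n)) {i j : Fin n} (h : (τ i : ℕ) = τ j) : i = j :=
  τ.injective (Fin.ext h)

def P12 (_ y z : ℕ) : Prop := y < z
def P21 (_ y z : ℕ) : Prop := z < y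
def P213 (x y z : ℕ) : Prop := y < x ∧ x < z
def P123 (x y z : ℕ) : Prop := x < y ∧ y < z
def P132 (x y z : ℕ) : Prop := x < z ∧ z < y
def P231 (x y z : ℕ) : Prop := z < x ∧ x < y
def P312 (x y z : ℕ) : Prop := y < z ∧ z < x
def P321 (x y z : ℕ) : Prop := z < y ∧ y < x

lemma skip_lt_skip {r x y : ℕ} : skip r x < skip r y ↔ x < y := by
  unfold skip; split_ifs <;> omega

lemma skip_lt_self {r x : ℕ} : skip r x < r ↔ x < r := by
  unfold skip; split_ifs <;> omega

lemma self_lt_skip {r x : ℕ} : r < skip r x ↔ r ≤ x := by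
  unfold skip; split_ifs <;> omega

abbrev twoSites (m : ℕ) : ℕ := if m = 0 then 1 else 2

lemma hasSites_of_iff {Q : ℕ → ℕ → ℕ → Prop}
    (h : ∀ (n : ℕ) (τ : Equiv.Perm (Fin n)) (m : ℕ) (l : Fin n), m ≤ n → (τ l : ℕ) < m →
      (∀ i, (τ i : ℕ) < m → i ≤ l) →
      (∀ i j k, i ≤ j → j < k → (τ i : ℕ) < m → (τ j : ℕ) < m → (τ k : ℕ) < m →
        ¬ Q (τ i) (τ j) (τ k)) →
      ∃ a b, a ≤ m ∧ b ≤ m ∧ a ≠ b ∧ ∀ r, Extends Q m τ r ↔ r = a ∨ r = b) :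
    HasSites Q twoSites := by
  classical
  intro n τ m hm hlow
  rcases Nat.eq_zero_or_pos m with rfl | h0
  · rw [twoSites, if_pos rfl]
    convert card_filter_fin_eq_one (n := n) (P := fun r => Extends Q 0 τ r) (Nat.zero_le n) ?_
    simp [Extends]
  · obtain ⟨l, hl, hmax⟩ := exists_last_low τ h0 hm
    obtain ⟨a, b, ha, hb, hab, hr⟩ := h n τ m l hm hl hmax hlow
    rw [twoSites, if_neg h0.ne']
    convert card_filter_fin_eq_two (P := fun r => Extends Q m τ r) (ha.trans hm) (hb.trans hm)
      hab hr

lemma hasSites_12 : HasSites P12 fun _ => 1 := by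
  classical
  intro n τ m hm hlow
  convert card_filter_fin_eq_one (P := fun r => Extends P12 m τ r) (Nat.zero_le n) ?_
  intro r
  simp only [Extends, P12, skip_lt_self]
  constructor
  · rintro ⟨h1, h2⟩
    by_contra hr
    obtain ⟨i, hi⟩ := exists_val_apply_eq τ (y := 0) (by omega)
    exact h2 i i le_rfl (by omega) (by omega) (by omega)
  · rintro rfl
    simp

lemma hasSites_21 : HasSites P21 fun _ => 1 := by
  classical
  intro n τ m hm hlow
  convert card_filter_fin_eq_one (P := fun r => Extends P21 m τ r) hm ?_
  intro r
  simp only [Extends, P21, self_lt_skip]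
  constructor
  · rintro ⟨h1, h2⟩
    by_contra hr
    obtain ⟨i, hi⟩ := exists_val_apply_eq τ (y := r) (by omega)
    exact h2 i i le_rfl (by omega) (by omega) (by omega)
  · rintro rfl
    refine ⟨le_rfl, ?_⟩
    intros; omega

lemma hasSites_123_213 : HasSites (fun x y z => P123 x y z ∨ P213 x y z) twoSites := by
  refine hasSites_of_iff fun n τ m l hm hl hmax hlow => ⟨0, 1, by omega, by omega, by omega, ?_⟩
  intro r
  simp only [Extends, P123, P213, skip_lt_skip, skip_lt_self]
  constructor
  · rintro ⟨h1, h2⟩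
    by_contra hr
    obtain ⟨i, hi⟩ := exists_val_apply_eq τ (y := 0) (by omega)
    obtain ⟨j, hj⟩ := exists_val_apply_eq τ (y := 1) (by omega)
    rcases le_total i j with h | h
    · exact h2 i j h (by omega) (by omega) (by omega)
    · exact h2 j i h (by omega) (by omega) (by omega)
  · intro hr
    refine ⟨by omega, ?_⟩
    intros; omega

lemma hasSites_132_312 : HasSites (fun x y z => P132 x y z ∨ P312 x y z) twoSites := by
  refine hasSites_of_iff fun n τ m l hm hl hmax hlow => ⟨0, m, by omega, by omega, by omega, ?_⟩
  intro r
  simp only [Extends, P132, P312, skip_lt_self, self_lt_skip]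
  constructor
  · rintro ⟨h1, h2⟩
    by_contra hr
    obtain ⟨i, hi⟩ := exists_val_apply_eq τ (y := 0) (by omega)
    obtain ⟨j, hj⟩ := exists_val_apply_eq τ (y := r) (by omega)
    rcases le_total i j with h | h
    · exact h2 i j h (by omega) (by omega) (by omega)
    · exact h2 j i h (by omega) (by omega) (by omega)
  · intro hr
    refine ⟨by omega, ?_⟩
    intros; omega

lemma hasSites_231_321 : HasSites (fun x y z => P231 x y z ∨ P321 x y z) twoSites := by
  refine hasSites_of_iff fun n τ m l hm hl hmax hlow => ⟨m, m - 1, by omega, by omega, by omega, ?_⟩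
  intro r
  simp only [Extends, P231, P321, skip_lt_skip, self_lt_skip]
  constructor
  · rintro ⟨h1, h2⟩
    by_contra hr
    obtain ⟨i, hi⟩ := exists_val_apply_eq τ (y := r) (by omega)
    obtain ⟨j, hj⟩ := exists_val_apply_eq τ (y := r + 1) (by omega)
    rcases le_total i j with h | h
    · exact h2 i j h (by omega) (by omega) (by omega)
    · exact h2 j i h (by omega) (by omega) (by omega)
  · intro hr
    refine ⟨by omega, ?_⟩
    intros; omega

lemma hasSites_231_312 : HasSites (fun x y z => P231 x y z ∨ P312 x y z) twoSites := by
  refine hasSites_of_iff fun n τ m l hm hl hmax hlow => ⟨m, τ l, by omega, by omega, by omega, ?_⟩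
  intro r
  simp only [Extends, P231, P312, skip_lt_skip, self_lt_skip, skip_lt_self] at hlow ⊢
  constructor
  · rintro ⟨h1, h2⟩
    by_contra hr
    obtain ⟨i, hi⟩ := exists_val_apply_eq τ (y := r) (by omega)
    have := h2 i l (hmax i (by omega)) (by omega) (by omega)
    omega
  · intro hr
    refine ⟨by omega, fun i j hij hi hj => ?_⟩
    rcases (hmax j hj).eq_or_lt with rfl | h
    · omega
    · have := hlow i j l hij h hi hj hl
      have hil : (τ i : ℕ) ≠ τ l := fun e => (hij.trans_lt h).ne (val_perm_inj τ e)
      have hjl : (τ j : ℕ) ≠ τ l := fun e => h.ne (val_perm_inj τ e)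
      omega

lemma hasSites_213_132 : HasSites (fun x y z => P213 x y z ∨ P132 x y z) twoSites := by
  refine hasSites_of_iff fun n τ m l hm hl hmax hlow =>
    ⟨0, τ l + 1, by omega, by omega, by omega, ?_⟩
  intro r
  simp only [Extends, P213, P132, skip_lt_skip, self_lt_skip, skip_lt_self] at hlow ⊢
  constructor
  · rintro ⟨h1, h2⟩
    by_contra hr
    obtain ⟨i, hi⟩ := exists_val_apply_eq τ (y := r - 1) (by omega)
    have := h2 i l (hmax i (by omega)) (by omega) (by omega)
    omega
  · intro hr
    refine ⟨by omega, fun i j hij hi hj => ?_⟩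
    rcases (hmax j hj).eq_or_lt with rfl | h
    · omega
    · have := hlow i j l hij h hi hj hl
      have hil : (τ i : ℕ) ≠ τ l := fun e => (hij.trans_lt h).ne (val_perm_inj τ e)
      have hjl : (τ j : ℕ) ≠ τ l := fun e => h.ne (val_perm_inj τ e)
      omega

lemma hasSites_213_231 : HasSites (fun x y z => P213 x y z ∨ P231 x y z) twoSites := by
  refine hasSites_of_iff fun n τ m l hm hl hmax hlow =>
    ⟨τ l, τ l + 1, by omega, by omega, by omega, ?_⟩
  intro r
  simp only [Extends, P213, P231, skip_lt_skip, self_lt_skip, skip_lt_self] at hlow ⊢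
  constructor
  · rintro ⟨h1, h2⟩
    by_contra hr
    rcases lt_or_ge r (τ l) with h | h
    · obtain ⟨i, hi⟩ := exists_val_apply_eq τ (y := r) (by omega)
      have := h2 i l (hmax i (by omega)) (by omega) (by omega)
      omega
    · obtain ⟨i, hi⟩ := exists_val_apply_eq τ (y := r - 1) (by omega)
      have := h2 i l (hmax i (by omega)) (by omega) (by omega)
      omega
  · intro hr
    refine ⟨by omega, fun i j hij hi hj => ?_⟩
    rcases (hmax j hj).eq_or_lt with rfl | h
    · omega
    · have := hlow i j l hij h hi hj hl
      have hil : (τ i : ℕ) ≠ τ l := fun e => (hij.trans_lt h).ne (val_perm_inj τ e)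
      have hjl : (τ j : ℕ) ≠ τ l := fun e => h.ne (val_perm_inj τ e)
      omega

/-- `Ballot s d`: every suffix of `s` has at least as many `true` as `false`, and `s` has `d` more
`true` than `false`. -/
inductive Ballot : List Bool → ℕ → Prop
  | nil : Ballot [] 0
  | up {s d} : Ballot s d → Ballot (true :: s) (d + 1)
  | down {s d} : Ballot s (d + 1) → Ballot (false :: s) d

lemma ballot_true {s : List Bool} {d : ℕ} : Ballot (true :: s) (d + 1) ↔ Ballot s d :=
  ⟨fun h => by cases h; assumption, .up⟩

lemma ballot_false {s : List Bool} {d : ℕ} : Ballot (false :: s) d ↔ Ballot s (d + 1) :=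
  ⟨fun h => by cases h; assumption, .down⟩

lemma not_ballot_true_zero {s : List Bool} : ¬ Ballot (true :: s) 0 := by
  rintro ⟨⟩

lemma Ballot.unique {s : List Bool} {d e : ℕ} (hd : Ballot s d) (he : Ballot s e) : d = e := by
  induction hd generalizing e with
  | nil => cases he; rfl
  | up _ ih => cases he with | up h => rw [ih h]
  | down _ ih => cases he with | down h => simpa using ih h

lemma Ballot.le_length {s : List Bool} {d : ℕ} (hd : Ballot s d) : d ≤ s.length := by
  induction hd with
  | nil => simp
  | up _ ih => simpa
  | down _ ih => simp; omega

lemma Ballot.eq_length {s : List Bool} {d : ℕ} (hd : Ballot s d) (h : false ∉ s) :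
    d = s.length := by
  induction hd with
  | nil => simp
  | up _ ih => simpa using ih (by simpa using h)
  | down => simp at h

/-- `RaiseZeros s k s'`: `s = 0ᵏ t` and `s' = 0ᵏ 1 t`. -/
inductive RaiseZeros : List Bool → ℕ → List Bool → Prop
  | here (s) : RaiseZeros s 0 (true :: s)
  | step {s k u} : RaiseZeros s k u → RaiseZeros (false :: s) (k + 1) (false :: u)

/-- `RaiseOnes s k s'`: `s = 1 ⋯ 1 0 ⋯ 0 t` with `k` letters before `t`, at least one
of them `1`, and `s'` arises by turning the last of these ones into `0` and inserting `1` before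
`t`. -/
inductive RaiseOnes : List Bool → ℕ → List Bool → Prop
  | turn {s k u} : RaiseZeros s k u → RaiseOnes (true :: s) (k + 1) (false :: u)
  | step {s k u} : RaiseOnes s k u → RaiseOnes (true :: s) (k + 1) (true :: u)

/-- The transition of states when an entry is appended `k` rows below the top. -/
def Raise (s : List Bool) (k : ℕ) (s' : List Bool) : Prop := RaiseZeros s k s' ∨ RaiseOnes s k s'

lemma RaiseZeros.unique {s t s' : List Bool} {k l : ℕ} (h : RaiseZeros s k s')
    (h' : RaiseZeros t l s') : s = t ∧ k = l := by
  induction h generalizing t l with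
  | here => cases h'; simp
  | step _ ih => cases h' with | step h' => simpa using ih h'

lemma RaiseOnes.unique {s t s' : List Bool} {k l : ℕ} (h : RaiseOnes s k s')
    (h' : RaiseOnes t l s') : s = t ∧ k = l := by
  induction h generalizing t l with
  | turn h => cases h' with | turn h' => simpa using h.unique h'
  | step _ ih => cases h' with | step h' => simpa using ih h'

lemma RaiseZeros.target_unique {s t t' : List Bool} {k : ℕ} (h : RaiseZeros s k t)
    (h' : RaiseZeros s k t') : t = t' := by
  induction h generalizing t' with
  | here => cases h'; simp
  | step _ ih => cases h' with | step h' => simpa using ih h'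

lemma RaiseOnes.target_unique {s t t' : List Bool} {k : ℕ} (h : RaiseOnes s k t)
    (h' : RaiseOnes s k t') : t = t' := by
  induction h generalizing t' with
  | turn h =>
    cases h' with
    | turn h' => simpa using h.target_unique h'
    | step h' => cases h' <;> cases h
  | step h ih =>
    cases h' with
    | turn h' => cases h <;> cases h'
    | step h' => simpa using ih h'

lemma RaiseOnes.not_raiseZeros {s t t' : List Bool} {k : ℕ} (h : RaiseOnes s k t) :
    ¬ RaiseZeros s k t' := by
  cases h <;> rintro ⟨⟩

lemma Raise.target_unique {s t t' : List Bool} {k : ℕ} (h : Raise s k t) (h' : Raise s k t') :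
    t = t' := by
  rcases h with h | h <;> rcases h' with h' | h'
  · exact h.target_unique h'
  · exact absurd h h'.not_raiseZeros
  · exact absurd h' h.not_raiseZeros
  · exact h.target_unique h'

lemma RaiseZeros.ballot_iff {s s' : List Bool} {k d : ℕ} (h : RaiseZeros s k s') :
    Ballot s' (d + 1) ↔ Ballot s d := by
  induction h generalizing d with
  | here => exact ballot_true
  | step _ ih => rw [ballot_false, ballot_false, ih]

lemma RaiseOnes.ballot_iff {s s' : List Bool} {k d : ℕ} (h : RaiseOnes s k s') :
    Ballot s (d + 1) ↔ Ballot s' d := by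
  induction h generalizing d with
  | turn h => rw [ballot_true, ballot_false, h.ballot_iff]
  | step h ih =>
    cases d with
    | zero =>
      rw [ballot_true]
      refine iff_of_false ?_ not_ballot_true_zero
      cases h <;> exact not_ballot_true_zero
    | succ d => rw [ballot_true, ballot_true, ih]

lemma RaiseOnes.not_ballot_zero {s s' : List Bool} {k : ℕ} (h : RaiseOnes s k s') :
    ¬ Ballot s 0 := by
  cases h <;> exact not_ballot_true_zero

lemma Raise.exists_ballot {s s' : List Bool} {k d : ℕ} (h : Raise s k s') (hs : Ballot s d) :
    ∃ e, Ballot s' e := by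
  rcases h with h | h
  · exact ⟨d + 1, h.ballot_iff.2 hs⟩
  · cases d with
    | zero => exact absurd hs h.not_ballot_zero
    | succ d => exact ⟨d, h.ballot_iff.1 hs⟩

lemma RaiseZeros.length {s s' : List Bool} {k : ℕ} (h : RaiseZeros s k s') :
    s'.length = s.length + 1 ∧ k ≤ s.length := by
  induction h with
  | here => simp
  | step _ ih => simpa using ih

lemma RaiseOnes.length {s s' : List Bool} {k : ℕ} (h : RaiseOnes s k s') :
    s'.length = s.length + 1 ∧ k ≤ s.length := by
  induction h with
  | turn h => simpa using h.length
  | step _ ih => simpa using ih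

lemma Raise.length {s s' : List Bool} {k : ℕ} (h : Raise s k s') :
    s'.length = s.length + 1 ∧ k ≤ s.length :=
  h.elim RaiseZeros.length RaiseOnes.length

lemma Ballot.exists_raiseZeros {s' : List Bool} {d : ℕ} (h : Ballot s' d) (h0 : s' ≠ []) :
    ∃ s k, RaiseZeros s k s' := by
  induction h with
  | nil => exact absurd rfl h0
  | up => exact ⟨_, _, .here _⟩
  | down h ih =>
    obtain ⟨s, k, hs⟩ := ih (by rintro rfl; cases h)
    exact ⟨_, _, hs.step⟩

lemma Ballot.exists_raiseOnes {s' : List Bool} {d : ℕ} (h : Ballot s' d) (h0 : false ∈ s') :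
    ∃ s k, RaiseOnes s k s' := by
  induction h with
  | nil => simp at h0
  | up _ ih =>
    obtain ⟨s, k, hs⟩ := ih (by simpa using h0)
    exact ⟨_, _, hs.step⟩
  | down h ih =>
    obtain ⟨s, k, hs⟩ := h.exists_raiseZeros (by rintro rfl; cases h)
    exact ⟨_, _, .turn hs⟩

lemma RaiseOnes.false_mem {s s' : List Bool} {k : ℕ} (h : RaiseOnes s k s') : false ∈ s' := by
  induction h with
  | turn => simp
  | step _ ih => simp [ih]

/-- The row pairs `(v, v + 1)` with `D v` are exactly those where the word `s`, whose head belongs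
to the top row, reads `01` from top to bottom. -/
def Records (D : ℕ → Prop) : List Bool → Prop
  | [] => True
  | [_] => True
  | b :: c :: t => (D t.length ↔ b = false ∧ c = true) ∧ Records D (c :: t)

lemma Records.tail {D : ℕ → Prop} {b : Bool} {s : List Bool} (h : Records D (b :: s)) :
    Records D s := by
  cases s with
  | nil => trivial
  | cons => exact h.2

lemma Records.congr {D E : ℕ → Prop} {s : List Bool} (hs : Records D s)
    (h : ∀ v, v + 1 < s.length → (D v ↔ E v)) : Records E s := by
  induction s with
  | nil => trivial
  | cons b s ih =>
    cases s with
    | nil => trivial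
    | cons c t =>
      exact ⟨(h _ (by simp)).symm.trans hs.1, ih hs.2 fun v hv => h v (by simp at hv ⊢; omega)⟩

/-- How the descents between consecutive values change when a last entry `r` is appended. -/
def shiftDescents (r : ℕ) (D : ℕ → Prop) (v : ℕ) : Prop :=
  (v + 1 < r ∧ D v) ∨ v = r ∨ (r < v ∧ D (v - 1))

lemma exists_raise_iff {D : ℕ → Prop} {s : List Bool} {k : ℕ} (hs : Records D s)
    (hk : k ≤ s.length) :
    (∃ s', Raise s k s') ↔ ∀ v, s.length ≤ v + k → v + 1 < s.length → ¬ D v := by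
  induction s generalizing k with
  | nil =>
    obtain rfl : k = 0 := by simpa using hk
    exact iff_of_true ⟨_, .inl (.here _)⟩ (by simp)
  | cons b s ih =>
    cases k with
    | zero => exact iff_of_true ⟨_, .inl (.here _)⟩ (by intros; omega)
    | succ k =>
      have ih := ih hs.tail (k := k) (by simpa using hk)
      cases s with
      | nil =>
        obtain rfl : k = 0 := by simpa using hk
        refine iff_of_true ?_ (by simp)
        cases b
        · exact ⟨_, .inl (.step (.here _))⟩
        · exact ⟨_, .inr (.turn (.here _))⟩
      | cons c t =>
        have hD := hs.1
        have split :
            (∀ v, (b :: c :: t).length ≤ v + (k + 1) → v + 1 < (b :: c :: t).length → ¬ D v)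
            ↔ (k ≠ 0 → ¬ D t.length) ∧
              ∀ v, (c :: t).length ≤ v + k → v + 1 < (c :: t).length → ¬ D v := by
          simp only [List.length_cons]
          constructor
          · intro h
            exact ⟨fun hk => h _ (by omega) (by omega), fun v h1 h2 => h v (by omega) (by omega)⟩
          · rintro ⟨h1, h2⟩ v h3 h4
            rcases eq_or_ne v t.length with rfl | hv
            · exact h1 (by omega)
            · exact h2 v (by omega) (by omega)
        rw [split, ← ih, hD]
        constructor
        · rintro ⟨s', h | h⟩
          · cases h with
            | step h =>
              refine ⟨fun hk => ?_, _, .inl h⟩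
              cases h with
              | here => exact absurd rfl hk
              | step => simp
          · cases h with
            | turn h => exact ⟨by simp, _, .inl h⟩
            | step h => exact ⟨by simp, _, .inr h⟩
        · rintro ⟨h1, s', h | h⟩
          · cases b
            · exact ⟨_, .inl h.step⟩
            · exact ⟨_, .inr (.turn h)⟩
          · cases b
            · cases h <;> simp at h1
            · exact ⟨_, .inr h.step⟩

lemma RaiseZeros.records {D : ℕ → Prop} {s s' : List Bool} {k r : ℕ} (h : RaiseZeros s k s')
    (hr : s.length = k + r) (hs : Records D s) : Records (shiftDescents r D) s' := by
  induction h with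
  | here s =>
    cases s with
    | nil => trivial
    | cons b s =>
      simp only [List.length_cons, zero_add] at hr
      refine ⟨?_, hs.congr fun v hv => ?_⟩
      · simp only [shiftDescents, Bool.true_eq_false, false_and, iff_false]
        omega
      · simp only [shiftDescents, List.length_cons] at hv ⊢
        constructor
        · exact fun h => .inl ⟨by omega, h⟩
        · rintro (h | h | h)
          · exact h.2
          · omega
          · omega
  | step h ih =>
    simp only [List.length_cons] at hr
    have hrec := ih (by omega) hs.tail
    cases h with
    | here s =>
      refine ⟨?_, hrec⟩
      simp only [shiftDescents, and_self, iff_true]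
      omega
    | @step s k s' h =>
      refine ⟨?_, hrec⟩
      have h1 := hs.1
      have h2 := h.length.1
      simp only [List.length_cons] at hr
      simp only [Bool.false_eq_true, and_false, iff_false, shiftDescents] at h1 ⊢
      rw [h2, Nat.add_sub_cancel]
      simp only [h1, and_false, or_false]
      omega

lemma RaiseOnes.records {D : ℕ → Prop} {s s' : List Bool} {k r : ℕ} (h : RaiseOnes s k s')
    (hr : s.length = k + r) (hs : Records D s) : Records (shiftDescents r D) s' := by
  induction h with
  | turn h =>
    simp only [List.length_cons] at hr
    have hrec := h.records (r := r) (by omega) hs.tail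
    cases h with
    | here s =>
      refine ⟨?_, hrec⟩
      simp only [shiftDescents, and_self, iff_true]
      omega
    | @step s k s' h =>
      refine ⟨?_, hrec⟩
      have h1 := hs.1
      have h2 := h.length.1
      simp only [List.length_cons] at hr
      simp only [Bool.false_eq_true, Bool.true_eq_false, and_false, iff_false,
        shiftDescents] at h1 ⊢
      rw [h2, Nat.add_sub_cancel]
      simp only [h1, and_false, or_false]
      omega
  | @step s k s' h ih =>
    simp only [List.length_cons] at hr
    have hrec := ih (by omega) hs.tail
    have h2 := h.length
    cases s with
    | nil => cases h
    | cons b s =>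
      cases s' with
      | nil => trivial
      | cons c s' =>
        refine ⟨?_, hrec⟩
        have h1 := hs.1
        have hk : 0 < k := by cases h <;> omega
        simp only [List.length_cons] at hr h2
        simp only [Bool.true_eq_false, false_and, iff_false, shiftDescents] at h1 ⊢
        rw [show s'.length - 1 = s.length by omega]
        simp only [h1, and_false, or_false]
        omega

lemma Raise.records {D : ℕ → Prop} {s s' : List Bool} {k r : ℕ} (h : Raise s k s')
    (hr : s.length = k + r) (hs : Records D s) : Records (shiftDescents r D) s' :=
  h.elim (fun h => h.records hr hs) fun h => h.records hr hs

/-- The value `v + 1` precedes the value `v`. -/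
def InvDescent {n : ℕ} (σ : Equiv.Perm (Fin n)) (v : ℕ) : Prop :=
  ∃ i j, (σ i : ℕ) = v + 1 ∧ (σ j : ℕ) = v ∧ i < j

lemma invDescent_snocPerm {n : ℕ} (r : Fin (n + 1)) (τ : Equiv.Perm (Fin n)) {v : ℕ} (hv : v < n) :
    InvDescent (snocPerm r τ) v ↔ shiftDescents r (InvDescent τ) v := by
  simp only [InvDescent, shiftDescents]
  constructor
  · rintro ⟨i, j, hi, hj, hij⟩
    induction i using Fin.lastCases with
    | last => exact absurd hij (Fin.le_last _).not_gt
    | cast i =>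
      rw [snocPerm_castSucc] at hi
      induction j using Fin.lastCases with
      | last =>
        rw [snocPerm_last] at hj
        exact .inr (.inl hj.symm)
      | cast j =>
        rw [snocPerm_castSucc] at hj
        have hij : i < j := by simpa using hij
        unfold skip at hi hj
        rcases lt_or_ge (v + 1) r with h | h
        · exact .inl ⟨h, i, j, by split_ifs at hi <;> omega, by split_ifs at hj <;> omega, hij⟩
        · refine .inr (.inr ?_)
          split_ifs at hi hj <;> first | omega | exact ⟨by omega, i, j, by omega, by omega, hij⟩
  · rintro (⟨h, i, j, hi, hj, hij⟩ | h | ⟨h, i, j, hi, hj, hij⟩)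
    · refine ⟨i.castSucc, j.castSucc, ?_, ?_, by simpa using hij⟩ <;>
        rw [snocPerm_castSucc, skip, if_pos (by omega)] <;> omega
    · obtain ⟨i, hi⟩ := exists_val_apply_eq τ hv
      refine ⟨i.castSucc, Fin.last n, ?_, by rw [snocPerm_last, h], Fin.castSucc_lt_last i⟩
      rw [snocPerm_castSucc, skip, if_neg (by omega), hi]
    · refine ⟨i.castSucc, j.castSucc, ?_, ?_, by simpa using hij⟩ <;>
        rw [snocPerm_castSucc, skip, if_neg (by omega)] <;> omega

lemma exists_invDescent {n : ℕ} {τ : Equiv.Perm (Fin n)} {i j : Fin n} (hij : i < j)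
    (h : (τ j : ℕ) < τ i) : ∃ v, (τ j : ℕ) ≤ v ∧ v + 1 ≤ τ i ∧ InvDescent τ v := by
  obtain ⟨c, hc⟩ := Nat.exists_eq_add_of_lt h
  induction c generalizing j with
  | zero => exact ⟨τ j, le_rfl, h, i, j, by omega, rfl, hij⟩
  | succ c ih =>
    obtain ⟨p, hp⟩ := exists_val_apply_eq τ (y := (τ j : ℕ) + 1) (by omega)
    rcases lt_or_ge p j with hpj | hpj
    · exact ⟨τ j, le_rfl, h, p, j, hp, rfl, hpj⟩
    · obtain ⟨v, h1, h2, h3⟩ := ih (hij.trans_le hpj) (by omega) (by omega)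
      exact ⟨v, by omega, h2, h3⟩

lemma extends_321_iff {n m r : ℕ} {τ : Equiv.Perm (Fin n)} :
    Extends P321 m τ r ↔ r ≤ m ∧ ∀ v, r ≤ v → v + 1 < m → ¬ InvDescent τ v := by
  simp only [Extends, P321, skip_lt_skip, self_lt_skip]
  refine and_congr_right fun _ => ⟨?_, ?_⟩
  · rintro h v h1 h2 ⟨i, j, hi, hj, hij⟩
    exact h i j hij.le (by omega) (by omega) (by omega)
  · rintro h i j hij hi hj ⟨h1, h2⟩
    rcases hij.eq_or_lt with rfl | hij
    · omega
    · obtain ⟨v, h3, h4, h5⟩ := exists_invDescent hij h2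
      exact h v (by omega) (by omega) h5

/-- The values below `j` appear in increasing order. -/
def LowIncreasing {n : ℕ} (τ : Equiv.Perm (Fin n)) (j : ℕ) : Prop :=
  ∀ a b, a < b → (τ a : ℕ) < j → (τ b : ℕ) < j → (τ a : ℕ) < τ b

lemma extends_213_and_lowIncreasing_iff {n m j : ℕ} {τ : Equiv.Perm (Fin n)} (r : Fin (n + 1))
    (hm : m ≤ n) (hj : j ≤ m + 1) :
    Extends P213 m τ r ∧ LowIncreasing (snocPerm r τ) j ↔
      (r ≤ m ∧ j ≤ r + 1) ∧ LowIncreasing τ r := by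
  simp only [Extends, P213, skip_lt_skip, skip_lt_self, LowIncreasing, Fin.forall_fin_succ',
    snocPerm_castSucc, snocPerm_last]
  constructor
  · rintro ⟨⟨h1, h2⟩, h3, h4⟩
    refine ⟨⟨h1, ?_⟩, ?_⟩
    · by_contra hr
      obtain ⟨a, ha⟩ := exists_val_apply_eq τ (y := r) (by omega)
      have h5 : skip r (τ a) < j := by
        rw [ha, skip, if_neg (lt_irrefl _)]
        omega
      have := (h3 a).2 (Fin.castSucc_lt_last a) h5 (by omega)
      omega
    · intro a b hab ha hb
      have := h2 a b hab.le (by omega) (by omega)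
      have hne : (τ a : ℕ) ≠ τ b := fun e => hab.ne (val_perm_inj τ e)
      omega
  · rintro ⟨⟨h1, h2⟩, h3⟩
    refine ⟨⟨h1, ?_⟩, fun a => ⟨fun b hab ha hb => ?_, fun _ ha hb => ?_⟩, fun b hb => ?_, ?_⟩
    · rintro a b hab ha hb ⟨h4, h5⟩
      rcases hab.eq_or_lt with rfl | hab
      · omega
      · have := h3 a b hab h5 (by omega)
        omega
    · refine h3 a b (by simpa using hab) ?_ ?_ <;> unfold skip at ha hb <;>
        split_ifs at ha hb <;> omega
    · unfold skip at ha
      split_ifs at ha <;> omega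
    · exact absurd hb (Fin.castSucc_lt_last b).not_gt
    · exact fun h => absurd h (lt_irrefl _)

/-- One step of the reflected ballot recursion. -/
def ballotStep (V : ℕ → ℕ) : ℕ → ℕ
  | 0 => V 1
  | d + 1 => V (d + 2) + V d

lemma ballotStep_iterate_congr {V W : ℕ → ℕ} {M : ℕ} (h : ∀ d ≤ M, V d = W d) (k j : ℕ)
    (hjk : j + k ≤ M) : ballotStep^[k] V j = ballotStep^[k] W j := by
  induction k generalizing j with
  | zero => exact h j hjk
  | succ k ih =>
    simp only [Function.iterate_succ_apply']
    cases j with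
    | zero => exact ih _ (by omega)
    | succ j => simp only [ballotStep]; rw [ih _ (by omega), ih _ (by omega)]

lemma sum_iterate_ballotStep {V : ℕ → ℕ} {m j : ℕ} (hV : ∀ d, m < d → V d = 0) (hj : j ≤ m + 1) :
    ∑ r ∈ Finset.range (m + 1) with j ≤ r + 1, ballotStep^[m - r] V r =
      ballotStep^[m + 1 - j] (ballotStep V) j := by
  rw [← Function.iterate_succ_apply]
  induction hj using Nat.decreasingInduction with
  | self =>
    have : (Finset.range (m + 1)).filter (fun r => m + 1 ≤ r + 1) = {m} := by
      ext r; simp; omega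
    rw [this]
    simp [ballotStep, hV (m + 2) (by omega)]
  | of_succ j hj ih =>
    have e : m + 1 - j = (m + 1 - (j + 1)).succ := by omega
    rw [e, Function.iterate_succ_apply']
    cases j with
    | zero =>
      simp only [ballotStep]
      rw [← ih]
      refine Finset.sum_congr ?_ fun _ _ => rfl
      ext r; simp
    | succ j =>
      have : (Finset.range (m + 1)).filter (fun r => j + 1 ≤ r + 1) =
          insert j ((Finset.range (m + 1)).filter fun r => j + 1 + 1 ≤ r + 1) := by
        ext r; simp; omega
      rw [this, Finset.sum_insert (by simp), ih, ballotStep, add_comm, Function.iterate_succ_apply',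
        ← Function.iterate_succ_apply' ballotStep, show (m + 1 - (j + 1 + 1)).succ = m - j by omega]

open Classical in
/-- The `321`-avoiding placements carry words of length `M` recording the descents between the
values below `M`, equidistributed on the ballot words of given excess `d` with frequency `V d`, and
the distribution of initial increasing values of `213`-avoiding placements is obtained from `V`. -/
def Linked (n : ℕ) (h : ℕ → ℕ) (M : ℕ) : Prop :=
  ∃ (V : ℕ → ℕ) (st : Equiv.Perm (Fin n) → List Bool),
    (∀ d, M < d → V d = 0) ∧
    (∀ σ ∈ placements P321 n h, (st σ).length = M ∧ (∃ d, Ballot (st σ) d) ∧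
      Records (InvDescent σ) (st σ)) ∧
    (∀ s d, s.length = M → Ballot s d → ((placements P321 n h).filter (st · = s)).card = V d) ∧
    ∀ j ≤ M, ((placements P213 n h).filter (LowIncreasing · j)).card = ballotStep^[M - j] V j

lemma Linked.truncate {n : ℕ} {h : ℕ → ℕ} {M : ℕ} (H : Linked n h (M + 1)) : Linked n h M := by
  classical
  obtain ⟨V, st, -, hst, hcount, hU⟩ := H
  refine ⟨fun d => if d ≤ M then ballotStep V d else 0, fun σ => (st σ).tail, ?_, ?_, ?_, ?_⟩
  · intro d hd
    simp [hd.not_ge]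
  · intro σ hσ
    obtain ⟨h1, ⟨d, h2⟩, h3⟩ := hst σ hσ
    cases hs : st σ with
    | nil => simp [hs] at h1
    | cons b s =>
      rw [hs] at h1 h2 h3
      simp only [hs, List.tail_cons]
      refine ⟨by simpa using h1, ?_, h3.tail⟩
      cases h2 with
      | up h => exact ⟨_, h⟩
      | down h => exact ⟨_, h⟩
  · intro s d hs hd
    have hdM : d ≤ M := hs ▸ hd.le_length
    have key : (placements P321 n h).filter (fun σ => (st σ).tail = s) =
        (placements P321 n h).filter (fun σ => st σ = true :: s) ∪
          (placements P321 n h).filter (fun σ => st σ = false :: s) := by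
      ext σ
      simp only [Finset.mem_filter, Finset.mem_union, ← and_or_left, and_congr_right_iff]
      intro hσ
      have h1 := (hst σ hσ).1
      cases hs' : st σ with
      | nil => simp [hs'] at h1
      | cons b t => cases b <;> simp
    rw [key, Finset.card_union_of_disjoint, hcount _ (d + 1) (by simp [hs]) hd.up]
    · simp only [if_pos hdM]
      cases d with
      | zero =>
        have : (placements P321 n h).filter (fun σ => st σ = false :: s) = ∅ := by
          rw [Finset.filter_eq_empty_iff]
          intro σ hσ e
          obtain ⟨-, ⟨d, h2⟩, -⟩ := hst σ hσ
          rw [e, ballot_false] at h2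
          exact absurd (h2.unique hd) (by omega)
        simp [this, ballotStep]
      | succ d =>
        rw [hcount _ d (by simp [hs]) hd.down, ballotStep]
    · rw [Finset.disjoint_filter]
      intro σ _ h1 h2
      simp [h1] at h2
  · intro j hj
    rw [hU j (by omega), show M + 1 - j = (M - j).succ by omega, Function.iterate_succ_apply]
    refine ballotStep_iterate_congr (M := M) ?_ _ _ (by omega)
    intro d hd
    simp [hd]

lemma Linked.mono {n : ℕ} {h : ℕ → ℕ} {M N : ℕ} (H : Linked n h N) (hMN : M ≤ N) :
    Linked n h M := by
  induction hMN using Nat.decreasingInduction with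
  | self => exact H
  | of_succ _ _ ih => exact ih.truncate

lemma skipInvariant_213 : SkipInvariant P213 := by
  intro r x y z; simp only [P213, skip_lt_skip]

lemma skipInvariant_321 : SkipInvariant P321 := by
  intro r x y z; simp only [P321, skip_lt_skip]

lemma card_filter_lowIncreasing_succ {n : ℕ} {h : ℕ → ℕ} (hh : Antitone h) (h0 : 0 < h n)
    (hn : h n ≤ n + 1) {j : ℕ} (hj : j ≤ h n) [∀ n j, DecidablePred (LowIncreasing (n := n) · j)] :
    ((placements P213 (n + 1) h).filter (LowIncreasing · j)).card =
      ∑ r ∈ Finset.range (h n - 1 + 1) with j ≤ r + 1,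
        ((placements P213 n fun i => h i - 1).filter (LowIncreasing · r)).card := by
  classical
  have h1 := card_placements_succ skipInvariant_213 hh h0 (LowIncreasing · j)
  calc _ = ∑ τ ∈ placements P213 n fun i => h i - 1,
        (Finset.univ.filter fun r : Fin (n + 1) =>
          Extends P213 (h n - 1) τ r ∧ LowIncreasing (snocPerm r τ) j).card := by convert h1
    _ = ∑ τ ∈ placements P213 n fun i => h i - 1,
        ∑ r ∈ Finset.range (h n - 1 + 1) with j ≤ r + 1, if LowIncreasing τ r then 1 else 0 := by
      refine Finset.sum_congr rfl fun τ _ => ?_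
      rw [← Finset.card_filter, Finset.filter_filter]
      refine Finset.card_bij (fun r _ => r) ?_ ?_ ?_
      · intro r hr
        simp only [Finset.mem_filter, Finset.mem_univ, true_and, Finset.mem_range] at hr ⊢
        rw [extends_213_and_lowIncreasing_iff r (by omega) (by omega)] at hr
        exact ⟨by omega, hr.1.2, hr.2⟩
      · intro r _ r' _ e
        exact Fin.ext e
      · intro r hr
        simp only [Finset.mem_filter, Finset.mem_univ, true_and, Finset.mem_range] at hr ⊢
        refine ⟨⟨r, by omega⟩, ?_, rfl⟩
        rw [extends_213_and_lowIncreasing_iff _ (by omega) (by omega)]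
        exact ⟨⟨by simp only; omega, hr.2.1⟩, hr.2.2⟩
    _ = _ := by
      rw [Finset.sum_comm]
      simp only [Finset.card_filter]

open Classical in
/-- A word reached from `s` by `Raise s k`, if there is one. -/
noncomputable def raised (s : List Bool) (k : ℕ) : List Bool :=
  if h : ∃ s', Raise s k s' then h.choose else []

lemma raised_spec {s : List Bool} {k : ℕ} (h : ∃ s', Raise s k s') : Raise s k (raised s k) := by
  rw [raised, dif_pos h]
  exact h.choose_spec

lemma Raise.raised_eq {s s' : List Bool} {k : ℕ} (h : Raise s k s') : raised s k = s' :=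
  (raised_spec ⟨s', h⟩).target_unique h

/-- The word attached to the permutation `snocPerm r τ` given the words attached to each `τ`. -/
noncomputable def nextWord {n : ℕ} (m : ℕ) (st : Equiv.Perm (Fin n) → List Bool)
    (σ : Equiv.Perm (Fin (n + 1))) : List Bool :=
  let p := (Equiv.ofBijective _ (snocPerm_bijective n)).symm σ
  raised (st p.2) (m - p.1)

lemma nextWord_snocPerm {n : ℕ} (m : ℕ) (st : Equiv.Perm (Fin n) → List Bool)
    (r : Fin (n + 1)) (τ : Equiv.Perm (Fin n)) :
    nextWord m st (snocPerm r τ) = raised (st τ) (m - r) := by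
  have : (Equiv.ofBijective _ (snocPerm_bijective n)).symm (snocPerm r τ) = (r, τ) := by
    rw [Equiv.symm_apply_eq]; rfl
  rw [nextWord, this]

lemma extends_321_iff_raise {n m : ℕ} {τ : Equiv.Perm (Fin n)} {s : List Bool}
    (hs : Records (InvDescent τ) s) (hm : s.length = m) (r : ℕ) :
    Extends P321 m τ r ↔ r ≤ m ∧ ∃ s', Raise s (m - r) s' := by
  rw [extends_321_iff]
  refine and_congr_right fun hr => ?_
  rw [exists_raise_iff hs (by omega), hm]
  constructor
  · intro h v h1 h2
    exact h v (by omega) h2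
  · intro h v h1 h2
    exact h v (by omega) h2

open Classical in
lemma card_filter_fin_eq_ite {n m : ℕ} (hmn : m ≤ n) {P : ℕ → Prop} {Q : Prop} [Decidable Q]
    {k₀ : ℕ}
    (hP : ∀ k, P k ↔ Q ∧ k = k₀) (hk : Q → k₀ ≤ m) :
    (Finset.univ.filter fun r : Fin (n + 1) => (r : ℕ) ≤ m ∧ P (m - r)).card =
      if Q then 1 else 0 := by
  split_ifs with hQ
  · rw [Finset.card_eq_one]
    have := hk hQ
    refine ⟨⟨m - k₀, by omega⟩, ?_⟩
    ext r
    simp only [hP, hQ, true_and, Finset.mem_filter, Finset.mem_univ, Finset.mem_singleton,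
      Fin.ext_iff]
    omega
  · simp [hP, hQ]

open Classical in
lemma card_filter_nextWord {n m : ℕ} {h : ℕ → ℕ} {V : ℕ → ℕ}
    {st : Equiv.Perm (Fin n) → List Bool} (hmn : m ≤ n) (hV : ∀ d, m < d → V d = 0)
    (hst : ∀ σ ∈ placements P321 n h, (st σ).length = m ∧ (∃ d, Ballot (st σ) d) ∧
      Records (InvDescent σ) (st σ))
    (hcount : ∀ s d, s.length = m → Ballot s d →
      ((placements P321 n h).filter (st · = s)).card = V d)
    {s' : List Bool} {d : ℕ} (hs' : s'.length = m + 1) (hd : Ballot s' d) :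
    ∑ τ ∈ placements P321 n h, (Finset.univ.filter fun r : Fin (n + 1) =>
      Extends P321 m τ r ∧ nextWord m st (snocPerm r τ) = s').card = ballotStep V d := by
  have h1 : ∀ τ ∈ placements P321 n h, (Finset.univ.filter fun r : Fin (n + 1) =>
      Extends P321 m τ r ∧ nextWord m st (snocPerm r τ) = s').card =
      (Finset.univ.filter fun r : Fin (n + 1) =>
        (r : ℕ) ≤ m ∧ RaiseZeros (st τ) (m - r) s').card +
      (Finset.univ.filter fun r : Fin (n + 1) =>
        (r : ℕ) ≤ m ∧ RaiseOnes (st τ) (m - r) s').card := by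
    intro τ hτ
    rw [← Finset.card_union_of_disjoint]
    · congr 1
      ext r
      simp only [Finset.mem_filter, Finset.mem_univ, true_and, Finset.mem_union, ← and_or_left,
        nextWord_snocPerm, extends_321_iff_raise (hst τ hτ).2.2 (hst τ hτ).1, and_assoc]
      refine and_congr_right fun _ => ⟨?_, fun h => ⟨⟨s', h⟩, Raise.raised_eq h⟩⟩
      rintro ⟨h1, h2⟩
      exact h2 ▸ raised_spec h1
    · rw [Finset.disjoint_filter]
      rintro r - ⟨-, h1⟩ ⟨-, h2⟩
      exact h2.not_raiseZeros h1
  rw [Finset.sum_congr rfl h1, Finset.sum_add_distrib]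
  have hne : s' ≠ [] := by rintro rfl; simp at hs'
  have zeros : ∑ τ ∈ placements P321 n h, (Finset.univ.filter fun r : Fin (n + 1) =>
      (r : ℕ) ≤ m ∧ RaiseZeros (st τ) (m - r) s').card = if d = 0 then 0 else V (d - 1) := by
    obtain ⟨s₀, k₀, h₀⟩ := hd.exists_raiseZeros hne
    have hl := h₀.length
    have : ∀ τ : Equiv.Perm (Fin n), (Finset.univ.filter fun r : Fin (n + 1) =>
        (r : ℕ) ≤ m ∧ RaiseZeros (st τ) (m - r) s').card = if st τ = s₀ then 1 else 0 := by
      intro τ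
      refine card_filter_fin_eq_ite (P := fun k => RaiseZeros (st τ) k s') (Q := st τ = s₀)
          (k₀ := k₀) hmn (fun k => ⟨fun h => h.unique h₀, ?_⟩) ?_
      · rintro ⟨h, rfl⟩
        exact h ▸ h₀
      · omega
    simp only [this, ← Finset.card_filter]
    cases d with
    | zero =>
      rw [if_pos rfl, Finset.card_eq_zero, Finset.filter_eq_empty_iff]
      rintro σ hσ rfl
      obtain ⟨-, ⟨e, he⟩, -⟩ := hst σ hσ
      exact absurd ((h₀.ballot_iff.2 he).unique hd) (by omega)
    | succ d => exact hcount _ _ (by omega) (h₀.ballot_iff.1 hd)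
  have ones : ∑ τ ∈ placements P321 n h, (Finset.univ.filter fun r : Fin (n + 1) =>
      (r : ℕ) ≤ m ∧ RaiseOnes (st τ) (m - r) s').card = V (d + 1) := by
    by_cases hf : false ∈ s'
    · obtain ⟨s₀, k₀, h₀⟩ := hd.exists_raiseOnes hf
      have hl := h₀.length
      have : ∀ τ : Equiv.Perm (Fin n), (Finset.univ.filter fun r : Fin (n + 1) =>
          (r : ℕ) ≤ m ∧ RaiseOnes (st τ) (m - r) s').card = if st τ = s₀ then 1 else 0 := by
        intro τ
        refine card_filter_fin_eq_ite (P := fun k => RaiseOnes (st τ) k s') (Q := st τ = s₀)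
          (k₀ := k₀) hmn (fun k => ⟨fun h => h.unique h₀, ?_⟩) ?_
        · rintro ⟨h, rfl⟩
          exact h ▸ h₀
        · omega
      simp only [this, ← Finset.card_filter]
      exact hcount _ _ (by omega) (h₀.ballot_iff.2 hd)
    · rw [hV _ (by have := hd.eq_length hf; omega)]
      refine Finset.sum_eq_zero fun τ _ => ?_
      rw [Finset.card_eq_zero, Finset.filter_eq_empty_iff]
      rintro r - ⟨-, h⟩
      exact hf h.false_mem
  rw [zeros, ones]
  cases d with
  | zero => simp [ballotStep]
  | succ d => exact add_comm _ _

lemma Linked.succ {n : ℕ} {h : ℕ → ℕ} (hh : Antitone h) (h0 : 0 < h n) (hn : h n ≤ n + 1)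
    (H : Linked n (fun i => h i - 1) (h n - 1)) : Linked (n + 1) h (h n) := by
  classical
  obtain ⟨m, hm⟩ : ∃ m, h n = m + 1 := ⟨h n - 1, by omega⟩
  have hm' : h n - 1 = m := by omega
  obtain ⟨V, st, hV, hst, hcount, hU⟩ := H
  rw [hm'] at hV hst hcount hU
  refine ⟨ballotStep V, nextWord m st, ?_, ?_, ?_, ?_⟩
  · intro d hd
    cases d with
    | zero => omega
    | succ d => simp [ballotStep, hV (d + 2) (by omega), hV d (by omega)]
  · intro σ hσ
    obtain ⟨⟨r, τ⟩, rfl⟩ := (snocPerm_bijective n).2 σ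
    simp only at hσ ⊢
    rw [mem_placements_snocPerm skipInvariant_321 hh, hm'] at hσ
    obtain ⟨-, hτ, hE⟩ := hσ
    obtain ⟨h1, ⟨d, h2⟩, h3⟩ := hst τ hτ
    rw [extends_321_iff_raise h3 h1] at hE
    have hR := raised_spec hE.2
    rw [nextWord_snocPerm, hm, hR.length.1, h1]
    refine ⟨rfl, hR.exists_ballot h2, ?_⟩
    refine (hR.records (r := r) (by omega) h3).congr fun v hv => ?_
    rw [hR.length.1] at hv
    exact (invDescent_snocPerm r τ (by omega)).symm
  · intro s d hs hd
    have := card_placements_succ skipInvariant_321 hh h0 (fun σ => nextWord m st σ = s)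
    rw [hm'] at this
    rw [← card_filter_nextWord (by omega) hV hst hcount (hm ▸ hs) hd]
    convert this
  · intro j hj
    rw [card_filter_lowIncreasing_succ hh h0 hn hj, hm', hm, ← sum_iterate_ballotStep hV (hm ▸ hj)]
    refine Finset.sum_congr rfl fun r hr => hU r ?_
    simp only [Finset.mem_filter, Finset.mem_range] at hr
    omega

lemma linked_of_le {n : ℕ} {h : ℕ → ℕ} (hh : Antitone h) (hn : ∀ i, h i ≤ n) {M : ℕ}
    (hM : M ≤ n) (hMh : ∀ i < n, M ≤ h i) : Linked n h M := by
  classical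
  induction n generalizing h M with
  | zero =>
    obtain rfl : M = 0 := by omega
    refine ⟨fun d => if d = 0 then 1 else 0, fun _ => [], ?_, ?_, ?_, ?_⟩
    · intro d hd
      simp [hd.ne']
    · exact fun _ _ => ⟨rfl, ⟨0, .nil⟩, trivial⟩
    · intro s d hs hd
      obtain rfl := List.length_eq_zero_iff.1 hs
      cases hd
      simp [placements]
    · intro j hj
      obtain rfl : j = 0 := by omega
      simp [placements, LowIncreasing]
  | succ n ih =>
    have hMn := hMh n (by omega)
    rcases Nat.eq_zero_or_pos (h n) with h0 | h0
    · obtain rfl : M = 0 := by omega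
      refine ⟨fun _ => 0, fun _ => [], ?_, ?_, ?_, ?_⟩
      · simp
      · simp [placements_eq_empty h0]
      · simp [placements_eq_empty h0]
      · intro j hj
        obtain rfl : j = 0 := by omega
        simp [placements_eq_empty h0]
    · refine Linked.mono (Linked.succ hh h0 (hn n) ?_) hMn
      have := hn n
      refine ih (fun a b hab => Nat.sub_le_sub_right (hh hab) 1) (fun i => ?_) (by omega) ?_
      · have := hn i
        omega
      · exact fun i hi => Nat.sub_le_sub_right (hh hi.le) 1

theorem card_placements_213_eq_321 (n : ℕ) (h : ℕ → ℕ) (hh : Antitone h) (hn : ∀ i, h i ≤ n) :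
    (placements P213 n h).card = (placements P321 n h).card := by
  classical
  obtain ⟨V, st, -, hst, hcount, hU⟩ := linked_of_le hh hn (Nat.zero_le n) fun _ _ => Nat.zero_le _
  have h1 := hU 0 le_rfl
  have h2 := hcount [] 0 rfl .nil
  rw [Finset.filter_true_of_mem (by simp [LowIncreasing])] at h1
  rw [Finset.filter_true_of_mem fun σ hσ => List.length_eq_zero_iff.1 (hst σ hσ).1] at h2
  rw [h1, h2]
  rfl

/-- `f` lists the positions of an occurrence of `p` in `π`. -/
def IsOccurrence {n : ℕ} (π : Equiv.Perm (Fin n)) (p : Pattern) (f : Fin p.1 → Fin n) : Prop :=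
  StrictMono f ∧ ∀ a b, π (f a) < π (f b) ↔ p.2 a < p.2 b

/-- The direct sum of two permutations. -/
def sumPerm {k l : ℕ} (p : Equiv.Perm (Fin k)) (q : Equiv.Perm (Fin l)) :
    Equiv.Perm (Fin (k + l)) :=
  finSumFinEquiv.symm.trans ((Equiv.sumCongr p q).trans finSumFinEquiv)

lemma sumPerm_castAdd {k l : ℕ} (p : Equiv.Perm (Fin k)) (q : Equiv.Perm (Fin l)) (a : Fin k) :
    sumPerm p q (Fin.castAdd l a) = Fin.castAdd l (p a) := by
  simp [sumPerm]

lemma sumPerm_natAdd {k l : ℕ} (p : Equiv.Perm (Fin k)) (q : Equiv.Perm (Fin l)) (a : Fin l) :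
    sumPerm p q (Fin.natAdd k a) = Fin.natAdd k (q a) := by
  simp [sumPerm]

/-- The direct sum of two patterns, with `q` placed above and to the right of `p`. -/
def dsum (p q : Pattern) : Pattern := ⟨p.1 + q.1, sumPerm p.2 q.2⟩

lemma castAdd_lt_natAdd {k l : ℕ} (a : Fin k) (b : Fin l) : Fin.castAdd l a < Fin.natAdd k b := by
  simp only [Fin.lt_def, Fin.val_castAdd, Fin.val_natAdd]
  omega

lemma castAdd_lt_castAdd {k l : ℕ} {a b : Fin k} :
    Fin.castAdd l a < Fin.castAdd l b ↔ a < b := Iff.rfl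

lemma natAdd_lt_natAdd {k l : ℕ} {a b : Fin l} : Fin.natAdd k a < Fin.natAdd k b ↔ a < b := by
  simp only [Fin.lt_def, Fin.val_natAdd]
  omega

lemma exists_occurrence_sumPerm {n k l : ℕ} {π : Equiv.Perm (Fin n)} {p : Equiv.Perm (Fin k)}
    {q : Equiv.Perm (Fin l)} :
    (∃ e : Fin (k + l) → Fin n, StrictMono e ∧
      ∀ a b, π (e a) < π (e b) ↔ sumPerm p q a < sumPerm p q b) ↔
    ∃ (f : Fin k → Fin n) (g : Fin l → Fin n),
      (StrictMono f ∧ ∀ a b, π (f a) < π (f b) ↔ p a < p b) ∧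
      (StrictMono g ∧ ∀ a b, π (g a) < π (g b) ↔ q a < q b) ∧
      ∀ a b, f a < g b ∧ π (f a) < π (g b) := by
  constructor
  · rintro ⟨e, he, ho⟩
    refine ⟨fun a => e (Fin.castAdd l a), fun b => e (Fin.natAdd k b),
      ⟨fun a b hab => he (castAdd_lt_castAdd.2 hab), fun a b => ?_⟩,
      ⟨fun a b hab => he (natAdd_lt_natAdd.2 hab), fun a b => ?_⟩,
      fun a b => ⟨he (castAdd_lt_natAdd a b), ?_⟩⟩
    · rw [ho, sumPerm_castAdd, sumPerm_castAdd, castAdd_lt_castAdd]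
    · rw [ho, sumPerm_natAdd, sumPerm_natAdd, natAdd_lt_natAdd]
    · rw [ho, sumPerm_castAdd, sumPerm_natAdd]
      exact castAdd_lt_natAdd _ _
  · rintro ⟨f, g, ⟨hf, hfo⟩, ⟨hg, hgo⟩, hfg⟩
    let e : Fin (k + l) → Fin n := Fin.addCases f g
    have hel : ∀ a, e (Fin.castAdd l a) = f a := fun a => Fin.addCases_left a
    have her : ∀ a, e (Fin.natAdd k a) = g a := fun a => Fin.addCases_right a
    refine ⟨e, fun a b hab => ?_, fun a b => ?_⟩
    · induction a using Fin.addCases with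
      | left a =>
        induction b using Fin.addCases with
        | left b =>
          rw [hel, hel]
          exact hf (castAdd_lt_castAdd.1 hab)
        | right b =>
          rw [hel, her]
          exact (hfg a b).1
      | right a =>
        induction b using Fin.addCases with
        | left b => exact absurd hab (castAdd_lt_natAdd b a).not_gt
        | right b =>
          rw [her, her]
          exact hg (natAdd_lt_natAdd.1 hab)
    · induction a using Fin.addCases with
      | left a =>
        induction b using Fin.addCases with
        | left b => rw [hel, hel, sumPerm_castAdd, sumPerm_castAdd, hfo, castAdd_lt_castAdd]
        | right b =>
          rw [hel, her, sumPerm_castAdd, sumPerm_natAdd]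
          exact iff_of_true (hfg a b).2 (castAdd_lt_natAdd _ _)
      | right a =>
        induction b using Fin.addCases with
        | left b =>
          rw [hel, her, sumPerm_castAdd, sumPerm_natAdd]
          exact iff_of_false (hfg b a).2.not_gt (castAdd_lt_natAdd _ _).not_gt
        | right b => rw [her, her, sumPerm_natAdd, sumPerm_natAdd, hgo, natAdd_lt_natAdd]

lemma permContains_dsum {n : ℕ} {π : Equiv.Perm (Fin n)} {p q : Pattern} :
    PermContains π (dsum p q) ↔ ∃ f g, IsOccurrence π p f ∧ IsOccurrence π q g ∧
      ∀ a b, f a < g b ∧ π (f a) < π (g b) :=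
  exists_occurrence_sumPerm

/-- The cells `(c, r)` of the grid with an occurrence of a pattern of `T` in the partial
permutation `κ` strictly above and to the right of them. -/
def Region {n : ℕ} (T : Set Pattern) (κ : Fin n → Option (Fin n)) (c r : Fin n) : Prop :=
  ∃ q ∈ T, ∃ g v : Fin q.1 → Fin n, StrictMono g ∧ (∀ a, κ (g a) = some (v a)) ∧
    (∀ a b, v a < v b ↔ q.2 a < q.2 b) ∧ ∀ a, c < g a ∧ r < v a

lemma Region.anti {n : ℕ} {T : Set Pattern} {κ : Fin n → Option (Fin n)} {c r c' r' : Fin n}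
    (h : Region T κ c r) (hc : c' ≤ c) (hr : r' ≤ r) : Region T κ c' r' := by
  obtain ⟨q, hq, g, v, h1, h2, h3, h4⟩ := h
  exact ⟨q, hq, g, v, h1, h2, h3, fun a => ⟨hc.trans_lt (h4 a).1, hr.trans_lt (h4 a).2⟩⟩

/-- The `Region` of a permutation. -/
abbrev FullRegion {n : ℕ} (T : Set Pattern) (π : Equiv.Perm (Fin n)) : Fin n → Fin n → Prop :=
  Region T fun i => some (π i)

lemma exists_dsum_iff {n : ℕ} {T : Set Pattern} {π : Equiv.Perm (Fin n)} {p : Pattern}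
    (hp : 0 < p.1) :
    (∃ q ∈ T, PermContains π (dsum p q)) ↔
      ∃ f, IsOccurrence π p f ∧ ∀ a b, FullRegion T π (f a) (π (f b)) := by
  constructor
  · rintro ⟨q, hq, h⟩
    obtain ⟨f, g, hf, hg, hfg⟩ := permContains_dsum.1 h
    exact ⟨f, hf, fun a b => ⟨q, hq, g, fun i => π (g i), hg.1, fun _ => rfl, hg.2,
      fun x => ⟨(hfg a x).1, (hfg b x).2⟩⟩⟩
  · rintro ⟨f, hf, h⟩
    have : Nonempty (Fin p.1) := ⟨⟨0, hp⟩⟩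
    obtain ⟨a, ha⟩ := Finite.exists_max f
    obtain ⟨b, hb⟩ := Finite.exists_max fun x => π (f x)
    obtain ⟨q, hq, g, v, h1, h2, h3, h4⟩ := h a b
    obtain rfl : v = fun x => π (g x) := funext fun x => (Option.some.inj (h2 x)).symm
    exact ⟨q, hq, permContains_dsum.2 ⟨f, g, hf, ⟨h1, h3⟩, fun x y =>
      ⟨(ha x).trans_lt (h4 y).1, (hb x).trans_lt (h4 y).2⟩⟩⟩

lemma region_eq_fullRegion {n : ℕ} {T : Set Pattern} {π : Equiv.Perm (Fin n)}
    {κ : Fin n → Option (Fin n)}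
    (h : ∀ i, κ i = some (π i) ∨ κ i = none ∧ FullRegion T π i (π i)) :
    Region T κ = FullRegion T π := by
  have full : ∀ c, ∀ r, FullRegion T π c r → Region T κ c r := by
    intro c
    induction c using WellFoundedGT.induction with
    | ind c ih =>
      rintro r ⟨q, hq, g, v, h1, h2, h3, h4⟩
      by_cases hall : ∀ a, κ (g a) = some (v a)
      · exact ⟨q, hq, g, v, h1, hall, h3, h4⟩
      · push Not at hall
        obtain ⟨a, ha⟩ := hall
        have hv := Option.some.inj (h2 a)
        obtain h5 | ⟨-, h5⟩ := h (g a)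
        · exact absurd (h5.trans (h2 a)) ha
        · exact (ih _ (h4 a).1 _ h5).anti (h4 a).1.le (hv ▸ (h4 a).2.le)
  ext c r
  refine ⟨?_, full c r⟩
  rintro ⟨q, hq, g, v, h1, h2, h3, h4⟩
  refine ⟨q, hq, g, v, h1, fun a => ?_, h3, h4⟩
  obtain h5 | ⟨h5, -⟩ := h (g a)
  · rw [← h2 a, h5]
  · simp [h2 a] at h5

open Classical in
/-- The part of `π` outside of the region of `T`. -/
noncomputable def key {n : ℕ} (T : Set Pattern) (π : Equiv.Perm (Fin n)) (i : Fin n) :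
    Option (Fin n) :=
  if FullRegion T π i (π i) then none else some (π i)

lemma region_key {n : ℕ} (T : Set Pattern) (π : Equiv.Perm (Fin n)) :
    Region T (key T π) = FullRegion T π := by
  refine region_eq_fullRegion fun i => ?_
  unfold key
  split_ifs with h <;> simp [h]

open Classical in
lemma key_eq_iff {n : ℕ} {T : Set Pattern} {π : Equiv.Perm (Fin n)} {κ : Fin n → Option (Fin n)} :
    key T π = κ ↔ ∀ i, κ i = if Region T κ i (π i) then none else some (π i) := by
  constructor
  · rintro rfl i
    rw [region_key]
    rfl
  · intro h
    have hR : Region T κ = FullRegion T π := by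
      refine region_eq_fullRegion fun i => ?_
      have := h i
      split_ifs at this with hi
      · refine .inr ⟨this, ?_⟩
        obtain ⟨q, hq, g, v, h1, h2, h3, h4⟩ := hi
        refine ⟨q, hq, g, v, h1, fun a => ?_, h3, h4⟩
        have := h (g a)
        rw [h2 a] at this
        split_ifs at this
        exact this.symm
      · exact .inl this
    ext1 i
    rw [h i, hR]
    rfl

/-- Permutations of `Fin m` in the board with column heights `h` for which no occurrence of a
pattern of `A` has its enclosing rectangle in the board. -/
def boardAvoiders (A : Set Pattern) (m : ℕ) (h : ℕ → ℕ) : Set (Equiv.Perm (Fin m)) :=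
  {σ | (∀ i, (σ i : ℕ) < h i) ∧
    ∀ p ∈ A, ¬ ∃ f, IsOccurrence σ p f ∧ ∀ a b, (σ (f b) : ℕ) < h (f a)}

/-- Shape-Wilf-equivalence of sets of patterns. -/
def ShapeWilfEquiv (A A' : Set Pattern) : Prop :=
  ∀ m h, Antitone h → (∀ i, h i ≤ m) → (boardAvoiders A m h).ncard = (boardAvoiders A' m h).ncard

/-- Permutations agreeing with `π₀` off `C` correspond to permutations of `Fin C.card`. -/
lemma exists_equiv_of_eqOn_compl {n : ℕ} (π₀ : Equiv.Perm (Fin n)) (C : Finset (Fin n)) :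
    ∃ (c ρ : Fin C.card ↪o Fin n)
      (e : {π : Equiv.Perm (Fin n) // ∀ i ∉ C, π i = π₀ i} ≃ Equiv.Perm (Fin C.card)),
      (∀ i, i ∈ C ↔ ∃ a, c a = i) ∧ ∀ π a, π.1 (c a) = ρ (e π a) := by
  classical
  set c := C.orderEmbOfFin rfl with hc
  set ρ := (C.map π₀.toEmbedding).orderEmbOfFin (Finset.card_map _) with hρ
  have hcr : ∀ i, i ∈ C ↔ ∃ a, c a = i := fun i => by
    have := Finset.range_orderEmbOfFin C rfl
    rw [← Finset.mem_coe, ← this]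
    rfl
  have hρr : ∀ j, (∃ i ∈ C, π₀ i = j) ↔ ∃ a, ρ a = j := fun j => by
    have := Finset.range_orderEmbOfFin (C.map π₀.toEmbedding) (Finset.card_map _)
    have hmem : (∃ i ∈ C, π₀ i = j) ↔ j ∈ (C.map π₀.toEmbedding : Set (Fin n)) := by
      rw [Finset.mem_coe, Finset.mem_map]
      rfl
    rw [hmem, ← this]
    rfl
  have hval : ∀ (π : {π : Equiv.Perm (Fin n) // ∀ i ∉ C, π i = π₀ i}) (a : Fin C.card),
      ∃ b, π.1 (c a) = ρ b := by
    intro π a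
    obtain ⟨j, hj⟩ := π₀.surjective (π.1 (c a))
    have hjC : j ∈ C := by
      by_contra hjC
      rw [← π.2 j hjC] at hj
      exact hjC ((hcr j).2 ⟨a, (π.1.injective hj).symm⟩)
    obtain ⟨b, hb⟩ := (hρr _).1 ⟨j, hjC, hj⟩
    exact ⟨b, hb.symm⟩
  choose s hs using hval
  have hinj : ∀ π, Function.Injective (s π) := by
    intro π a b hab
    apply c.injective
    apply π.1.injective
    rw [hs, hs, hab]
  let F : {π : Equiv.Perm (Fin n) // ∀ i ∉ C, π i = π₀ i} → Equiv.Perm (Fin C.card) :=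
    fun π => Equiv.ofBijective (s π) (Finite.injective_iff_bijective.1 (hinj π))
  have hF : Function.Bijective F := by
    constructor
    · intro π π' h
      ext i : 2
      by_cases hi : i ∈ C
      · obtain ⟨a, rfl⟩ := (hcr i).1 hi
        rw [hs, hs]
        exact congrArg ρ (Equiv.congr_fun h a)
      · rw [π.2 i hi, π'.2 i hi]
    · intro σ
      have hcov : ∀ i, ∃ j, (∀ a, c a = i → j = ρ (σ a)) ∧ (i ∉ C → j = π₀ i) := by
        intro i
        by_cases hi : i ∈ C
        · obtain ⟨a, rfl⟩ := (hcr i).1 hi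
          exact ⟨ρ (σ a), fun b hb => by rw [c.injective hb], fun h => absurd hi h⟩
        · exact ⟨π₀ i, fun a ha => absurd ((hcr i).2 ⟨a, ha⟩) hi, fun _ => rfl⟩
      choose P hP1 hP2 using hcov
      have hne : ∀ a j, j ∉ C → ρ a ≠ π₀ j := by
        intro a j hj h
        obtain ⟨i, hi, h'⟩ := (hρr _).2 ⟨a, rfl⟩
        exact hj (π₀.injective (h'.trans h) ▸ hi)
      have hPinj : Function.Injective P := by
        intro i j hij
        by_cases hi : i ∈ C <;> by_cases hj : j ∈ C
        · obtain ⟨a, rfl⟩ := (hcr i).1 hi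
          obtain ⟨b, rfl⟩ := (hcr j).1 hj
          rw [hP1 _ a rfl, hP1 _ b rfl] at hij
          rw [σ.injective (ρ.injective hij)]
        · obtain ⟨a, rfl⟩ := (hcr i).1 hi
          rw [hP1 _ a rfl, hP2 _ hj] at hij
          exact absurd hij (hne _ _ hj)
        · obtain ⟨b, rfl⟩ := (hcr j).1 hj
          rw [hP1 _ b rfl, hP2 _ hi] at hij
          exact absurd hij.symm (hne _ _ hi)
        · rw [hP2 _ hi, hP2 _ hj] at hij
          exact π₀.injective hij
      refine ⟨⟨Equiv.ofBijective P (Finite.injective_iff_bijective.1 hPinj), hP2⟩, ?_⟩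
      ext a : 1
      apply ρ.injective
      rw [← hP1 _ a rfl]
      exact (hs _ a).symm
  exact ⟨c, ρ, Equiv.ofBijective F hF, hcr, hs⟩

lemma lt_card_filter_iff {m : ℕ} {P : Fin m → Prop} [DecidablePred P]
    (hP : ∀ i j, i ≤ j → P j → P i) (j : Fin m) : (j : ℕ) < (Finset.univ.filter P).card ↔ P j := by
  constructor
  · intro h
    by_contra hj
    have : Finset.univ.filter P ⊆ Finset.Iio j := by
      intro i hi
      simp only [Finset.mem_filter, Finset.mem_univ, true_and, Finset.mem_Iio] at hi ⊢
      by_contra hij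
      exact hj (hP j i (not_lt.1 hij) hi)
    have := Finset.card_le_card this
    rw [Fin.card_Iio] at this
    omega
  · intro h
    have : Finset.Iic j ⊆ Finset.univ.filter P := by
      intro i hi
      simpa using hP i j (by simpa using hi) h
    have := Finset.card_le_card this
    rw [Fin.card_Iic] at this
    omega

/-- Permutations without an occurrence of a pattern of `A` whose enclosing rectangle lies in the
region of `T`. -/
def regionAvoiders {n : ℕ} (A T : Set Pattern) : Set (Equiv.Perm (Fin n)) :=
  {π | ∀ p ∈ A, ¬ ∃ f, IsOccurrence π p f ∧ ∀ a b, FullRegion T π (f a) (π (f b))}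

lemma exists_ncard_fiber_eq {n : ℕ} (T : Set Pattern) (π₀ : Equiv.Perm (Fin n)) :
    ∃ m h, Antitone h ∧ (∀ i, h i ≤ m) ∧ ∀ A, (∀ p ∈ A, 0 < p.1) →
      {π | π ∈ regionAvoiders A T ∧ key T π = key T π₀}.ncard = (boardAvoiders A m h).ncard := by
  classical
  set κ := key T π₀ with hκ
  set C : Finset (Fin n) := Finset.univ.filter fun i => κ i = none with hC
  obtain ⟨c, ρ, e, hc, he⟩ := exists_equiv_of_eqOn_compl π₀ C
  have h₀ := key_eq_iff.1 hκ.symm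
  let h : ℕ → ℕ := fun i =>
    (Finset.univ.filter fun j => ∃ hi : i < C.card, Region T κ (c ⟨i, hi⟩) (ρ j)).card
  have hlt : ∀ i j : Fin C.card, (j : ℕ) < h i ↔ Region T κ (c i) (ρ j) := by
    intro i j
    rw [lt_card_filter_iff]
    · exact ⟨fun ⟨_, h⟩ => h, fun h => ⟨i.isLt, h⟩⟩
    · rintro j k hjk ⟨hi, h⟩
      exact ⟨hi, h.anti le_rfl (ρ.monotone hjk)⟩
  refine ⟨C.card, h, ?_, ?_, fun A hA => ?_⟩
  · intro i j hij
    refine Finset.card_le_card fun k hk => ?_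
    simp only [Finset.mem_filter, Finset.mem_univ, true_and] at hk ⊢
    obtain ⟨hj, hk⟩ := hk
    exact ⟨hij.trans_lt hj, hk.anti (c.monotone hij) le_rfl⟩
  · intro i
    exact (Finset.card_le_univ _).trans_eq (Fintype.card_fin _)
  · have hagree : ∀ π, key T π = κ → ∀ i ∉ C, π i = π₀ i := by
      intro π hπ i hi
      have h1 := key_eq_iff.1 hπ i
      have h2 := h₀ i
      simp only [hC, Finset.mem_filter, Finset.mem_univ, true_and] at hi
      split_ifs at h1 h2 <;> first | exact absurd ‹_› hi | skip
      exact Option.some.inj (h1.symm.trans h2)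
    have hkey : ∀ π : {π : Equiv.Perm (Fin n) // ∀ i ∉ C, π i = π₀ i},
        key T π.1 = κ ↔ ∀ i, (e π i : ℕ) < h i := by
      intro π
      rw [key_eq_iff]
      constructor
      · intro hπ i
        rw [hlt, ← he]
        have h1 := hπ (c i)
        have h2 : κ (c i) = none := by simpa [hC] using (hc (c i)).2 ⟨i, rfl⟩
        by_contra h3
        rw [if_neg h3, h2] at h1
        cases h1
      · intro hπ i
        by_cases hi : i ∈ C
        · obtain ⟨a, rfl⟩ := (hc i).1 hi
          rw [he, if_pos ((hlt _ _).1 (hπ a))]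
          simpa [hC] using hi
        · rw [π.2 i hi]
          exact h₀ i
    have hocc : ∀ π : {π : Equiv.Perm (Fin n) // ∀ i ∉ C, π i = π₀ i}, key T π.1 = κ →
        ∀ p : Pattern,
        ((∃ f, IsOccurrence π.1 p f ∧ ∀ a b, FullRegion T π.1 (f a) (π.1 (f b))) ↔
        ∃ f, IsOccurrence (e π) p f ∧ ∀ a b, (e π (f b) : ℕ) < h (f a)) := by
      intro π hπ p
      rw [← region_key, hπ]
      constructor
      · rintro ⟨f, ⟨hf, hfo⟩, hR⟩
        have hfC : ∀ a, ∃ b, c b = f a := by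
          intro a
          have h1 := key_eq_iff.1 hπ (f a)
          rw [if_pos (hR a a)] at h1
          exact (hc _).1 (by simpa [hC] using h1)
        choose g hg using hfC
        refine ⟨g, ⟨fun a b hab => ?_, fun a b => ?_⟩, fun a b => ?_⟩
        · rw [← c.lt_iff_lt, hg, hg]
          exact hf hab
        · rw [← ρ.lt_iff_lt, ← he, ← he, hg, hg]
          exact hfo a b
        · rw [hlt, ← he, hg, hg]
          exact hR a b
      · rintro ⟨g, ⟨hg, hgo⟩, hR⟩
        refine ⟨fun a => c (g a), ⟨fun a b hab => c.lt_iff_lt.2 (hg hab), fun a b => ?_⟩,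
          fun a b => ?_⟩
        · rw [he, he, ρ.lt_iff_lt]
          exact hgo a b
        · rw [he]
          exact (hlt _ _).1 (hR a b)
    refine Set.ncard_congr (fun π hπ => e ⟨π, hagree π hπ.2⟩) ?_ ?_ ?_
    · rintro π ⟨h1, h2⟩
      refine ⟨(hkey ⟨π, hagree π h2⟩).1 h2, fun p hp => ?_⟩
      rw [← hocc ⟨π, hagree π h2⟩ h2]
      exact h1 p hp
    · intro π π' _ _ hπ
      exact congrArg Subtype.val (e.injective hπ)
    · rintro σ ⟨h1, h2⟩
      obtain ⟨π, rfl⟩ := e.surjective σ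
      have h3 := (hkey π).2 h1
      refine ⟨π.1, ⟨fun p hp => ?_, h3⟩, rfl⟩
      rw [hocc π h3]
      exact h2 p hp

lemma ncard_regionAvoiders_congr {n : ℕ} {A A' T : Set Pattern} (h : ShapeWilfEquiv A A')
    (hA : ∀ p ∈ A, 0 < p.1) (hA' : ∀ p ∈ A', 0 < p.1) :
    (regionAvoiders (n := n) A T).ncard = (regionAvoiders (n := n) A' T).ncard := by
  classical
  have key_sum : ∀ B : Set Pattern, (regionAvoiders (n := n) B T).ncard =
      ∑ κ : Fin n → Option (Fin n), {π | π ∈ regionAvoiders (n := n) B T ∧ key T π = κ}.ncard := by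
    intro B
    rw [Set.ncard_eq_toFinset_card', Finset.card_eq_sum_card_fiberwise (f := key T)
      (t := Finset.univ) (by simp)]
    refine Finset.sum_congr rfl fun κ _ => ?_
    rw [Set.ncard_eq_toFinset_card']
    congr 1
    ext π
    simp
  rw [key_sum, key_sum]
  refine Finset.sum_congr rfl fun κ _ => ?_
  by_cases hκ : ∃ π₀ : Equiv.Perm (Fin n), key T π₀ = κ
  · obtain ⟨π₀, rfl⟩ := hκ
    obtain ⟨m, hts, h1, h2, h3⟩ := exists_ncard_fiber_eq T π₀
    rw [h3 A hA, h3 A' hA', h m hts h1 h2]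
  · push Not at hκ
    simp [hκ]

lemma avoidsSet_image2_dsum_iff {n : ℕ} {A T : Set Pattern} {π : Equiv.Perm (Fin n)}
    (hA : ∀ p ∈ A, 0 < p.1) :
    AvoidsSet π (Set.image2 dsum A T) ↔ π ∈ regionAvoiders A T := by
  rw [AvoidsSet, Set.forall_mem_image2]
  refine forall₂_congr fun p hp => ?_
  rw [← exists_dsum_iff (hA p hp)]
  push Not
  rfl

/-- Shape-Wilf-equivalent sets remain Wilf-equivalent after adding the same patterns above and to
the right. -/
theorem ShapeWilfEquiv.wilfEquiv_image2 {A A' : Set Pattern} (h : ShapeWilfEquiv A A')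
    (hA : ∀ p ∈ A, 0 < p.1) (hA' : ∀ p ∈ A', 0 < p.1) (T : Set Pattern) :
    WilfEquiv (Set.image2 dsum A T) (Set.image2 dsum A' T) := by
  intro n _
  simp only [avoidsSet_image2_dsum_iff hA, avoidsSet_image2_dsum_iff hA']
  exact ncard_regionAvoiders_congr h hA hA'

/-- On Ferrers boards, the occurrences of patterns of `A` are the triples satisfying `Q`. -/
def Encodes (A : Set Pattern) (Q : ℕ → ℕ → ℕ → Prop) : Prop :=
  ∀ (m : ℕ) (σ : Equiv.Perm (Fin m)) (h : ℕ → ℕ), Antitone h → (∀ i, (σ i : ℕ) < h i) →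
    ((∃ p ∈ A, ∃ f, IsOccurrence σ p f ∧ ∀ a b, (σ (f b) : ℕ) < h (f a)) ↔
      ∃ i j k, i ≤ j ∧ j < k ∧ (σ i : ℕ) < h k ∧ (σ j : ℕ) < h k ∧ Q (σ i) (σ j) (σ k))

lemma Encodes.union {A A' : Set Pattern} {Q Q' : ℕ → ℕ → ℕ → Prop} (h : Encodes A Q)
    (h' : Encodes A' Q') : Encodes (A ∪ A') fun x y z => Q x y z ∨ Q' x y z := by
  intro m σ t ht hσ
  simp only [Set.mem_union, or_and_right, exists_or, h m σ t ht hσ, h' m σ t ht hσ, and_or_left]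

lemma Encodes.ncard_boardAvoiders {A : Set Pattern} {Q : ℕ → ℕ → ℕ → Prop} (hA : Encodes A Q)
    (m : ℕ) {h : ℕ → ℕ} (hh : Antitone h) :
    (boardAvoiders A m h).ncard = (placements Q m h).card := by
  rw [← Set.ncard_coe_finset]
  congr 1
  ext σ
  simp only [boardAvoiders, placements, Set.mem_ofPred_eq, Finset.coe_filter, Finset.mem_univ,
    true_and]
  refine and_congr_right fun hσ => ?_
  have := not_congr (hA m σ h hh hσ)
  push Not at this
  simpa only [not_exists, not_and, not_forall, not_lt] using this

lemma ShapeWilfEquiv.of_encodes {A A' : Set Pattern} {Q Q' : ℕ → ℕ → ℕ → Prop} (hA : Encodes A Q)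
    (hA' : Encodes A' Q') (h : ∀ m h, Antitone h → (∀ i, h i ≤ m) →
      (placements Q m h).card = (placements Q' m h).card) : ShapeWilfEquiv A A' := by
  intro m t ht hm
  rw [hA.ncard_boardAvoiders m ht, hA'.ncard_boardAvoiders m ht, h m t ht hm]

lemma encodes_three (v : Fin 3 → Fin 3) (hv : Function.Bijective v) {Q : ℕ → ℕ → ℕ → Prop}
    (hQ : ∀ x y z, Q x y z ↔ ∀ a b, ![x, y, z] a < ![x, y, z] b ↔ v a < v b) :
    Encodes {mkPattern v hv} Q := by
  intro m σ h hh hσ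
  rw [show (∃ p ∈ ({mkPattern v hv} : Set Pattern), ∃ f, IsOccurrence σ p f ∧
      ∀ a b, (σ (f b) : ℕ) < h (f a)) ↔ ∃ f : Fin 3 → Fin m, (StrictMono f ∧
        ∀ a b, σ (f a) < σ (f b) ↔ v a < v b) ∧ ∀ a b, (σ (f b) : ℕ) < h (f a) from
    exists_eq_left]
  have hcomp : ∀ (f : Fin 3 → Fin m) a, ![(σ (f 0) : ℕ), σ (f 1), σ (f 2)] a = σ (f a) := by
    intro f a
    fin_cases a <;> rfl
  constructor
  · rintro ⟨f, ⟨hf, ho⟩, hb⟩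
    refine ⟨f 0, f 1, f 2, (hf (by decide)).le, hf (by decide), hb _ _, hb _ _, ?_⟩
    rw [hQ]
    intro a b
    rw [hcomp, hcomp, ← ho]
    rfl
  · rintro ⟨i, j, k, hij, hjk, hik, hjk', hq⟩
    rw [hQ] at hq
    have hne : i ≠ j := by
      rintro rfl
      have h1 := hq 0 1
      have h2 := hq 1 0
      have h3 : v 0 ≠ v 1 := hv.injective.ne (by decide)
      simp at h1 h2
      exact h3 (le_antisymm h2 h1)
    have hlt := lt_of_le_of_ne hij hne
    have hc := hcomp ![i, j, k]
    refine ⟨![i, j, k], ⟨?_, fun a b => ?_⟩, fun a b => ?_⟩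
    · rw [Fin.strictMono_iff_lt_succ]
      intro a
      fin_cases a
      · exact hlt
      · exact hjk
    · rw [← hq]
      exact (iff_of_eq (congrArg₂ (· < ·) (hc a) (hc b))).symm
    · have h1 : (σ (![i, j, k] b) : ℕ) < h k := by
        fin_cases b
        · exact hik
        · exact hjk'
        · exact hσ k
      refine h1.trans_le (hh ?_)
      fin_cases a
      · exact (hlt.trans hjk).le
      · exact hjk.le
      · exact le_rfl

lemma encodes_two (v : Fin 2 → Fin 2) (hv : Function.Bijective v) {Q : ℕ → ℕ → ℕ → Prop}
    (hQ : ∀ w x y, Q w x y ↔ ∀ a b, ![x, y] a < ![x, y] b ↔ v a < v b) :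
    Encodes {mkPattern v hv} Q := by
  intro m σ h hh hσ
  rw [show (∃ p ∈ ({mkPattern v hv} : Set Pattern), ∃ f, IsOccurrence σ p f ∧
      ∀ a b, (σ (f b) : ℕ) < h (f a)) ↔ ∃ f : Fin 2 → Fin m, (StrictMono f ∧
        ∀ a b, σ (f a) < σ (f b) ↔ v a < v b) ∧ ∀ a b, (σ (f b) : ℕ) < h (f a) from
    exists_eq_left]
  have hcomp : ∀ (f : Fin 2 → Fin m) a, ![(σ (f 0) : ℕ), σ (f 1)] a = σ (f a) := by
    intro f a
    fin_cases a <;> rfl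
  constructor
  · rintro ⟨f, ⟨hf, ho⟩, hb⟩
    refine ⟨f 0, f 0, f 1, le_rfl, hf (by decide), hb _ _, hb _ _, ?_⟩
    rw [hQ]
    intro a b
    rw [hcomp, hcomp, ← ho]
    rfl
  · rintro ⟨_, j, k, _, hjk, _, hjk', hq⟩
    rw [hQ] at hq
    have hc := hcomp ![j, k]
    refine ⟨![j, k], ⟨?_, fun a b => ?_⟩, fun a b => ?_⟩
    · rw [Fin.strictMono_iff_lt_succ]
      intro a
      fin_cases a
      exact hjk
    · rw [← hq]
      exact (iff_of_eq (congrArg₂ (· < ·) (hc a) (hc b))).symm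
    · have h1 : (σ (![j, k] b) : ℕ) < h k := by
        fin_cases b
        · exact hjk'
        · exact hσ k
      refine h1.trans_le (hh ?_)
      fin_cases a
      · exact hjk.le
      · exact le_rfl

lemma encodes_12 : Encodes {mkPattern ![0, 1]} P12 :=
  encodes_two _ _ fun _ x y => by simp [Fin.forall_fin_succ, P12]; omega

lemma encodes_21 : Encodes {mkPattern ![1, 0]} P21 :=
  encodes_two _ _ fun _ x y => by simp [Fin.forall_fin_succ, P21]; omega

lemma encodes_123 : Encodes {mkPattern ![0, 1, 2]} P123 :=
  encodes_three _ _ fun x y z => by simp [Fin.forall_fin_succ, P123]; omega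

lemma encodes_132 : Encodes {mkPattern ![0, 2, 1]} P132 :=
  encodes_three _ _ fun x y z => by simp [Fin.forall_fin_succ, P132]; omega

lemma encodes_213 : Encodes {mkPattern ![1, 0, 2]} P213 :=
  encodes_three _ _ fun x y z => by simp [Fin.forall_fin_succ, P213]; omega

lemma encodes_231 : Encodes {mkPattern ![1, 2, 0]} P231 :=
  encodes_three _ _ fun x y z => by simp [Fin.forall_fin_succ, P231]; omega

lemma encodes_312 : Encodes {mkPattern ![2, 0, 1]} P312 :=
  encodes_three _ _ fun x y z => by simp [Fin.forall_fin_succ, P312]; omega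

lemma encodes_321 : Encodes {mkPattern ![2, 1, 0]} P321 :=
  encodes_three _ _ fun x y z => by simp [Fin.forall_fin_succ, P321]; omega

theorem shapeWilfEquiv_12_21 : ShapeWilfEquiv {mkPattern ![0, 1]} {mkPattern ![1, 0]} :=
  .of_encodes encodes_12 encodes_21 <| card_placements_eq_of_hasSites
    (fun _ _ _ _ => skip_lt_skip) (fun _ _ _ _ => skip_lt_skip) hasSites_12 hasSites_21

theorem shapeWilfEquiv_213_321 :
    ShapeWilfEquiv {mkPattern ![1, 0, 2]} {mkPattern ![2, 1, 0]} :=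
  .of_encodes encodes_213 encodes_321 card_placements_213_eq_321

lemma ShapeWilfEquiv.of_hasSites {p q p' q' : Pattern} {P Q P' Q' : ℕ → ℕ → ℕ → Prop} {κ : ℕ → ℕ}
    (hp : Encodes {p} P) (hq : Encodes {q} Q) (hp' : Encodes {p'} P') (hq' : Encodes {q'} Q')
    (h : HasSites (fun x y z => P x y z ∨ Q x y z) κ)
    (h' : HasSites (fun x y z => P' x y z ∨ Q' x y z) κ)
    (hs : SkipInvariant fun x y z => P x y z ∨ Q x y z)
    (hs' : SkipInvariant fun x y z => P' x y z ∨ Q' x y z) :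
    ShapeWilfEquiv {p, q} {p', q'} := by
  rw [← Set.singleton_union, ← Set.singleton_union]
  exact .of_encodes (hp.union hq) (hp'.union hq') (card_placements_eq_of_hasSites hs hs' h h')

lemma SkipInvariant.or {Q Q' : ℕ → ℕ → ℕ → Prop} (h : SkipInvariant Q) (h' : SkipInvariant Q') :
    SkipInvariant fun x y z => Q x y z ∨ Q' x y z :=
  fun r x y z => or_congr (h r x y z) (h' r x y z)

lemma skipInvariant_123 : SkipInvariant P123 := fun _ _ _ _ => by simp only [P123, skip_lt_skip]

lemma skipInvariant_132 : SkipInvariant P132 := fun _ _ _ _ => by simp only [P132, skip_lt_skip]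

lemma skipInvariant_231 : SkipInvariant P231 := fun _ _ _ _ => by simp only [P231, skip_lt_skip]

lemma skipInvariant_312 : SkipInvariant P312 := fun _ _ _ _ => by simp only [P312, skip_lt_skip]

theorem shapeWilfEquiv_213_132 :
    ShapeWilfEquiv {mkPattern ![1, 0, 2], mkPattern ![0, 2, 1]}
      {mkPattern ![0, 1, 2], mkPattern ![1, 0, 2]} :=
  .of_hasSites encodes_213 encodes_132 encodes_123 encodes_213 hasSites_213_132 hasSites_123_213
    (skipInvariant_213.or skipInvariant_132) (skipInvariant_123.or skipInvariant_213)

theorem shapeWilfEquiv_213_231 :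
    ShapeWilfEquiv {mkPattern ![1, 0, 2], mkPattern ![1, 2, 0]}
      {mkPattern ![0, 1, 2], mkPattern ![1, 0, 2]} :=
  .of_hasSites encodes_213 encodes_231 encodes_123 encodes_213 hasSites_213_231 hasSites_123_213
    (skipInvariant_213.or skipInvariant_231) (skipInvariant_123.or skipInvariant_213)

theorem shapeWilfEquiv_132_312 :
    ShapeWilfEquiv {mkPattern ![0, 2, 1], mkPattern ![2, 0, 1]}
      {mkPattern ![0, 1, 2], mkPattern ![1, 0, 2]} :=
  .of_hasSites encodes_132 encodes_312 encodes_123 encodes_213 hasSites_132_312 hasSites_123_213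
    (skipInvariant_132.or skipInvariant_312) (skipInvariant_123.or skipInvariant_213)

theorem shapeWilfEquiv_231_312 :
    ShapeWilfEquiv {mkPattern ![1, 2, 0], mkPattern ![2, 0, 1]}
      {mkPattern ![0, 1, 2], mkPattern ![1, 0, 2]} :=
  .of_hasSites encodes_231 encodes_312 encodes_123 encodes_213 hasSites_231_312 hasSites_123_213
    (skipInvariant_231.or skipInvariant_312) (skipInvariant_123.or skipInvariant_213)

theorem shapeWilfEquiv_231_321 :
    ShapeWilfEquiv {mkPattern ![1, 2, 0], mkPattern ![2, 1, 0]}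
      {mkPattern ![0, 1, 2], mkPattern ![1, 0, 2]} :=
  .of_hasSites encodes_231 encodes_321 encodes_123 encodes_213 hasSites_231_321 hasSites_123_213
    (skipInvariant_231.or skipInvariant_321) (skipInvariant_123.or skipInvariant_213)

lemma WilfEquiv.symm {S T : Set Pattern} (h : WilfEquiv S T) : WilfEquiv T S :=
  fun n hn => (h n hn).symm

lemma WilfEquiv.trans {S T U : Set Pattern} (h : WilfEquiv S T) (h' : WilfEquiv T U) :
    WilfEquiv S U :=
  fun n hn => (h n hn).trans (h' n hn)

/-- A symmetry of permutations compatible with containment preserves Wilf-equivalence classes. -/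
lemma wilfEquiv_image {φ : Pattern → Pattern}
    (Φ : ∀ n, Equiv.Perm (Fin n) ≃ Equiv.Perm (Fin n))
    (h : ∀ n π p, PermContains (Φ n π) (φ p) ↔ PermContains π p) (S : Set Pattern) :
    WilfEquiv S (φ '' S) := fun n _ =>
  Nat.card_congr <| (Φ n).subtypeEquiv fun π => by simp only [AvoidsSet, Set.forall_mem_image, h]

/-- The inverse of a pattern. -/
def Pattern.inv (p : Pattern) : Pattern := ⟨p.1, p.2.symm⟩

/-- The reverse complement of a permutation. -/
def revCompl {k : ℕ} (π : Equiv.Perm (Fin k)) : Equiv.Perm (Fin k) :=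
  Fin.revPerm.trans (π.trans Fin.revPerm)

lemma revCompl_apply {k : ℕ} (π : Equiv.Perm (Fin k)) (i : Fin k) :
    revCompl π i = (π i.rev).rev := rfl

lemma revCompl_revCompl {k : ℕ} (π : Equiv.Perm (Fin k)) : revCompl (revCompl π) = π := by
  ext i
  simp [revCompl_apply]

/-- The reverse complement of a pattern. -/
def Pattern.revCompl (p : Pattern) : Pattern := ⟨p.1, _root_.revCompl p.2⟩

lemma PermContains.symm {n : ℕ} {π : Equiv.Perm (Fin n)} {p : Pattern} (h : PermContains π p) :
    PermContains π.symm p.inv := by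
  obtain ⟨k, p⟩ := p
  obtain ⟨f, hf, ho⟩ := h
  refine ⟨fun a : Fin k => π (f (p.symm a)), fun (a b : Fin k) hab => (ho _ _).2 ?_, fun a b => ?_⟩
  · change p (p.symm a) < p (p.symm b)
    rwa [Equiv.apply_symm_apply, Equiv.apply_symm_apply]
  · simp only [Equiv.symm_apply_apply, hf.lt_iff_lt]
    rfl

lemma PermContains.revCompl {n : ℕ} {π : Equiv.Perm (Fin n)} {p : Pattern}
    (h : PermContains π p) : PermContains (revCompl π) p.revCompl := by
  obtain ⟨k, p⟩ := p
  obtain ⟨f, hf, ho⟩ := h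
  refine ⟨fun a : Fin k => (f a.rev).rev,
    fun a b hab => Fin.rev_lt_rev.2 (hf (Fin.rev_lt_rev.2 hab)), fun a b => ?_⟩
  simp only [revCompl_apply, Fin.rev_rev, Fin.rev_lt_rev]
  exact (ho _ _).trans Fin.rev_lt_rev.symm

theorem wilfEquiv_inv (S : Set Pattern) : WilfEquiv S (Pattern.inv '' S) :=
  wilfEquiv_image (fun _ => ⟨Equiv.symm, Equiv.symm, fun _ => rfl, fun _ => rfl⟩)
    (fun _ _ _ => ⟨PermContains.symm, PermContains.symm⟩) S

theorem wilfEquiv_revCompl (S : Set Pattern) : WilfEquiv S (Pattern.revCompl '' S) :=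
  wilfEquiv_image (fun _ => ⟨revCompl, revCompl, revCompl_revCompl, revCompl_revCompl⟩)
    (fun _ π p => ⟨fun h => by
      have := h.revCompl
      rwa [Pattern.revCompl, Pattern.revCompl, Equiv.coe_fn_mk, revCompl_revCompl,
        revCompl_revCompl] at this, PermContains.revCompl⟩) S

lemma inv_mkPattern {k : ℕ} {v w : Fin k → Fin k} (hv : Function.Bijective v)
    (hw : Function.Bijective w) (h : ∀ i, w (v i) = i) :
    (mkPattern v hv).inv = mkPattern w hw := by
  refine congrArg (Sigma.mk k) (Equiv.ext fun i => ?_)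
  refine (Equiv.symm_apply_eq _).2 (hw.injective ?_)
  exact (h _).symm

lemma revCompl_mkPattern {k : ℕ} {v w : Fin k → Fin k} (hv : Function.Bijective v)
    (hw : Function.Bijective w) (h : ∀ i, (v i.rev).rev = w i) :
    (mkPattern v hv).revCompl = mkPattern w hw :=
  congrArg (Sigma.mk k) (Equiv.ext h)

/-- `u` is the one-line notation of the direct sum of `v` and `w`. -/
abbrev IsDirectSum {k l : ℕ} (v : Fin k → Fin k) (w : Fin l → Fin l)
    (u : Fin (k + l) → Fin (k + l)) : Prop :=
  (∀ i, Fin.castAdd l (v i) = u (Fin.castAdd l i)) ∧ ∀ i, Fin.natAdd k (w i) = u (Fin.natAdd k i)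

lemma dsum_mkPattern {k l : ℕ} {v : Fin k → Fin k} {w : Fin l → Fin l}
    {u : Fin (k + l) → Fin (k + l)} (hv : Function.Bijective v) (hw : Function.Bijective w)
    (hu : Function.Bijective u) (h : IsDirectSum v w u) :
    dsum (mkPattern v hv) (mkPattern w hw) = mkPattern u hu := by
  refine congrArg (Sigma.mk (k + l)) (Equiv.ext fun i => ?_)
  induction i using Fin.addCases with
  | left i => exact (sumPerm_castAdd _ _ _).trans (h.1 i)
  | right i => exact (sumPerm_natAdd _ _ _).trans (h.2 i)

lemma wilfEquiv_inv_pair {k : ℕ} {v v' w w' : Fin k → Fin k} (hv : Function.Bijective v)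
    (hv' : Function.Bijective v') (hw : Function.Bijective w) (hw' : Function.Bijective w')
    (h : ∀ i, w (v i) = i) (h' : ∀ i, w' (v' i) = i) :
    WilfEquiv {mkPattern v hv, mkPattern v' hv'} {mkPattern w hw, mkPattern w' hw'} := by
  have := wilfEquiv_inv {mkPattern v hv, mkPattern v' hv'}
  rwa [Set.image_pair, inv_mkPattern hv hw h, inv_mkPattern hv' hw' h'] at this

lemma wilfEquiv_revCompl_pair {k : ℕ} {v v' w w' : Fin k → Fin k} (hv : Function.Bijective v)
    (hv' : Function.Bijective v') (hw : Function.Bijective w) (hw' : Function.Bijective w')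
    (h : ∀ i, (v i.rev).rev = w i) (h' : ∀ i, (v' i.rev).rev = w' i) :
    WilfEquiv {mkPattern v hv, mkPattern v' hv'} {mkPattern w hw, mkPattern w' hw'} := by
  have := wilfEquiv_revCompl {mkPattern v hv, mkPattern v' hv'}
  rwa [Set.image_pair, revCompl_mkPattern hv hw h, revCompl_mkPattern hv' hw' h'] at this

/-- Adding one pattern to two shape-Wilf-equivalent pairs. -/
lemma ShapeWilfEquiv.wilfEquiv_pair_dsum {k l : ℕ} {v v' w w' : Fin k → Fin k}
    {hv : Function.Bijective v} {hv' : Function.Bijective v'}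
    {hw : Function.Bijective w} {hw' : Function.Bijective w'}
    (h : ShapeWilfEquiv {mkPattern v hv, mkPattern v' hv'} {mkPattern w hw, mkPattern w' hw'})
    (hk : 0 < k) {t : Fin l → Fin l} (ht : Function.Bijective t)
    {x x' y y' : Fin (k + l) → Fin (k + l)} (hx : Function.Bijective x)
    (hx' : Function.Bijective x') (hy : Function.Bijective y) (hy' : Function.Bijective y')
    (hvx : IsDirectSum v t x) (hvx' : IsDirectSum v' t x') (hwy : IsDirectSum w t y)
    (hwy' : IsDirectSum w' t y') :
    WilfEquiv {mkPattern x hx, mkPattern x' hx'} {mkPattern y hy, mkPattern y' hy'} := by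
  have := h.wilfEquiv_image2 (by rintro p (rfl | rfl) <;> exact hk)
    (by rintro p (rfl | rfl) <;> exact hk) {mkPattern t ht}
  rwa [Set.image2_singleton_right, Set.image2_singleton_right, Set.image_pair, Set.image_pair,
    dsum_mkPattern hv ht hx hvx, dsum_mkPattern hv' ht hx' hvx', dsum_mkPattern hw ht hy hwy,
    dsum_mkPattern hw' ht hy' hwy'] at this

/-- Adding a pair of patterns to two shape-Wilf-equivalent patterns. -/
lemma ShapeWilfEquiv.wilfEquiv_dsum_pair {k l : ℕ} {v w : Fin k → Fin k}
    {hv : Function.Bijective v} {hw : Function.Bijective w}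
    (h : ShapeWilfEquiv {mkPattern v hv} {mkPattern w hw})
    (hk : 0 < k) {t t' : Fin l → Fin l} (ht : Function.Bijective t) (ht' : Function.Bijective t')
    {x x' y y' : Fin (k + l) → Fin (k + l)} (hx : Function.Bijective x)
    (hx' : Function.Bijective x') (hy : Function.Bijective y) (hy' : Function.Bijective y')
    (hvx : IsDirectSum v t x) (hvx' : IsDirectSum v t' x') (hwy : IsDirectSum w t y)
    (hwy' : IsDirectSum w t' y') :
    WilfEquiv {mkPattern x hx, mkPattern x' hx'} {mkPattern y hy, mkPattern y' hy'} := by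
  have := h.wilfEquiv_image2 (by rintro p rfl; exact hk) (by rintro p rfl; exact hk)
    {mkPattern t ht, mkPattern t' ht'}
  rwa [Set.image2_singleton_left, Set.image2_singleton_left, Set.image_pair, Set.image_pair,
    dsum_mkPattern hv ht hx hvx, dsum_mkPattern hv ht' hx' hvx', dsum_mkPattern hw ht hy hwy,
    dsum_mkPattern hw ht' hy' hwy'] at this

/-- The reverse complement of the pair `{12345, 12354}`. -/
lemma wilfEquiv_12345_21345 :
    WilfEquiv {mkPattern ![0,1,2,3,4], mkPattern ![1,0,2,3,4]}
      {mkPattern ![0,1,2,3,4], mkPattern ![0,1,2,4,3]} :=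
  wilfEquiv_revCompl_pair _ _ _ _ (by decide) (by decide)

lemma ShapeWilfEquiv.wilfEquiv_base {v v' : Fin 3 → Fin 3} {hv : Function.Bijective v}
    {hv' : Function.Bijective v'}
    (h : ShapeWilfEquiv {mkPattern v hv, mkPattern v' hv'}
      {mkPattern ![0, 1, 2], mkPattern ![1, 0, 2]})
    {x x' : Fin 5 → Fin 5} (hx : Function.Bijective x) (hx' : Function.Bijective x')
    (hvx : IsDirectSum v ![0, 1] x) (hvx' : IsDirectSum v' ![0, 1] x') :
    WilfEquiv {mkPattern x hx, mkPattern x' hx'}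
      {mkPattern ![0,1,2,3,4], mkPattern ![0,1,2,4,3]} :=
  (h.wilfEquiv_pair_dsum (by decide) (by decide) _ _ _ _ hvx hvx' (by decide) (by decide)).trans
    wilfEquiv_12345_21345

/-- Exchanging `12` and `21` below and to the left of a pair of patterns of length three. -/
lemma wilfEquiv_21_12_dsum {t t' : Fin 3 → Fin 3} (ht : Function.Bijective t)
    (ht' : Function.Bijective t') {x x' y y' : Fin 5 → Fin 5} (hx : Function.Bijective x)
    (hx' : Function.Bijective x') (hy : Function.Bijective y) (hy' : Function.Bijective y')
    (htx : IsDirectSum ![1, 0] t x) (htx' : IsDirectSum ![1, 0] t' x')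
    (hty : IsDirectSum ![0, 1] t y) (hty' : IsDirectSum ![0, 1] t' y') :
    WilfEquiv {mkPattern x hx, mkPattern x' hx'} {mkPattern y hy, mkPattern y' hy'} :=
  (shapeWilfEquiv_12_21.wilfEquiv_dsum_pair (by decide) ht ht' hy hy' hx hx' hty hty' htx
    htx').symm

lemma wilfEquiv_12354_12435 :
    WilfEquiv {mkPattern ![0,1,2,4,3], mkPattern ![0,1,3,2,4]}
      {mkPattern ![0,1,2,3,4], mkPattern ![0,1,2,4,3]} :=
  (wilfEquiv_revCompl_pair _ _ (w := ![1,0,2,3,4]) (w' := ![0,2,1,3,4])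
    (by decide) (by decide) (by decide) (by decide)).trans <|
  shapeWilfEquiv_213_132.wilfEquiv_base _ _ (by decide) (by decide)

lemma wilfEquiv_12354_12453 :
    WilfEquiv {mkPattern ![0,1,2,4,3], mkPattern ![0,1,3,4,2]}
      {mkPattern ![0,1,2,3,4], mkPattern ![0,1,2,4,3]} :=
  (wilfEquiv_revCompl_pair _ _ (w := ![1,0,2,3,4]) (w' := ![2,0,1,3,4])
    (by decide) (by decide) (by decide) (by decide)).trans <|
  (wilfEquiv_inv_pair _ _ (w := ![1,0,2,3,4]) (w' := ![1,2,0,3,4])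
    (by decide) (by decide) (by decide) (by decide)).trans <|
  shapeWilfEquiv_213_231.wilfEquiv_base _ _ (by decide) (by decide)

lemma wilfEquiv_21345_21354 :
    WilfEquiv {mkPattern ![1,0,2,3,4], mkPattern ![1,0,2,4,3]}
      {mkPattern ![0,1,2,3,4], mkPattern ![0,1,2,4,3]} :=
  wilfEquiv_21_12_dsum (t := ![0,1,2]) (t' := ![0,2,1]) (by decide) (by decide) _ _ _ _
    (by decide) (by decide) (by decide) (by decide)

lemma wilfEquiv_12435_12453 :
    WilfEquiv {mkPattern ![0,1,3,2,4], mkPattern ![0,1,3,4,2]}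
      {mkPattern ![0,1,2,3,4], mkPattern ![0,1,2,4,3]} :=
  (wilfEquiv_revCompl_pair _ _ (w := ![0,2,1,3,4]) (w' := ![2,0,1,3,4])
    (by decide) (by decide) (by decide) (by decide)).trans <|
  shapeWilfEquiv_132_312.wilfEquiv_base _ _ (by decide) (by decide)

lemma wilfEquiv_12453_12534 :
    WilfEquiv {mkPattern ![0,1,3,4,2], mkPattern ![0,1,4,2,3]}
      {mkPattern ![0,1,2,3,4], mkPattern ![0,1,2,4,3]} := by
  rw [Set.pair_comm (mkPattern ![0,1,3,4,2])]
  exact (wilfEquiv_revCompl_pair _ _ (w := ![1,2,0,3,4]) (w' := ![2,0,1,3,4])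
    (by decide) (by decide) (by decide) (by decide)).trans <|
    shapeWilfEquiv_231_312.wilfEquiv_base _ _ (by decide) (by decide)

lemma wilfEquiv_12453_12543 :
    WilfEquiv {mkPattern ![0,1,3,4,2], mkPattern ![0,1,4,3,2]}
      {mkPattern ![0,1,2,3,4], mkPattern ![0,1,2,4,3]} :=
  (wilfEquiv_revCompl_pair _ _ (w := ![2,0,1,3,4]) (w' := ![2,1,0,3,4])
    (by decide) (by decide) (by decide) (by decide)).trans <|
  (wilfEquiv_inv_pair _ _ (w := ![1,2,0,3,4]) (w' := ![2,1,0,3,4])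
    (by decide) (by decide) (by decide) (by decide)).trans <|
  shapeWilfEquiv_231_321.wilfEquiv_base _ _ (by decide) (by decide)

/-- Each of the twelve listed pattern sets is Wilf-equivalent to {12345, 12354}. -/
theorem stmt14 :
    WilfEquiv {mkPattern ![0,1,2,4,3], mkPattern ![0,1,3,2,4]} {mkPattern ![0,1,2,3,4], mkPattern ![0,1,2,4,3]} ∧
    WilfEquiv {mkPattern ![0,1,2,4,3], mkPattern ![0,1,3,4,2]} {mkPattern ![0,1,2,3,4], mkPattern ![0,1,2,4,3]} ∧
    WilfEquiv {mkPattern ![0,1,2,4,3], mkPattern ![1,0,2,4,3]} {mkPattern ![0,1,2,3,4], mkPattern ![0,1,2,4,3]} ∧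
    WilfEquiv {mkPattern ![0,1,3,2,4], mkPattern ![0,1,3,4,2]} {mkPattern ![0,1,2,3,4], mkPattern ![0,1,2,4,3]} ∧
    WilfEquiv {mkPattern ![0,1,3,4,2], mkPattern ![0,1,4,2,3]} {mkPattern ![0,1,2,3,4], mkPattern ![0,1,2,4,3]} ∧
    WilfEquiv {mkPattern ![0,1,3,4,2], mkPattern ![0,1,4,3,2]} {mkPattern ![0,1,2,3,4], mkPattern ![0,1,2,4,3]} ∧
    WilfEquiv {mkPattern ![0,1,4,3,2], mkPattern ![1,0,4,3,2]} {mkPattern ![0,1,2,3,4], mkPattern ![0,1,2,4,3]} ∧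
    WilfEquiv {mkPattern ![0,2,1,4,3], mkPattern ![1,0,2,4,3]} {mkPattern ![0,1,2,3,4], mkPattern ![0,1,2,4,3]} ∧
    WilfEquiv {mkPattern ![0,2,1,4,3], mkPattern ![1,2,0,4,3]} {mkPattern ![0,1,2,3,4], mkPattern ![0,1,2,4,3]} ∧
    WilfEquiv {mkPattern ![1,0,2,4,3], mkPattern ![1,0,3,4,2]} {mkPattern ![0,1,2,3,4], mkPattern ![0,1,2,4,3]} ∧
    WilfEquiv {mkPattern ![1,0,3,4,2], mkPattern ![1,0,4,2,3]} {mkPattern ![0,1,2,3,4], mkPattern ![0,1,2,4,3]} ∧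
    WilfEquiv {mkPattern ![1,0,3,4,2], mkPattern ![1,0,4,3,2]} {mkPattern ![0,1,2,3,4], mkPattern ![0,1,2,4,3]} := by
  refine ⟨wilfEquiv_12354_12435, wilfEquiv_12354_12453, ?_, wilfEquiv_12435_12453,
    wilfEquiv_12453_12534, wilfEquiv_12453_12543, ?_, ?_, ?_, ?_, ?_, ?_⟩
  · exact (wilfEquiv_revCompl_pair _ _ _ _ (by decide) (by decide)).trans wilfEquiv_21345_21354
  · exact (wilfEquiv_revCompl_pair _ _ (w := ![2,1,0,3,4]) (w' := ![2,1,0,4,3])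
      (by decide) (by decide) (by decide) (by decide)).trans <|
      (shapeWilfEquiv_213_321.wilfEquiv_dsum_pair (t := ![0,1]) (t' := ![1,0]) (by decide)
        (by decide) (by decide) _ _ _ _ (by decide) (by decide) (by decide) (by decide)).symm.trans
      wilfEquiv_21345_21354
  · rw [Set.pair_comm (mkPattern ![0,2,1,4,3])]
    exact (wilfEquiv_revCompl_pair _ _ (w := ![1,0,2,4,3]) (w' := ![1,0,3,2,4])
      (by decide) (by decide) (by decide) (by decide)).trans <|
      (wilfEquiv_21_12_dsum (t := ![0,2,1]) (t' := ![1,0,2]) (by decide) (by decide) _ _ _ _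
        (by decide) (by decide) (by decide) (by decide)).trans wilfEquiv_12354_12435
  · exact (wilfEquiv_revCompl_pair _ _ (w := ![1,0,3,2,4]) (w' := ![1,0,4,2,3])
      (by decide) (by decide) (by decide) (by decide)).trans <|
      (wilfEquiv_21_12_dsum (t := ![1,0,2]) (t' := ![2,0,1]) (y := ![0,1,3,2,4])
        (y' := ![0,1,4,2,3]) (by decide) (by decide) _ _ (by decide) (by decide)
        (by decide) (by decide) (by decide) (by decide)).trans <|
      (wilfEquiv_inv_pair _ _ _ _ (by decide) (by decide)).trans wilfEquiv_12435_12453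
  · exact (wilfEquiv_21_12_dsum (t := ![0,2,1]) (t' := ![1,2,0]) (by decide) (by decide) _ _ _ _
      (by decide) (by decide) (by decide) (by decide)).trans wilfEquiv_12354_12453
  · exact (wilfEquiv_21_12_dsum (t := ![1,2,0]) (t' := ![2,0,1]) (by decide) (by decide) _ _ _ _
      (by decide) (by decide) (by decide) (by decide)).trans wilfEquiv_12453_12534
  · exact (wilfEquiv_21_12_dsum (t := ![1,2,0]) (t' := ![2,1,0]) (by decide) (by decide) _ _ _ _
      (by decide) (by decide) (by decide) (by decide)).trans wilfEquiv_12453_12543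
end

section
/- The pattern sets {12543, 21543} and {12345, 21345} are Wilf-equivalent. -/
namespace ShapeWilf

open Finset

/-- A finite set of cells with at most one cell in each row and each column. -/
def IsPartialPerm (S : Finset (ℕ × ℕ)) : Prop :=
  ∀ p ∈ S, ∀ q ∈ S, p.1 = q.1 ∨ p.2 = q.2 → p = q

/-- Read from left to right, the heights of the cells of `C` form an `r`-chain. -/
def IsMono (r : ℕ → ℕ → Prop) (C : Finset (ℕ × ℕ)) : Prop :=
  ∀ p ∈ C, ∀ q ∈ C, p.1 < q.1 → r p.2 q.2

/-- There is no `r`-chain of three cells. -/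
def Free (r : ℕ → ℕ → Prop) (S : Finset (ℕ × ℕ)) : Prop :=
  ∀ p ∈ S, ∀ q ∈ S, ∀ t ∈ S, p.1 < q.1 → q.1 < t.1 → r p.2 q.2 → ¬ r q.2 t.2

open Classical in
/-- The largest size of an `r`-chain in `S`. -/
noncomputable def chainLen (r : ℕ → ℕ → Prop) (S : Finset (ℕ × ℕ)) : ℕ :=
  (S.powerset.filter (IsMono r)).sup card

section chains

variable {r r' : ℕ → ℕ → Prop} {S T C D : Finset (ℕ × ℕ)}

theorem IsPartialPerm.subset (hS : IsPartialPerm S) (h : T ⊆ S) : IsPartialPerm T :=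
  fun p hp q hq => hS p (h hp) q (h hq)

theorem IsMono.subset (hS : IsMono r S) (h : T ⊆ S) : IsMono r T :=
  fun p hp q hq => hS p (h hp) q (h hq)

theorem Free.subset (hS : Free r S) (h : T ⊆ S) : Free r T :=
  fun p hp q hq t ht => hS p (h hp) q (h hq) t (h ht)

theorem IsMono.le_chainLen (hC : IsMono r C) (h : C ⊆ S) : #C ≤ chainLen r S := by
  classical
  exact Finset.le_sup (f := card) (by simp [h, hC])

theorem exists_isMono_card_eq (r : ℕ → ℕ → Prop) (S : Finset (ℕ × ℕ)) :
    ∃ C ⊆ S, IsMono r C ∧ #C = chainLen r S := by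
  classical
  obtain ⟨C, hC, h⟩ := Finset.exists_mem_eq_sup (S.powerset.filter (IsMono r))
    ⟨∅, by simp [IsMono]⟩ card
  simp only [mem_filter, mem_powerset] at hC
  exact ⟨C, hC.1, hC.2, h.symm⟩

theorem chainLen_le {k : ℕ} (h : ∀ C ⊆ S, IsMono r C → #C ≤ k) : chainLen r S ≤ k := by
  obtain ⟨C, hC, hm, hc⟩ := exists_isMono_card_eq r S
  exact hc ▸ h C hC hm

theorem chainLen_mono (h : T ⊆ S) : chainLen r T ≤ chainLen r S :=
  chainLen_le fun _ hC hm => hm.le_chainLen (hC.trans h)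

theorem chainLen_le_card : chainLen r S ≤ #S :=
  chainLen_le fun _ hC _ => card_le_card hC

theorem chainLen_insert_le (x : ℕ × ℕ) : chainLen r (insert x S) ≤ chainLen r S + 1 := by
  refine chainLen_le fun C hC hm => ?_
  have h1 := (hm.subset (erase_subset x C)).le_chainLen (S := S) (by grind)
  have := Finset.pred_card_le_card_erase (s := C) (a := x)
  omega

theorem card_le_two_mul_chainLen (hr : ∀ a b, a ≠ b → r a b ∨ r' a b) (hS : IsPartialPerm S)
    (hf : Free r' S) : #S ≤ 2 * chainLen r S := by
  classical
  set p : ℕ × ℕ → Prop := fun c => ∃ q ∈ S, q.1 < c.1 ∧ r' q.2 c.2 with hp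
  have hne : ∀ a ∈ S, ∀ b ∈ S, a.1 < b.1 → a.2 ≠ b.2 := fun a ha b hb h h' => by
    have := hS a ha b hb (Or.inr h')
    simp [this] at h
  have h1 : IsMono r (S.filter p) := by
    intro a ha b hb hab
    simp only [mem_filter, hp] at ha hb
    obtain ⟨ha, o, ho, h1, h2⟩ := ha
    rcases hr _ _ (hne a ha b hb.1 hab) with h | h
    · exact h
    · exact absurd h (hf o ho a ha b hb.1 h1 hab h2)
  have h2 : IsMono r (S.filter (fun c => ¬ p c)) := by
    intro a ha b hb hab
    simp only [mem_filter, hp] at ha hb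
    rcases hr _ _ (hne a ha.1 b hb.1 hab) with h | h
    · exact h
    · exact absurd ⟨a, ha.1, hab, h⟩ hb.2
  have h3 := h1.le_chainLen (filter_subset _ S)
  have h4 := h2.le_chainLen (filter_subset _ S)
  have h5 := Finset.card_filter_add_card_filter_not (s := S) p
  omega

/-- Follow `C` up to the column of `e`, then `D`. -/
def splice (e : ℕ × ℕ) (C D : Finset (ℕ × ℕ)) : Finset (ℕ × ℕ) :=
  C.filter (fun p => p.1 ≤ e.1) ∪ D.filter (fun p => e.1 < p.1)

theorem card_splice (e : ℕ × ℕ) (C D : Finset (ℕ × ℕ)) :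
    #(splice e C D) + #(splice e D C) = #C + #D := by
  have h (C D : Finset (ℕ × ℕ)) : #(splice e C D) =
      #(C.filter (fun p => p.1 ≤ e.1)) + #(D.filter (fun p => e.1 < p.1)) :=
    card_union_of_disjoint (by rw [Finset.disjoint_left]; grind)
  have h' (C : Finset (ℕ × ℕ)) :=
    Finset.card_filter_add_card_filter_not (s := C) (fun p : ℕ × ℕ => p.1 ≤ e.1)
  simp only [not_le] at h'
  have := h' C
  have := h' D
  rw [h, h]
  omega

theorem IsMono.splice {e : ℕ × ℕ} (hr : ∀ a b c, r a b → r b c → r a c) (hC : IsMono r C)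
    (hD : IsMono r D) (he : e ∈ C) (he' : e ∈ D) (hS : IsPartialPerm C) :
    IsMono r (splice e C D) := by
  intro p hp q hq hpq
  simp only [ShapeWilf.splice, mem_union, mem_filter] at hp hq
  rcases hp with ⟨hp, h1⟩ | ⟨hp, h1⟩ <;> rcases hq with ⟨hq, h2⟩ | ⟨hq, h2⟩
  · exact hC p hp q hq hpq
  · rcases h1.eq_or_lt with h | h
    · rw [hS p hp e he (Or.inl h)]
      exact hD e he' q hq h2
    · exact hr _ _ _ (hC p hp e he h) (hD e he' q hq h2)
  · omega
  · exact hD p hp q hq hpq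

end chains

section corner

/-! Adding a cell `(a, j)` right of `S` and a cell `(i, b)` above `S`. -/

variable {S : Finset (ℕ × ℕ)} {a b i j : ℕ}

/-- `S` lies left of column `a` and below row `b`, and avoids column `i < a` and row `j < b`. -/
structure Hook (S : Finset (ℕ × ℕ)) (a b i j : ℕ) : Prop where
  perm : IsPartialPerm S
  lt : ∀ p ∈ S, p.1 < a ∧ p.2 < b
  ne : ∀ p ∈ S, p.1 ≠ i ∧ p.2 ≠ j
  hi : i < a
  hj : j < b

theorem Hook.chainLen_inc (h : Hook S a b i j) :
    chainLen (· < ·) (insert (a, j) (insert (i, b) S)) =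
      max (chainLen (· < ·) (insert (i, b) S)) (chainLen (· < ·) (insert (a, j) S)) := by
  have := h.hi
  have := h.hj
  apply le_antisymm
  · refine chainLen_le fun C hC hm => ?_
    by_cases hx : (a, j) ∈ C
    · have hy : (i, b) ∉ C := fun hy => by
        have := hm _ hy _ hx h.hi
        simp only at this
        omega
      exact le_max_of_le_right (hm.le_chainLen (by grind))
    · exact le_max_of_le_left (hm.le_chainLen (by grind))
  · exact max_le (chainLen_mono (by grind)) (chainLen_mono (by grind))

theorem Hook.lt_chainLen_inc (h : Hook S a b i j)
    (hf : Free (· > ·) (insert (a, j) (insert (i, b) S))) :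
    chainLen (· < ·) S + 1 ≤
      max (chainLen (· < ·) (insert (i, b) S)) (chainLen (· < ·) (insert (a, j) S)) := by
  have hi := h.hi
  have hj := h.hj
  obtain ⟨C, hC, hm, hc⟩ := exists_isMono_card_eq (· < ·) S
  have hlt := fun p hp => h.lt p (hC hp)
  have hne := fun p hp => h.ne p (hC hp)
  rw [← hc]
  by_cases h1 : ∀ p ∈ C, p.1 < i
  · apply le_max_of_le_left
    rw [← card_insert_of_notMem (s := C) (a := (i, b)) (by grind)]
    refine IsMono.le_chainLen (fun p hp q hq => ?_) (insert_subset_insert _ hC)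
    simp only [mem_insert] at hp hq
    grind [IsMono]
  by_cases h2 : ∀ p ∈ C, p.2 < j
  · apply le_max_of_le_right
    rw [← card_insert_of_notMem (s := C) (a := (a, j)) (by grind)]
    refine IsMono.le_chainLen (fun p hp q hq => ?_) (insert_subset_insert _ hC)
    simp only [mem_insert] at hp hq
    grind [IsMono]
  push Not at h1 h2
  obtain ⟨p, hp, hpi⟩ := h1
  obtain ⟨q, hq, hqj⟩ := h2
  exfalso
  have hZ : ∀ z ∈ C, i < z.1 → ¬ j < z.2 := fun z hz h1 h2 =>
    hf (i, b) (by simp) z (by simp [hC hz]) (a, j) (by simp) h1 (hlt z hz).1 (hlt z hz).2 h2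
  have h1 := hZ p hp
  have h2 := hZ q hq
  have h3 := hne p hp
  have h4 := hne q hq
  have h5 := hm q hq p hp
  simp only at h5
  omega

theorem Hook.free_dec (h : Hook S a b i j) (hx : Free (· > ·) (insert (a, j) S))
    (hy : Free (· > ·) (insert (i, b) S))
    (hlen : chainLen (· < ·) S < chainLen (· < ·) (insert (i, b) S) ∨
      chainLen (· < ·) S < chainLen (· < ·) (insert (a, j) S)) :
    Free (· > ·) (insert (a, j) (insert (i, b) S)) := by
  have hi := h.hi
  have hj := h.hj
  intro p hp q hq t ht hpq hqt h1 h2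
  have hlt := h.lt
  obtain ⟨z, hz, hzi, hzj⟩ : ∃ z ∈ S, i < z.1 ∧ j < z.2 := by
    have hqS : q ∈ S := by
      simp only [mem_insert] at hp hq ht
      grind
    by_cases hpS : p = (i, b)
    · by_cases htS : t = (a, j)
      · exact ⟨q, hqS, by grind⟩
      · exact absurd h2 (hy p (by grind) q (by grind) t (by grind) hpq hqt h1)
    · refine absurd h2 (hx p ?_ q ?_ t ?_ hpq hqt h1)
      all_goals simp only [mem_insert] at hp hq ht ⊢
      all_goals grind
  have hza := h.lt z hz
  rcases hlen with hlen | hlen <;> refine absurd hlen (not_lt.2 (chainLen_le fun C hC hm => ?_))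
  · by_cases hyC : (i, b) ∈ C
    · have key : ∀ c ∈ C.erase (i, b), c ∈ S ∧ c.1 < i ∧ c.2 < z.2 := by
        intro c hc
        simp only [mem_erase] at hc
        have hcS : c ∈ S := by grind
        have h1 := hm _ hyC c hc.2
        have h2 := h.lt c hcS
        have h3 := h.ne c hcS
        simp only at h1
        have h4 : c.1 < i := by omega
        refine ⟨hcS, h4, ?_⟩
        by_contra hcz
        have h5 : z.2 ≠ c.2 := fun h5 => by
          have := h.perm z hz c hcS (Or.inr h5)
          subst this
          omega
        exact hx c (by simp [hcS]) z (by simp [hz]) (a, j) (by simp) (by omega) hza.1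
          (by simp only; omega) hzj
      rw [← card_erase_add_one hyC, ← card_insert_of_notMem (a := z) (by grind)]
      refine IsMono.le_chainLen (fun p hp q hq hpq => ?_) (by grind)
      simp only [mem_insert] at hp hq
      have := hm p
      grind
    · exact hm.le_chainLen (by grind)
  · by_cases hxC : (a, j) ∈ C
    · have key : ∀ c ∈ C.erase (a, j), c ∈ S ∧ c.2 < j ∧ c.1 < z.1 := by
        intro c hc
        simp only [mem_erase] at hc
        have hcS : c ∈ S := by grind
        have h2 := h.lt c hcS
        have h1 := hm c hc.2 _ hxC h2.1
        simp only at h1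
        refine ⟨hcS, h1, ?_⟩
        by_contra hcz
        have h5 : z.1 ≠ c.1 := fun h5 => by
          have := h.perm z hz c hcS (Or.inl h5)
          subst this
          omega
        exact hy (i, b) (by simp) z (by simp [hz]) c (by simp [hcS]) hzi (by omega) hza.2
          (by simp only; omega)
      rw [← card_erase_add_one hxC, ← card_insert_of_notMem (a := z) (by grind)]
      refine IsMono.le_chainLen (fun p hp q hq hpq => ?_) (by grind)
      simp only [mem_insert] at hp hq
      have := hm p
      grind
    · exact hm.le_chainLen (by grind)

theorem Hook.free_inc (h : Hook S a b i j) (hx : Free (· < ·) (insert (a, j) S))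
    (hy : Free (· < ·) (insert (i, b) S)) :
    Free (· < ·) (insert (a, j) (insert (i, b) S)) := by
  have hi := h.hi
  have hj := h.hj
  have hlt := h.lt
  intro p hp q hq t ht hpq hqt h1 h2
  have : p ∈ S ∧ q ∈ S := by
    simp only [mem_insert] at hp hq ht
    grind
  by_cases htx : t = (a, j)
  · exact hx p (by simp [this]) q (by simp [this]) t (by simp [htx]) hpq hqt h1 h2
  · exact hy p (by simp [this]) q (by simp [this]) t (by grind) hpq hqt h1 h2

/-- Two longest decreasing chains, one right of column `i` and one above row `j`, give a longest
decreasing chain with both properties. -/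
theorem exists_isMono_inter {C₁ C₂ : Finset (ℕ × ℕ)} {m : ℕ} (hS : IsPartialPerm S)
    (hm : chainLen (· > ·) S = m) (h₁ : C₁ ⊆ S) (h₂ : C₂ ⊆ S) (hm₁ : IsMono (· > ·) C₁)
    (hm₂ : IsMono (· > ·) C₂) (hc₁ : #C₁ = m) (hc₂ : #C₂ = m) (hi : ∀ p ∈ C₁, i < p.1)
    (hj : ∀ p ∈ C₂, j < p.2) :
    ∃ D ⊆ S, IsMono (· > ·) D ∧ m ≤ #D ∧ ∀ p ∈ D, i < p.1 ∧ j < p.2 := by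
  classical
  by_cases hd : Disjoint C₁ C₂
  · set U := C₁ ∪ C₂ with hU
    have hUS : U ⊆ S := union_subset h₁ h₂
    set P : ℕ × ℕ → Prop := fun p => ∃ q ∈ U, q.1 < p.1 ∧ q.2 < p.2 with hP
    have hcard := Finset.card_filter_add_card_filter_not (s := U) P
    have hcU : #U = #C₁ + #C₂ := card_union_of_disjoint hd
    have hne : ∀ p ∈ U, ∀ q ∈ U, p.1 < q.1 → p.2 ≠ q.2 := fun p hp q hq h1 h2 => by
      have := hS p (hUS hp) q (hUS hq) (Or.inr h2)
      simp [this] at h1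
    have hmin : IsMono (· > ·) (U.filter (fun p => ¬ P p)) := by
      intro p hp q hq hpq
      simp only [mem_filter] at hp hq
      have h1 := hne p hp.1 q hq.1 hpq
      have h2 : ¬ p.2 < q.2 := fun h => hq.2 ⟨p, hp.1, hpq, h⟩
      omega
    have hmin' := hmin.le_chainLen ((filter_subset _ _).trans hUS)
    refine ⟨U.filter P, (filter_subset _ _).trans hUS, ?_, by omega, ?_⟩
    · intro p hp q hq hpq
      simp only [mem_filter] at hp hq
      obtain ⟨o, ho, h1, h2⟩ := hp.2
      have h3 := hne p hp.1 q hq.1 hpq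
      by_contra h4
      have h5 : p.2 < q.2 := by omega
      have ha := hm₁ o
      have hb := hm₁ p
      have hc := hm₂ o
      have hd := hm₂ p
      grind
    · intro z hz
      simp only [mem_filter] at hz
      obtain ⟨w, hw, h1, h2⟩ := hz.2
      have ha := hm₁ w
      have hc := hm₂ w
      grind
  · rw [not_disjoint_iff] at hd
    obtain ⟨e, he₁, he₂⟩ := hd
    have htr : ∀ a b c : ℕ, a > b → b > c → a > c := fun a b c h1 h2 => h2.trans h1
    have h := card_splice e C₁ C₂
    have h' := (hm₂.splice htr hm₁ he₂ he₁ (hS.subset h₂)).le_chainLen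
      (r := (· > ·)) (S := S) (by grind [splice])
    refine ⟨splice e C₁ C₂, by grind [splice],
      hm₁.splice htr hm₂ he₁ he₂ (hS.subset h₁), by omega, ?_⟩
    intro p hp
    simp only [splice, mem_union, mem_filter] at hp
    rcases hp with ⟨hp, hpe⟩ | ⟨hp, hpe⟩
    · refine ⟨hi p hp, ?_⟩
      rcases hpe.eq_or_lt with h3 | h3
      · rw [hS p (h₁ hp) e (h₁ he₁) (Or.inl h3)]
        exact hj e he₂
      · exact (hj e he₂).trans (hm₁ p hp e he₁ h3)
    · exact ⟨(hi e he₁).trans hpe, hj p hp⟩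

theorem Hook.add_two_le_chainLen_dec (h : Hook S a b i j)
    (hx : chainLen (· > ·) (insert (a, j) S) = chainLen (· > ·) S + 1)
    (hy : chainLen (· > ·) (insert (i, b) S) = chainLen (· > ·) S + 1) :
    chainLen (· > ·) S + 2 ≤ chainLen (· > ·) (insert (a, j) (insert (i, b) S)) := by
  have hi := h.hi
  have hj := h.hj
  obtain ⟨C, hC, hm, hc⟩ := exists_isMono_card_eq (· > ·) (insert (i, b) S)
  obtain ⟨D, hD, hm', hc'⟩ := exists_isMono_card_eq (· > ·) (insert (a, j) S)
  have hyC : (i, b) ∈ C := by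
    by_contra hn
    have := hm.le_chainLen (S := S) (by grind)
    omega
  have hxD : (a, j) ∈ D := by
    by_contra hn
    have := hm'.le_chainLen (S := S) (by grind)
    omega
  have h1 : C.erase (i, b) ⊆ S := by grind
  have h2 : D.erase (a, j) ⊆ S := by grind
  obtain ⟨E, hES, hEm, hEc, hE⟩ := exists_isMono_inter (i := i) (j := j) h.perm rfl h1 h2
    (hm.subset (erase_subset _ _)) (hm'.subset (erase_subset _ _))
    (by rw [card_erase_of_mem hyC]; omega) (by rw [card_erase_of_mem hxD]; omega)
    (fun p hp => by
      have h3 := h.lt p (h1 hp)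
      have h4 := h.ne p (h1 hp)
      have h5 := hm p (mem_of_mem_erase hp) _ hyC
      simp only at h5
      omega)
    (fun p hp => hm' p (mem_of_mem_erase hp) _ hxD (h.lt p (h2 hp)).1)
  have hlt := fun p hp => h.lt p (hES hp)
  have hcE : #(insert (a, j) (insert (i, b) E)) = #E + 2 := by
    rw [card_insert_of_notMem (by grind), card_insert_of_notMem (by grind)]
  have : IsMono (· > ·) (insert (a, j) (insert (i, b) E)) := by
    intro p hp q hq hpq
    simp only [mem_insert] at hp hq
    have := hEm p
    grind
  have := this.le_chainLen (S := insert (a, j) (insert (i, b) S)) (by grind)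
  omega

theorem Hook.two_mul_chainLen_dec_le (h : Hook S a b i j)
    (hx : chainLen (· > ·) (insert (a, j) S) = chainLen (· > ·) S)
    (hy : chainLen (· > ·) (insert (i, b) S) = chainLen (· > ·) S)
    (hxy : chainLen (· > ·) S < chainLen (· > ·) (insert (a, j) (insert (i, b) S))) :
    2 * chainLen (· > ·) S ≤ #S + 1 := by
  have hi := h.hi
  have hj := h.hj
  obtain ⟨C, hC, hm, hc⟩ := exists_isMono_card_eq (· > ·) (insert (a, j) (insert (i, b) S))
  obtain ⟨D, hD, hm', hc'⟩ := exists_isMono_card_eq (· > ·) S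
  have hlt := h.lt
  have hxC : (a, j) ∈ C := by
    by_contra hn
    have := hm.le_chainLen (S := insert (i, b) S) (by grind)
    omega
  have hyC : (i, b) ∈ C := by
    by_contra hn
    have := hm.le_chainLen (S := insert (a, j) S) (by grind)
    omega
  set C' := (C.erase (a, j)).erase (i, b) with hC'
  have hC'S : C' ⊆ S := by grind
  have hcC' : #C' + 2 = #C := by
    rw [hC', ← card_erase_add_one hxC, ← card_erase_add_one (s := C.erase (a, j)) (a := (i, b))]
    grind
  have hdisj : Disjoint C' D := by
    rw [disjoint_left]
    intro e heC' heD
    have heC : e ∈ C := by grind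
    have htr : ∀ a b c : ℕ, a > b → b > c → a > c := fun a b c h1 h2 => h2.trans h1
    have hPD := h.perm.subset hD
    have hPC : IsPartialPerm C := by
      intro p hp q hq hpq
      have h1 := hC hp
      have h2 := hC hq
      simp only [mem_insert] at h1 h2
      have := h.perm p
      have := h.ne
      grind
    have hie : i < e.1 := by
      have h3 := h.lt e (hC'S heC')
      have h4 := h.ne e (hC'S heC')
      have h5 := hm e heC _ hyC
      simp only at h5
      omega
    have hea := h.lt e (hC'S heC')
    have h1 := (hm.splice htr hm' heC heD hPC).le_chainLen
      (r := (· > ·)) (S := insert (i, b) S) (by intro p; simp only [splice, mem_union, mem_filter]; grind)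
    have h2 := (hm'.splice htr hm heD heC hPD).le_chainLen
      (r := (· > ·)) (S := insert (a, j) S) (by intro p; simp only [splice, mem_union, mem_filter]; grind)
    have h3 := card_splice e C D
    omega
  have := card_le_card (union_subset hC'S hD)
  rw [card_union_of_disjoint hdisj] at this
  omega

theorem isMono_of_free_insert {S : Finset (ℕ × ℕ)} {a b : ℕ} (hS : IsPartialPerm S)
    (hlt : ∀ p ∈ S, p.1 < a ∧ p.2 < b) (hf : Free (· < ·) (insert (a, b) S)) :
    IsMono (· > ·) S := by
  intro p hp q hq hpq
  have h1 := hf p (by simp [hp]) q (by simp [hq]) (a, b) (by simp) hpq (hlt q hq).1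
  have h2 : p.2 ≠ q.2 := fun h2 => by
    have := hS p hp q hq (Or.inr h2)
    simp [this] at hpq
  have := (hlt q hq).2
  simp only at h1 ⊢
  omega

theorem isMono_of_chainLen_eq_card {r : ℕ → ℕ → Prop} (h : chainLen r S = #S) : IsMono r S := by
  obtain ⟨C, hC, hm, hc⟩ := exists_isMono_card_eq r S
  rwa [← eq_of_subset_of_card_le hC (by omega)]

theorem chainLen_insert_dec (hlt : ∀ p ∈ S, p.1 < a ∧ p.2 < b) :
    chainLen (· > ·) (insert (a, b) S) = max (chainLen (· > ·) S) 1 := by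
  apply le_antisymm
  · refine chainLen_le fun C hC hm => ?_
    by_cases hc : (a, b) ∈ C
    · apply le_max_of_le_right
      rw [card_le_one]
      have : ∀ p ∈ C, p = (a, b) := fun p hp => by
        by_contra hn
        have hp' : p ∈ S := by grind
        have h1 := hm p hp _ hc (hlt p hp').1
        have := hlt p hp'
        simp only at h1
        omega
      grind
    · exact le_max_of_le_left (hm.le_chainLen (by grind))
  · refine max_le (chainLen_mono (subset_insert _ _)) ?_
    rw [← card_singleton (a, b)]
    exact IsMono.le_chainLen (by simp [IsMono]) (by simp)

theorem chainLen_insert_inc (hlt : ∀ p ∈ S, p.1 < a ∧ p.2 < b) :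
    chainLen (· < ·) (insert (a, b) S) = chainLen (· < ·) S + 1 := by
  apply le_antisymm (chainLen_insert_le _)
  obtain ⟨C, hC, hm, hc⟩ := exists_isMono_card_eq (· < ·) S
  rw [← hc, ← card_insert_of_notMem (s := C) (a := (a, b)) (by grind)]
  refine IsMono.le_chainLen (fun p hp q hq hpq => ?_) (insert_subset_insert _ hC)
  simp only [mem_insert] at hp hq
  have := hm p
  grind

end corner

section growth

/-- The cells of `S` in the first `i` columns and the first `j` rows. -/
def box (S : Finset (ℕ × ℕ)) (i j : ℕ) : Finset (ℕ × ℕ) :=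
  S.filter (fun p => p.1 < i ∧ p.2 < j)

theorem mem_box {S : Finset (ℕ × ℕ)} {i j : ℕ} {p : ℕ × ℕ} :
    p ∈ box S i j ↔ p ∈ S ∧ p.1 < i ∧ p.2 < j := by
  simp [box]

theorem box_subset (S : Finset (ℕ × ℕ)) (i j : ℕ) : box S i j ⊆ S := filter_subset _ _

theorem box_box {S : Finset (ℕ × ℕ)} {i j k l : ℕ} (hi : i ≤ k) (hj : j ≤ l) :
    box (box S k l) i j = box S i j := by
  ext p
  simp only [mem_box]
  grind

/-- The pairs `(v₁, v₂ - v₁)` are partitions with at most two parts. -/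
def Valid (v : ℕ × ℕ) : Prop := v.1 ≤ v.2 ∧ v.2 ≤ 2 * v.1

/-- `v'` is `v`, possibly with a box added to one of the two parts. -/
def Step (v v' : ℕ × ℕ) : Prop :=
  (v'.1 = v.1 ∧ v'.2 = v.2) ∨ (v'.2 = v.2 + 1 ∧ (v'.1 = v.1 ∨ v'.1 = v.1 + 1))

def stat (len : Finset (ℕ × ℕ) → ℕ) (S : Finset (ℕ × ℕ)) : ℕ × ℕ := (len S, #S)

/-- A class of placements, a statistic, and the local rule the statistic obeys around a cell. -/
structure Growth where
  Av : Finset (ℕ × ℕ) → Prop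
  len : Finset (ℕ × ℕ) → ℕ
  Rule : ℕ × ℕ → ℕ × ℕ → ℕ × ℕ → ℕ × ℕ → Prop → Prop
  av_empty : Av ∅
  av_subset : ∀ {S T}, Av S → T ⊆ S → Av T
  len_mono : ∀ {S T}, T ⊆ S → len T ≤ len S
  len_insert_le : ∀ S x, len (insert x S) ≤ len S + 1
  valid : ∀ {S}, IsPartialPerm S → Av S → Valid (stat len S)
  rule_of_av : ∀ {S a b}, IsPartialPerm S → (∀ p ∈ S, p.1 < a + 1 ∧ p.2 < b + 1) → Av S →
    Rule (stat len (box S a b)) (stat len (box S a (b + 1))) (stat len (box S (a + 1) b))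
      (stat len S) ((a, b) ∈ S)
  av_of_rule : ∀ {S a b v}, IsPartialPerm S → (∀ p ∈ S, p.1 < a + 1 ∧ p.2 < b + 1) →
    Av (box S a (b + 1)) → Av (box S (a + 1) b) →
    Rule (stat len (box S a b)) (stat len (box S a (b + 1))) (stat len (box S (a + 1) b))
      v ((a, b) ∈ S) → Av S
  rule_exists : ∀ {l m v}, Valid l → Valid m → Valid v → Step l v → Step m v →
    ∃ r X, Valid r ∧ Step r l ∧ Step r m ∧ Rule r l m v X
  rule_unique : ∀ {l m v r r' X X'}, Valid r → Valid r' → Rule r l m v X → Rule r' l m v X' →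
    r = r' ∧ (X ↔ X')
  rule_right_unique : ∀ {r l m v v' X}, Rule r l m v X → Rule r l m v' X → v = v'
  rule_new : ∀ {r l m v X}, Rule r l m v X → X → l = r ∧ m = r

theorem box_cases {S : Finset (ℕ × ℕ)} {a b : ℕ} (hS : IsPartialPerm S)
    (hb : ∀ p ∈ S, p.1 < a + 1 ∧ p.2 < b + 1) :
    ((a, b) ∈ S ∧ box S a (b + 1) = box S a b ∧ box S (a + 1) b = box S a b ∧
      insert (a, b) (box S a b) = S) ∨
    ((a, b) ∉ S ∧ box S (a + 1) b = box S a b ∧ box S a (b + 1) = S) ∨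
    ((a, b) ∉ S ∧ box S a (b + 1) = box S a b ∧ box S (a + 1) b = S) ∨
    ((a, b) ∉ S ∧ ∃ i j, Hook (box S a b) a b i j ∧ box S (a + 1) b = insert (a, j) (box S a b) ∧
      box S a (b + 1) = insert (i, b) (box S a b) ∧
      insert (a, j) (insert (i, b) (box S a b)) = S) := by
  by_cases hc : (a, b) ∈ S
  · left
    have h : ∀ p ∈ S, p.1 = a ∨ p.2 = b → p = (a, b) := fun p hp h => hS p hp _ hc h
    refine ⟨hc, ?_, ?_, ?_⟩ <;> ext p <;> simp only [mem_box, mem_insert] <;> grind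
  by_cases hx : ∃ x ∈ S, x.1 = a
  swap
  · right; left
    refine ⟨hc, ?_, ?_⟩ <;> ext p <;> simp only [mem_box] <;> grind
  by_cases hy : ∃ y ∈ S, y.2 = b
  swap
  · right; right; left
    refine ⟨hc, ?_, ?_⟩ <;> ext p <;> simp only [mem_box] <;> grind
  right; right; right
  obtain ⟨⟨a', j⟩, hx, rfl⟩ := hx
  obtain ⟨⟨i, b'⟩, hy, rfl⟩ := hy
  dsimp only at *
  have h1 : ∀ p ∈ S, p.1 = a' ∨ p.2 = j → p = (a', j) := fun p hp h => hS p hp _ hx h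
  have h2 : ∀ p ∈ S, p.1 = i ∨ p.2 = b' → p = (i, b') := fun p hp h => hS p hp _ hy h
  have hi : i < a' := by
    have := hb _ hy
    grind
  have hj : j < b' := by
    have := hb _ hx
    grind
  refine ⟨hc, i, j, ⟨hS.subset (box_subset _ _ _), fun p hp => (mem_box.1 hp).2,
    fun p hp => ?_, hi, hj⟩, ?_, ?_, ?_⟩
  · have := mem_box.1 hp
    grind
  all_goals ext p; simp only [mem_box, mem_insert]; grind

/-- The local rule away from the cells of the placement, when one of the row and the column
through the corner is empty. -/
def TrivialRule (r l m v : ℕ × ℕ) : Prop :=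
  (r.1 = m.1 ∧ r.2 = m.2 ∧ l.1 = v.1 ∧ l.2 = v.2) ∨
    (r.1 = l.1 ∧ r.2 = l.2 ∧ m.1 = v.1 ∧ m.2 = v.2)

/-- The sizes when both the row and the column through the corner are occupied. -/
def HookSizes (r l m v : ℕ × ℕ) : Prop := l.2 = r.2 + 1 ∧ m.2 = r.2 + 1 ∧ v.2 = r.2 + 2

theorem Hook.sizes {S : Finset (ℕ × ℕ)} {a b i j : ℕ} (h : Hook S a b i j)
    (len : Finset (ℕ × ℕ) → ℕ) :
    HookSizes (stat len S) (stat len (insert (i, b) S)) (stat len (insert (a, j) S))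
      (stat len (insert (a, j) (insert (i, b) S))) := by
  have hlt := h.lt
  have hi := h.hi
  have h1 : (i, b) ∉ S := by grind
  have h2 : (a, j) ∉ S := by grind
  have h3 : (a, j) ∉ insert (i, b) S := by grind
  simp only [HookSizes, stat, card_insert_of_notMem h1, card_insert_of_notMem h2,
    card_insert_of_notMem h3, and_self]

theorem not_trivialRule {r l m v v' : ℕ × ℕ} (h : HookSizes r l m v) :
    ¬ TrivialRule r l m v' := by
  simp only [TrivialRule, HookSizes] at *
  omega

/-- The local rule for the longest increasing chain of a placement with no decreasing triple. -/
def DecRule (r l m v : ℕ × ℕ) (X : Prop) : Prop :=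
  (X ∧ l = r ∧ m = r ∧ v = (r.1 + 1, r.2 + 1)) ∨ (¬ X ∧ TrivialRule r l m v) ∨
  (¬ X ∧ HookSizes r l m v ∧ v.1 = max l.1 m.1 ∧ v.1 = r.1 + 1)

theorem exists_decRule {l m v : ℕ × ℕ} (h1 : Valid l) (h2 : Valid m) (h3 : Valid v)
    (h4 : Step l v) (h5 : Step m v) :
    ∃ r X, Valid r ∧ Step r l ∧ Step r m ∧ DecRule r l m v X := by
  by_cases h6 : l.1 = v.1 ∧ l.2 = v.2
  · exact ⟨m, False, h2, by simpa only [Step, h6.1, h6.2] using h5, Or.inl ⟨rfl, rfl⟩,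
      Or.inr (Or.inl ⟨not_false, Or.inl ⟨rfl, rfl, h6⟩⟩)⟩
  by_cases h7 : m.1 = v.1 ∧ m.2 = v.2
  · exact ⟨l, False, h1, Or.inl ⟨rfl, rfl⟩, by simpa only [Step, h7.1, h7.2] using h4,
      Or.inr (Or.inl ⟨not_false, Or.inr ⟨rfl, rfl, h7⟩⟩)⟩
  by_cases h8 : l.1 = m.1 ∧ v.1 = l.1 + 1
  · refine ⟨l, True, h1, Or.inl ⟨rfl, rfl⟩, ?_, Or.inl ⟨trivial, rfl, ?_⟩⟩ <;>
      simp only [Valid, Step, Prod.ext_iff] at * <;> omega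
  · refine ⟨(v.1 - 1, v.2 - 2), False, ?_, ?_, ?_, Or.inr (Or.inr ⟨not_false, ?_, ?_⟩)⟩ <;>
      simp only [Valid, Step, HookSizes] at * <;> omega

theorem DecRule.unique {l m v r r' : ℕ × ℕ} {X X' : Prop} (h : DecRule r l m v X)
    (h' : DecRule r' l m v X') : r = r' ∧ (X ↔ X') := by
  simp only [DecRule, HookSizes, TrivialRule, Prod.ext_iff] at h h' ⊢
  rcases h with ⟨hX, h⟩ | ⟨hX, h⟩ | ⟨hX, h⟩ <;>
    rcases h' with ⟨hX', h'⟩ | ⟨hX', h'⟩ | ⟨hX', h'⟩ <;>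
    simp only [hX, hX', iff_self, and_true, iff_false, iff_true, not_true, and_false] <;>
    omega

theorem DecRule.right_unique {r l m v v' : ℕ × ℕ} {X : Prop} (h : DecRule r l m v X)
    (h' : DecRule r l m v' X) : v = v' := by
  simp only [DecRule, HookSizes, TrivialRule, Prod.ext_iff] at h h' ⊢
  rcases h with ⟨hX, h⟩ | ⟨hX, h⟩ | ⟨hX, h⟩ <;>
    rcases h' with ⟨hX', h'⟩ | ⟨hX', h'⟩ | ⟨hX', h'⟩ <;>
    first | exact absurd hX hX' | exact absurd hX' hX | omega

/-- The local rule for the longest decreasing chain of a placement with no increasing triple. -/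
def IncRule (r l m v : ℕ × ℕ) (X : Prop) : Prop :=
  (X ∧ l = r ∧ m = r ∧ r.1 = r.2 ∧ v = (max r.1 1, r.2 + 1)) ∨
  (¬ X ∧ TrivialRule r l m v) ∨
  (¬ X ∧ HookSizes r l m v ∧ ((l.1 ≠ m.1 ∧ v.1 = r.1 + 1) ∨
    (l.1 = r.1 + 1 ∧ m.1 = r.1 + 1 ∧ v.1 = r.1 + 2) ∨
    (l.1 = r.1 ∧ m.1 = r.1 ∧ r.2 + 2 ≤ 2 * r.1 ∧ v.1 = r.1) ∨
    (l.1 = r.1 ∧ m.1 = r.1 ∧ r.2 + 1 = 2 * r.1 ∧ v.1 = r.1 + 1)))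

theorem exists_incRule {l m v : ℕ × ℕ} (h1 : Valid l) (h2 : Valid m) (h3 : Valid v)
    (h4 : Step l v) (h5 : Step m v) :
    ∃ r X, Valid r ∧ Step r l ∧ Step r m ∧ IncRule r l m v X := by
  by_cases h6 : l.1 = v.1 ∧ l.2 = v.2
  · exact ⟨m, False, h2, by simpa only [Step, h6.1, h6.2] using h5, Or.inl ⟨rfl, rfl⟩,
      Or.inr (Or.inl ⟨not_false, Or.inl ⟨rfl, rfl, h6⟩⟩)⟩
  by_cases h7 : m.1 = v.1 ∧ m.2 = v.2
  · exact ⟨l, False, h1, Or.inl ⟨rfl, rfl⟩, by simpa only [Step, h7.1, h7.2] using h4,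
      Or.inr (Or.inl ⟨not_false, Or.inr ⟨rfl, rfl, h7⟩⟩)⟩
  by_cases h8 : l.1 ≠ m.1
  · refine ⟨(v.1 - 1, v.2 - 2), False, ?_, ?_, ?_, Or.inr (Or.inr ⟨not_false, ?_, ?_⟩)⟩ <;>
      simp only [Valid, Step, HookSizes] at h1 h2 h3 h4 h5 ⊢ <;> omega
  by_cases h9 : l.1 = l.2 ∧ v.1 = max l.1 1
  · refine ⟨l, True, h1, Or.inl ⟨rfl, rfl⟩, ?_, Or.inl ⟨trivial, rfl, ?_⟩⟩ <;>
      simp only [Valid, Step, Prod.ext_iff] at * <;> omega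
  by_cases h10 : v.1 = l.1 + 1 ∧ l.2 < 2 * l.1
  · refine ⟨(l.1 - 1, v.2 - 2), False, ?_, ?_, ?_, Or.inr (Or.inr ⟨not_false, ?_, ?_⟩)⟩ <;>
      simp only [Valid, Step, HookSizes] at h1 h2 h3 h4 h5 ⊢ <;> omega
  simp only [Valid, Step] at h1 h2 h3 h4 h5
  have h11 : l.2 + 1 = v.2 ∧ m.2 + 1 = v.2 ∧ m.1 = l.1 := by omega
  have h12 : l.1 + 2 ≤ v.2 := by omega
  obtain ⟨k, h13⟩ : ∃ k, v.2 = k + 2 := ⟨v.2 - 2, by omega⟩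
  refine ⟨(l.1, k), False, ?_, Or.inr ⟨?_, Or.inl rfl⟩, Or.inr ⟨?_, Or.inl h11.2.2⟩,
    Or.inr (Or.inr ⟨not_false, ⟨?_, ?_, h13⟩, Or.inr (Or.inr ?_)⟩)⟩
  · simp only [Valid]
    omega
  · omega
  · omega
  · omega
  · omega
  · rcases h4 with h4 | ⟨-, h4 | h4⟩
    · exact absurd ⟨h4.1.symm, h4.2.symm⟩ h6
    · exact Or.inl ⟨rfl, h11.2.2, by dsimp only; omega, h4⟩
    · exact Or.inr ⟨rfl, h11.2.2, by dsimp only; omega, h4⟩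

theorem IncRule.unique {l m v r r' : ℕ × ℕ} {X X' : Prop} (hr : Valid r) (hr' : Valid r')
    (h : IncRule r l m v X) (h' : IncRule r' l m v X') : r = r' ∧ (X ↔ X') := by
  simp only [Valid] at hr hr'
  simp only [IncRule, HookSizes, TrivialRule, Prod.ext_iff] at h h' ⊢
  rcases h with ⟨hX, h⟩ | ⟨hX, h⟩ | ⟨hX, h⟩ <;>
    rcases h' with ⟨hX', h'⟩ | ⟨hX', h'⟩ | ⟨hX', h'⟩ <;>
    simp only [hX, hX', iff_self, and_true, iff_false, iff_true, not_true, and_false] <;>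
    omega

theorem IncRule.right_unique {r l m v v' : ℕ × ℕ} {X : Prop} (h : IncRule r l m v X)
    (h' : IncRule r l m v' X) : v = v' := by
  simp only [IncRule, HookSizes, TrivialRule, Prod.ext_iff] at h h' ⊢
  rcases h with ⟨hX, h⟩ | ⟨hX, h⟩ | ⟨hX, h⟩ <;>
    rcases h' with ⟨hX', h'⟩ | ⟨hX', h'⟩ | ⟨hX', h'⟩ <;>
    first | exact absurd hX hX' | exact absurd hX' hX | omega

noncomputable def decGrowth : Growth where
  Av := Free (· > ·)
  len := chainLen (· < ·)
  Rule := DecRule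
  av_empty := fun p hp => absurd hp (notMem_empty p)
  av_subset h h' := h.subset h'
  len_mono h := chainLen_mono h
  len_insert_le S x := chainLen_insert_le x
  valid hS h := ⟨chainLen_le_card, card_le_two_mul_chainLen (by omega) hS h⟩
  rule_of_av := by
    intro S a b hS hb hf
    rcases box_cases hS hb with ⟨hc, h1, h2, h3⟩ | ⟨hc, h1, h2⟩ | ⟨hc, h1, h2⟩ |
      ⟨hc, i, j, hH, h1, h2, h3⟩
    · left
      refine ⟨hc, by rw [h1], by rw [h2], ?_⟩
      have hlt : ∀ p ∈ box S a b, p.1 < a ∧ p.2 < b := fun p hp => (mem_box.1 hp).2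
      have h4 := chainLen_insert_inc hlt
      have h5 : (a, b) ∉ box S a b := by simp [mem_box]
      have h6 := card_insert_of_notMem h5
      rw [h3] at h4 h6
      simp [stat, h4, h6]
    · exact Or.inr (Or.inl ⟨hc, Or.inl (by simp [h1, h2])⟩)
    · exact Or.inr (Or.inl ⟨hc, Or.inr (by simp [h1, h2])⟩)
    · right; right
      have h4 := hH.sizes (chainLen (· < ·))
      have h5 := hH.chainLen_inc
      rw [h3, ← h1, ← h2] at h4 h5
      rw [← h3] at hf
      have h6 := hH.lt_chainLen_inc hf
      have h7 : chainLen (· < ·) (box S a (b + 1)) ≤ chainLen (· < ·) (box S a b) + 1 := by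
        rw [h2]
        exact chainLen_insert_le _
      have h8 : chainLen (· < ·) (box S (a + 1) b) ≤ chainLen (· < ·) (box S a b) + 1 := by
        rw [h1]
        exact chainLen_insert_le _
      rw [← h1, ← h2] at h6
      refine ⟨hc, h4, h5, ?_⟩
      simp only [stat]
      omega
  av_of_rule := by
    intro S a b v hS hb hl hm hr
    rcases box_cases hS hb with ⟨hc, h1, h2, h3⟩ | ⟨hc, h1, h2⟩ | ⟨hc, h1, h2⟩ |
      ⟨hc, i, j, hH, h1, h2, h3⟩
    · rw [h1] at hl
      rw [← h3]
      have hlt : ∀ p ∈ box S a b, p.1 < a ∧ p.2 < b := fun p hp => (mem_box.1 hp).2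
      intro p hp q hq t ht hpq hqt h4 h5
      have := hl p
      simp only [mem_insert] at hp hq ht
      grind
    · rwa [h2] at hl
    · rwa [h2] at hm
    · have h4 := hH.sizes (chainLen (· < ·))
      rw [h3, ← h1, ← h2] at h4
      rcases hr with ⟨h, -⟩ | ⟨-, h⟩ | ⟨-, -, h5, h6⟩
      · exact absurd h hc
      · exact absurd h (not_trivialRule h4)
      · rw [h1] at hm h5
        rw [h2] at hl h5
        rw [← h3]
        refine hH.free_dec hm hl ?_
        simp only [stat] at h5 h6
        omega
  rule_exists := exists_decRule
  rule_unique _ _ := DecRule.unique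
  rule_right_unique := DecRule.right_unique
  rule_new := by
    rintro r l m v X h hX
    rcases h with ⟨-, h1, h2, -⟩ | ⟨h, -⟩ | ⟨h, -⟩
    · exact ⟨h1, h2⟩
    all_goals exact absurd hX h

noncomputable def incGrowth : Growth where
  Av := Free (· < ·)
  len := chainLen (· > ·)
  Rule := IncRule
  av_empty := fun p hp => absurd hp (notMem_empty p)
  av_subset h h' := h.subset h'
  len_mono h := chainLen_mono h
  len_insert_le S x := chainLen_insert_le x
  valid hS h := ⟨chainLen_le_card, card_le_two_mul_chainLen (by omega) hS h⟩
  rule_of_av := by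
    intro S a b hS hb hf
    rcases box_cases hS hb with ⟨hc, h1, h2, h3⟩ | ⟨hc, h1, h2⟩ | ⟨hc, h1, h2⟩ |
      ⟨hc, i, j, hH, h1, h2, h3⟩
    · left
      have hlt : ∀ p ∈ box S a b, p.1 < a ∧ p.2 < b := fun p hp => (mem_box.1 hp).2
      have h4 := chainLen_insert_dec hlt
      have h5 : (a, b) ∉ box S a b := by simp [mem_box]
      have h6 := card_insert_of_notMem h5
      have h7 := (isMono_of_free_insert (hS.subset (box_subset _ _ _)) hlt
        (by rwa [h3])).le_chainLen subset_rfl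
      have h8 : chainLen (· > ·) (box S a b) ≤ #(box S a b) := chainLen_le_card
      rw [h3] at h4 h6
      refine ⟨hc, by rw [h1], by rw [h2], le_antisymm h8 h7, ?_⟩
      simp [stat, h4, h6]
    · exact Or.inr (Or.inl ⟨hc, Or.inl (by simp [h1, h2])⟩)
    · exact Or.inr (Or.inl ⟨hc, Or.inr (by simp [h1, h2])⟩)
    · right; right
      have h4 := hH.sizes (chainLen (· > ·))
      have hl1 := chainLen_insert_le (r := (· > ·)) (S := box S a b) (i, b)
      have hm1 := chainLen_insert_le (r := (· > ·)) (S := box S a b) (a, j)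
      have hv1 := chainLen_insert_le (r := (· > ·)) (S := insert (i, b) (box S a b)) (a, j)
      have hv2 := chainLen_insert_le (r := (· > ·)) (S := insert (a, j) (box S a b)) (i, b)
      have hl2 := chainLen_mono (r := (· > ·)) (subset_insert (i, b) (box S a b))
      have hm2 := chainLen_mono (r := (· > ·)) (subset_insert (a, j) (box S a b))
      have hv3 := chainLen_mono (r := (· > ·)) (subset_insert (a, j) (insert (i, b) (box S a b)))
      have hv4 := chainLen_mono (r := (· > ·)) (subset_insert (i, b) (insert (a, j) (box S a b)))
      rw [insert_comm] at hv2 hv4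
      have h5 := hH.add_two_le_chainLen_dec
      have h6 := hH.two_mul_chainLen_dec_le
      have h7 := card_le_two_mul_chainLen (r := (· > ·)) (by omega) hS hf
      have h8 := card_le_two_mul_chainLen (r := (· > ·)) (by omega)
        (hS.subset (box_subset S a (b + 1))) (hf.subset (box_subset S a (b + 1)))
      rw [h3, ← h1, ← h2] at *
      refine ⟨hc, h4, ?_⟩
      simp only [stat, HookSizes] at h4 ⊢
      omega
  av_of_rule := by
    intro S a b v hS hb hl hm hr
    rcases box_cases hS hb with ⟨hc, h1, h2, h3⟩ | ⟨hc, h1, h2⟩ | ⟨hc, h1, h2⟩ |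
      ⟨hc, i, j, hH, h1, h2, h3⟩
    · have hlt : ∀ p ∈ box S a b, p.1 < a ∧ p.2 < b := fun p hp => (mem_box.1 hp).2
      rcases hr with ⟨-, -, -, h, -⟩ | ⟨h, -⟩ | ⟨h, -⟩
      · have h4 := isMono_of_chainLen_eq_card h
        rw [← h3]
        intro p hp q hq t ht hpq hqt h5 h6
        have := h4 p
        simp only [mem_insert] at hp hq ht
        grind
      all_goals exact absurd hc h
    · rwa [h2] at hl
    · rwa [h2] at hm
    · rw [← h3]
      exact hH.free_inc (by rwa [← h1]) (by rwa [← h2])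
  rule_exists := exists_incRule
  rule_unique := IncRule.unique
  rule_right_unique := IncRule.right_unique
  rule_new := by
    rintro r l m v X h hX
    rcases h with ⟨-, h1, h2, -⟩ | ⟨h, -⟩ | ⟨h, -⟩
    · exact ⟨h1, h2⟩
    all_goals exact absurd hX h

end growth

section filling

/-- The vertices of the boundary path of the Ferrers shape `F`. -/
def Bd (F : Finset (ℕ × ℕ)) (v : ℕ × ℕ) : Prop :=
  v ∉ F ∧ ∀ i j, v = (i + 1, j + 1) → (i, j) ∈ F

structure Labelling (F : Finset (ℕ × ℕ)) (w : ℕ × ℕ → ℕ × ℕ) : Prop where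
  valid : ∀ v, Bd F v → Valid (w v)
  zero : ∀ v, v.1 = 0 ∨ v.2 = 0 → Bd F v → w v = (0, 0)
  right : ∀ i j, Bd F (i, j) → Bd F (i + 1, j) → Step (w (i, j)) (w (i + 1, j))
  up : ∀ i j, Bd F (i, j) → Bd F (i, j + 1) → Step (w (i, j)) (w (i, j + 1))

def Growth.stat (G : Growth) (P : Finset (ℕ × ℕ)) (v : ℕ × ℕ) : ℕ × ℕ :=
  ShapeWilf.stat G.len (box P v.1 v.2)

structure IsFilling (G : Growth) (F P : Finset (ℕ × ℕ)) : Prop where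
  subset : P ⊆ F
  perm : IsPartialPerm P
  av : ∀ c ∈ F, G.Av (box P (c.1 + 1) (c.2 + 1))

variable {G : Growth} {F P Q : Finset (ℕ × ℕ)} {a b : ℕ}

theorem box_eq_empty {i j : ℕ} (h : i = 0 ∨ j = 0) : box P i j = ∅ := by
  ext p
  simp only [mem_box, notMem_empty, iff_false]
  omega

theorem Growth.stat_eq_zero {v : ℕ × ℕ} (h : v.1 = 0 ∨ v.2 = 0) : G.stat P v = (0, 0) := by
  have h1 := (G.valid (S := ∅) (fun p hp => absurd hp (notMem_empty p)) G.av_empty).1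
  simp only [ShapeWilf.stat, card_empty, Nat.le_zero] at h1
  simp [Growth.stat, ShapeWilf.stat, box_eq_empty h, h1]

theorem Growth.step_of_insert {S T : Finset (ℕ × ℕ)} {x : ℕ × ℕ} (h : S = T ∨ S = insert x T) :
    Step (ShapeWilf.stat G.len T) (ShapeWilf.stat G.len S) := by
  rcases h with rfl | rfl
  · exact Or.inl ⟨rfl, rfl⟩
  by_cases hx : x ∈ T
  · rw [insert_eq_of_mem hx]
    exact Or.inl ⟨rfl, rfl⟩
  have h1 := G.len_insert_le T x
  have h2 := G.len_mono (subset_insert x T)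
  refine Or.inr ⟨card_insert_of_notMem hx, ?_⟩
  simp only [ShapeWilf.stat]
  omega

theorem IsPartialPerm.exists_box_right (hP : IsPartialPerm P) (i j : ℕ) :
    ∃ x, box P (i + 1) j = box P i j ∨ box P (i + 1) j = insert x (box P i j) := by
  by_cases h : ∃ x ∈ P, x.1 = i ∧ x.2 < j
  · obtain ⟨x, hx, rfl, hj⟩ := h
    refine ⟨x, Or.inr ?_⟩
    ext p
    have := hP p
    simp only [mem_box, mem_insert]
    grind
  · refine ⟨(0, 0), Or.inl ?_⟩
    ext p
    simp only [mem_box]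
    grind

theorem IsPartialPerm.exists_box_up (hP : IsPartialPerm P) (i j : ℕ) :
    ∃ x, box P i (j + 1) = box P i j ∨ box P i (j + 1) = insert x (box P i j) := by
  by_cases h : ∃ x ∈ P, x.1 < i ∧ x.2 = j
  · obtain ⟨x, hx, hj, rfl⟩ := h
    refine ⟨x, Or.inr ?_⟩
    ext p
    have := hP p
    simp only [mem_box, mem_insert]
    grind
  · refine ⟨(0, 0), Or.inl ?_⟩
    ext p
    simp only [mem_box]
    grind

theorem IsFilling.av_of_bd (h : IsFilling G F P) {v : ℕ × ℕ} (hv : Bd F v) :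
    G.Av (box P v.1 v.2) := by
  obtain ⟨_ | i, _ | j⟩ := v
  · rw [box_eq_empty (by simp)]
    exact G.av_empty
  · rw [box_eq_empty (by simp)]
    exact G.av_empty
  · rw [box_eq_empty (by simp)]
    exact G.av_empty
  · exact h.av _ (hv.2 i j rfl)

theorem IsFilling.labelling (h : IsFilling G F P) : Labelling F (G.stat P) where
  valid v hv := G.valid (h.perm.subset (box_subset _ _ _)) (h.av_of_bd hv)
  zero v hv _ := Growth.stat_eq_zero hv
  right i j _ _ := by
    obtain ⟨x, hx⟩ := h.perm.exists_box_right i j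
    exact Growth.step_of_insert hx
  up i j _ _ := by
    obtain ⟨x, hx⟩ := h.perm.exists_box_up i j
    exact Growth.step_of_insert hx

/-- `(a, b)` is a corner of the Ferrers shape `F`. -/
structure IsCorner (F : Finset (ℕ × ℕ)) (a b : ℕ) : Prop where
  lower : IsLowerSet (F : Set (ℕ × ℕ))
  mem : (a, b) ∈ F
  right : (a + 1, b) ∉ F
  up : (a, b + 1) ∉ F

theorem exists_isCorner (hF : IsLowerSet (F : Set (ℕ × ℕ))) (h : F.Nonempty) :
    ∃ a b, IsCorner F a b := by
  obtain ⟨⟨a, b⟩, hc, hmax⟩ := F.exists_max_image (fun p => p.1 + p.2) h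
  refine ⟨a, b, hF, hc, fun h => ?_, fun h => ?_⟩
  all_goals
    have := hmax _ h
    dsimp only at this
    omega

namespace IsCorner

theorem mem_of_le (h : IsCorner F a b) {p : ℕ × ℕ} {i j : ℕ} (hp : p ∈ F) (hi : i ≤ p.1)
    (hj : j ≤ p.2) : (i, j) ∈ F :=
  h.lower (show (i, j) ≤ p from ⟨hi, hj⟩) hp

theorem eq_of_le (h : IsCorner F a b) {p : ℕ × ℕ} (hp : p ∈ F) (h1 : a ≤ p.1) (h2 : b ≤ p.2) :
    p = (a, b) := by
  by_contra hne
  by_cases h3 : a < p.1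
  · exact h.right (h.mem_of_le hp h3 h2)
  by_cases h4 : b < p.2
  · exact h.up (h.mem_of_le hp h1 h4)
  exact hne (Prod.ext (by dsimp only; omega) (by dsimp only; omega))

theorem lower_erase (h : IsCorner F a b) :
    IsLowerSet ((F.erase (a, b) : Finset (ℕ × ℕ)) : Set (ℕ × ℕ)) := by
  intro p q hqp hp
  simp only [coe_erase, Set.mem_sdiff, mem_coe, Set.mem_singleton_iff] at hp ⊢
  refine ⟨h.lower hqp hp.1, ?_⟩
  rintro rfl
  exact hp.2 (h.eq_of_le hp.1 hqp.1 hqp.2)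

theorem bd_left (h : IsCorner F a b) : Bd F (a, b + 1) :=
  ⟨h.up, fun i j hij => h.mem_of_le h.mem (by grind) (by grind)⟩

theorem bd_below (h : IsCorner F a b) : Bd F (a + 1, b) :=
  ⟨h.right, fun i j hij => h.mem_of_le h.mem (by grind) (by grind)⟩

theorem bd_out (h : IsCorner F a b) : Bd F (a + 1, b + 1) :=
  ⟨fun h' => h.right (h.mem_of_le h' le_rfl (by simp)), fun i j hij => by
    have := h.mem
    grind⟩

theorem bd_erase (h : IsCorner F a b) {v : ℕ × ℕ} :
    Bd (F.erase (a, b)) v ↔ v = (a, b) ∨ (Bd F v ∧ v ≠ (a + 1, b + 1)) := by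
  constructor
  · rintro ⟨h1, h2⟩
    by_cases hv : v = (a, b)
    · exact Or.inl hv
    refine Or.inr ⟨⟨fun h3 => h1 (mem_erase.2 ⟨hv, h3⟩), fun i j hij =>
      mem_of_mem_erase (h2 i j hij)⟩, ?_⟩
    rintro rfl
    exact notMem_erase _ _ (h2 a b rfl)
  · rintro (rfl | ⟨h1, h2⟩)
    · exact ⟨notMem_erase _ _, fun i j hij => mem_erase.2 ⟨by grind,
        h.mem_of_le h.mem (by grind) (by grind)⟩⟩
    · exact ⟨fun h3 => h1.1 (mem_of_mem_erase h3), fun i j hij =>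
        mem_erase.2 ⟨by grind, h1.2 i j hij⟩⟩

/-- The corner lies in the box below a boundary vertex only when the vertex is its own. -/
theorem eq_of_bd (h : IsCorner F a b) {v : ℕ × ℕ} (hv : Bd F v) (h1 : a < v.1) (h2 : b < v.2) :
    v = (a + 1, b + 1) := by
  obtain ⟨_ | i, _ | j⟩ := v
  · omega
  · omega
  · omega
  · have := h.eq_of_le (hv.2 i j rfl) (by dsimp only at *; omega) (by dsimp only at *; omega)
    grind

theorem labelling_update (h : IsCorner F a b) {w : ℕ × ℕ → ℕ × ℕ} (hw : Labelling F w)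
    {r : ℕ × ℕ} (hr : Valid r) (hl : Step r (w (a, b + 1))) (hm : Step r (w (a + 1, b))) :
    Labelling (F.erase (a, b)) (Function.update w (a, b) r) := by
  have key : ∀ v, Bd (F.erase (a, b)) v → v ≠ (a, b) → Bd F v := by
    intro v hv hne
    rcases h.bd_erase.1 hv with h1 | h1
    · exact absurd h1 hne
    · exact h1.1
  refine ⟨fun v hv => ?_, fun v h0 hv => ?_, fun i j h1 h2 => ?_, fun i j h1 h2 => ?_⟩
  · by_cases hva : v = (a, b)
    · rw [hva, Function.update_self]
      exact hr
    · rw [Function.update_of_ne hva]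
      exact hw.valid v (key v hv hva)
  · by_cases hva : v = (a, b)
    · rw [hva, Function.update_self]
      subst hva
      rcases h0 with h0 | h0
      · have := hw.zero (a, b + 1) (Or.inl h0) h.bd_left
        rw [this] at hl
        simp only [Step] at hl
        ext <;> dsimp only <;> omega
      · have := hw.zero (a + 1, b) (Or.inr h0) h.bd_below
        rw [this] at hm
        simp only [Step] at hm
        ext <;> dsimp only <;> omega
    · rw [Function.update_of_ne hva]
      exact hw.zero v h0 (key v hv hva)
  · have hne : (i + 1, j) ≠ (a, b) := fun he => h1.1
      (mem_erase.2 ⟨by grind, h.mem_of_le h.mem (by grind) (by grind)⟩)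
    rw [Function.update_of_ne hne]
    by_cases hva : (i, j) = (a, b)
    · rw [hva, Function.update_self]
      grind
    · rw [Function.update_of_ne hva]
      exact hw.right i j (key _ h1 hva) (key _ h2 hne)
  · have hne : (i, j + 1) ≠ (a, b) := fun he => h1.1
      (mem_erase.2 ⟨by grind, h.mem_of_le h.mem (by grind) (by grind)⟩)
    rw [Function.update_of_ne hne]
    by_cases hva : (i, j) = (a, b)
    · rw [hva, Function.update_self]
      grind
    · rw [Function.update_of_ne hva]
      exact hw.up i j (key _ h1 hva) (key _ h2 hne)

theorem box_erase {i j : ℕ} (h : ¬ (a < i ∧ b < j)) : box (P.erase (a, b)) i j = box P i j := by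
  ext p
  simp only [mem_box, mem_erase]
  grind

theorem filling_erase (h : IsCorner F a b) (hP : IsFilling G F P) :
    IsFilling G (F.erase (a, b)) (P.erase (a, b)) where
  subset := erase_subset_erase _ hP.subset
  perm := hP.perm.subset (erase_subset _ _)
  av c hc := by
    have hc := mem_erase.1 hc
    rw [box_erase (fun h' => hc.1 (h.eq_of_le hc.2 (by omega) (by omega)))]
    exact hP.av c hc.2

theorem stat_erase (h : IsCorner F a b) {v : ℕ × ℕ} (hv : Bd (F.erase (a, b)) v) :
    G.stat (P.erase (a, b)) v = G.stat P v := by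
  have : ¬ (a < v.1 ∧ b < v.2) := by
    rcases h.bd_erase.1 hv with h1 | ⟨h1, h2⟩
    · grind
    · exact fun h3 => h2 (h.eq_of_bd h1 h3.1 h3.2)
  rw [Growth.stat, Growth.stat, box_erase this]

theorem rule (h : IsCorner F a b) (hP : IsFilling G F P) :
    G.Rule (G.stat P (a, b)) (G.stat P (a, b + 1)) (G.stat P (a + 1, b))
      (G.stat P (a + 1, b + 1)) ((a, b) ∈ P) := by
  have := G.rule_of_av (hP.perm.subset (box_subset P (a + 1) (b + 1)))
    (fun p hp => (mem_box.1 hp).2) (hP.av _ h.mem)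
  rw [box_box (by omega) (by omega), box_box (by omega) (by omega),
    box_box (by omega) (by omega)] at this
  simpa [mem_box, Growth.stat] using this

end IsCorner

theorem IsFilling.eq (hF : IsLowerSet (F : Set (ℕ × ℕ))) (hP : IsFilling G F P)
    (hQ : IsFilling G F Q) (h : ∀ v, Bd F v → G.stat P v = G.stat Q v) : P = Q := by
  induction hn : #F generalizing F P Q with
  | zero =>
    have h1 := hP.subset
    have h2 := hQ.subset
    rw [card_eq_zero.1 hn, subset_empty] at h1 h2
    rw [h1, h2]
  | succ n ih =>
    obtain ⟨a, b, hc⟩ := exists_isCorner hF (card_pos.1 (by omega))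
    have hP' := hc.filling_erase hP
    have hQ' := hc.filling_erase hQ
    have hbd : Bd (F.erase (a, b)) (a, b) := hc.bd_erase.2 (Or.inl rfl)
    have h1 := hc.rule hP
    rw [h _ hc.bd_left, h _ hc.bd_below, h _ hc.bd_out] at h1
    have hv1 := hP'.labelling.valid _ hbd
    have hv2 := hQ'.labelling.valid _ hbd
    rw [hc.stat_erase hbd] at hv1 hv2
    obtain ⟨h2, h3⟩ := G.rule_unique hv1 hv2 h1 (hc.rule hQ)
    have h4 := ih hc.lower_erase hP' hQ' (fun v hv => by
      rw [hc.stat_erase hv, hc.stat_erase hv]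
      rcases hc.bd_erase.1 hv with rfl | h5
      · exact h2
      · exact h v h5.1) (by rw [card_erase_of_mem hc.mem]; omega)
    ext p
    by_cases hp : p = (a, b)
    · rw [hp, h3]
    · have := Finset.ext_iff.1 h4 p
      simpa [hp] using this

theorem Labelling.exists_filling (G : Growth) (hF : IsLowerSet (F : Set (ℕ × ℕ)))
    {w : ℕ × ℕ → ℕ × ℕ} (hw : Labelling F w) :
    ∃ P, IsFilling G F P ∧ ∀ v, Bd F v → G.stat P v = w v := by
  induction hn : #F generalizing F w with
  | zero =>
    have hF0 := card_eq_zero.1 hn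
    refine ⟨∅, ⟨empty_subset _, fun p hp => absurd hp (notMem_empty p), fun c hc => ?_⟩,
      fun v hv => ?_⟩
    · rw [hF0] at hc
      exact absurd hc (notMem_empty c)
    · have h0 : v.1 = 0 ∨ v.2 = 0 := by
        obtain ⟨_ | i, _ | j⟩ := v
        · simp
        · simp
        · simp
        · have := hv.2 i j rfl
          rw [hF0] at this
          exact absurd this (notMem_empty _)
      rw [hw.zero v h0 hv, Growth.stat_eq_zero h0]
  | succ n ih =>
    obtain ⟨a, b, hc⟩ := exists_isCorner hF (card_pos.1 (by omega))
    obtain ⟨r, X, hr, hl, hm, hX⟩ := G.rule_exists (hw.valid _ hc.bd_left)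
      (hw.valid _ hc.bd_below) (hw.valid _ hc.bd_out) (hw.right _ _ hc.bd_left hc.bd_out)
      (hw.up _ _ hc.bd_below hc.bd_out)
    obtain ⟨P, hP, hPw⟩ := ih hc.lower_erase (hc.labelling_update hw hr hl hm)
      (by rw [card_erase_of_mem hc.mem]; omega)
    have hcP : (a, b) ∉ P := fun h => notMem_erase _ _ (hP.subset h)
    obtain ⟨Q, hQP, hQX⟩ : ∃ Q : Finset (ℕ × ℕ), Q.erase (a, b) = P ∧ ((a, b) ∈ Q ↔ X) := by
      by_cases hX : X
      · exact ⟨insert (a, b) P, erase_insert hcP, by simp [hX]⟩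
      · exact ⟨P, erase_eq_of_notMem hcP, by simp [hX, hcP]⟩
    have hbox : ∀ i j, ¬ (a < i ∧ b < j) → box Q i j = box P i j := fun i j h => by
      rw [← hQP, IsCorner.box_erase h]
    have hsQ : ∀ v, Bd (F.erase (a, b)) v → G.stat Q v = Function.update w (a, b) r v := by
      intro v hv
      rw [← hPw v hv, ← hQP, hc.stat_erase hv]
    have hne : ∀ v, Bd F v → v ≠ (a + 1, b + 1) → G.stat Q v = w v := by
      intro v hv hv'
      rw [hsQ v (hc.bd_erase.2 (Or.inr ⟨hv, hv'⟩)), Function.update_of_ne]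
      rintro rfl
      exact hv.1 hc.mem
    have hsr : G.stat Q (a, b) = r := by
      rw [hsQ _ (hc.bd_erase.2 (Or.inl rfl)), Function.update_self]
    have hsl := hne _ hc.bd_left (by simp)
    have hsm := hne _ hc.bd_below (by simp)
    have hQF : Q ⊆ F := fun p hp => by
      by_cases hpc : p = (a, b)
      · exact hpc ▸ hc.mem
      · exact mem_of_mem_erase (hP.subset (hQP ▸ mem_erase.2 ⟨hpc, hp⟩))
    have hfree : (a, b) ∈ Q → ∀ p ∈ P, p.1 ≠ a ∧ p.2 ≠ b := by
      intro hcQ p hp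
      have hpF := hP.subset hp
      obtain ⟨h1, h2⟩ := G.rule_new hX (hQX.1 hcQ)
      rw [← hsl, ← hsr] at h1
      rw [← hsm, ← hsr] at h2
      have h3 := congrArg Prod.snd h1
      have h4 := congrArg Prod.snd h2
      simp only [Growth.stat, stat] at h3 h4
      rw [hbox _ _ (by omega), hbox _ _ (by omega)] at h3 h4
      have h5 : box P a b = box P a (b + 1) := eq_of_subset_of_card_le
        (fun p hp => by simp only [mem_box] at hp ⊢; exact ⟨hp.1, by omega, by omega⟩) h3.le
      have h6 : box P a b = box P (a + 1) b := eq_of_subset_of_card_le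
        (fun p hp => by simp only [mem_box] at hp ⊢; exact ⟨hp.1, by omega, by omega⟩) h4.le
      have h7 := Finset.ext_iff.1 h5 p
      have h8 := Finset.ext_iff.1 h6 p
      have h9 := mem_erase.1 hpF
      have h10 : ¬ (a ≤ p.1 ∧ b ≤ p.2) := fun h => h9.1 (hc.eq_of_le h9.2 h.1 h.2)
      simp only [mem_box, hp, true_and] at h7 h8
      omega
    have hQperm : IsPartialPerm Q := by
      intro p hp q hq hpq
      have hp' : p ≠ (a, b) → p ∈ P := fun h => hQP ▸ mem_erase.2 ⟨h, hp⟩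
      have hq' : q ≠ (a, b) → q ∈ P := fun h => hQP ▸ mem_erase.2 ⟨h, hq⟩
      by_cases h1 : p = (a, b) <;> by_cases h2 : q = (a, b)
      · rw [h1, h2]
      · have := hfree (h1 ▸ hp) q (hq' h2)
        grind
      · have := hfree (h2 ▸ hq) p (hp' h1)
        grind
      · exact hP.perm p (hp' h1) q (hq' h2) hpq
    have hS := hQperm.subset (box_subset Q (a + 1) (b + 1))
    have hSb : ∀ p ∈ box Q (a + 1) (b + 1), p.1 < a + 1 ∧ p.2 < b + 1 :=
      fun p hp => (mem_box.1 hp).2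
    have hXS : ((a, b) ∈ box Q (a + 1) (b + 1)) = X := by
      simp [mem_box, hQX]
    have hAv : G.Av (box Q (a + 1) (b + 1)) := by
      refine G.av_of_rule (a := a) (b := b) (v := w (a + 1, b + 1)) hS hSb ?_ ?_ ?_
      · rw [box_box (by omega) (by omega), hbox _ _ (by omega)]
        exact hP.av_of_bd (hc.bd_erase.2 (Or.inr ⟨hc.bd_left, by simp⟩))
      · rw [box_box (by omega) (by omega), hbox _ _ (by omega)]
        exact hP.av_of_bd (hc.bd_erase.2 (Or.inr ⟨hc.bd_below, by simp⟩))
      · rw [box_box (by omega) (by omega), box_box (by omega) (by omega),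
          box_box (by omega) (by omega), hXS]
        simp only [Growth.stat] at hsr hsl hsm
        rwa [hsr, hsl, hsm]
    have hQ : IsFilling G F Q := by
      refine ⟨hQF, hQperm, fun c hcF => ?_⟩
      by_cases hcc : c = (a, b)
      · rw [hcc]
        exact hAv
      · rw [hbox _ _ (fun h => hcc (hc.eq_of_le hcF (by omega) (by omega)))]
        exact hP.av c (mem_erase.2 ⟨hcc, hcF⟩)
    refine ⟨Q, hQ, fun v hv => ?_⟩
    by_cases hv' : v = (a + 1, b + 1)
    · have := hc.rule hQ
      rw [hsr, hsl, hsm, propext hQX] at this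
      rw [hv']
      exact G.rule_right_unique this hX
    · exact hne v hv hv'

end filling

section occupancy

variable {F P Q : Finset (ℕ × ℕ)}

theorem exists_bd_right (hF : IsLowerSet (F : Set (ℕ × ℕ))) (x : ℕ) :
    ∃ h, Bd F (x, h) ∧ Bd F (x + 1, h) ∧ ∀ p ∈ F, p.1 = x → p.2 < h := by
  classical
  have hex : ∃ h, (x, h) ∉ F := by
    obtain ⟨y, hy⟩ := Infinite.exists_notMem_finset (F.image Prod.snd)
    exact ⟨y, fun h => hy (mem_image_of_mem Prod.snd h)⟩
  have hle : ∀ i j i' j', (i', j') ∈ F → i ≤ i' → j ≤ j' → (i, j) ∈ F :=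
    fun i j i' j' h h1 h2 => hF (show (i, j) ≤ (i', j') from ⟨h1, h2⟩) h
  have h1 := Nat.find_spec hex
  have h2 : ∀ j, j + 1 = Nat.find hex → (x, j) ∈ F := fun j hj =>
    not_not.1 (Nat.find_min hex (m := j) (by omega))
  refine ⟨Nat.find hex, ⟨h1, fun i j hij => ?_⟩, ⟨fun h => h1 (hle _ _ _ _ h (by omega) le_rfl),
    fun i j hij => ?_⟩, fun p hp hpx => ?_⟩
  · rw [Prod.mk.injEq] at hij
    exact hle _ _ _ _ (h2 j hij.2.symm) (by omega) le_rfl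
  · rw [Prod.mk.injEq] at hij
    exact hle _ _ _ _ (h2 j hij.2.symm) (by omega) le_rfl
  · by_contra hlt
    exact h1 (hle _ _ p.1 p.2 hp (by omega) (by omega))

theorem exists_bd_up (hF : IsLowerSet (F : Set (ℕ × ℕ))) (y : ℕ) :
    ∃ h, Bd F (h, y) ∧ Bd F (h, y + 1) ∧ ∀ p ∈ F, p.2 = y → p.1 < h := by
  classical
  have hex : ∃ h, (h, y) ∉ F := by
    obtain ⟨x, hx⟩ := Infinite.exists_notMem_finset (F.image Prod.fst)
    exact ⟨x, fun h => hx (mem_image_of_mem Prod.fst h)⟩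
  have hle : ∀ i j i' j', (i', j') ∈ F → i ≤ i' → j ≤ j' → (i, j) ∈ F :=
    fun i j i' j' h h1 h2 => hF (show (i, j) ≤ (i', j') from ⟨h1, h2⟩) h
  have h1 := Nat.find_spec hex
  have h2 : ∀ i, i + 1 = Nat.find hex → (i, y) ∈ F := fun i hi =>
    not_not.1 (Nat.find_min hex (m := i) (by omega))
  refine ⟨Nat.find hex, ⟨h1, fun i j hij => ?_⟩, ⟨fun h => h1 (hle _ _ _ _ h le_rfl (by omega)),
    fun i j hij => ?_⟩, fun p hp hpy => ?_⟩
  · rw [Prod.mk.injEq] at hij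
    exact hle _ _ _ _ (h2 i hij.1.symm) le_rfl (by omega)
  · rw [Prod.mk.injEq] at hij
    exact hle _ _ _ _ (h2 i hij.1.symm) le_rfl (by omega)
  · by_contra hlt
    exact h1 (hle _ _ p.1 p.2 hp (by omega) (by omega))

theorem exists_fst_iff {x h : ℕ} (hP : ∀ p ∈ P, p.1 = x → p.2 < h) :
    (∃ p ∈ P, p.1 = x) ↔ #(box P x h) ≠ #(box P (x + 1) h) := by
  have hsub : box P x h ⊆ box P (x + 1) h := fun p hp => by
    rw [mem_box] at hp ⊢
    exact ⟨hp.1, by omega, hp.2.2⟩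
  constructor
  · rintro ⟨p, hp, rfl⟩ heq
    have := eq_of_subset_of_card_le hsub heq.ge
    have h1 : p ∈ box P (p.1 + 1) h := mem_box.2 ⟨hp, by omega, hP p hp rfl⟩
    rw [← this, mem_box] at h1
    omega
  · contrapose!
    intro hne
    congr 1
    ext p
    have := hne p
    simp only [mem_box]
    grind

theorem exists_snd_iff {y h : ℕ} (hP : ∀ p ∈ P, p.2 = y → p.1 < h) :
    (∃ p ∈ P, p.2 = y) ↔ #(box P h y) ≠ #(box P h (y + 1)) := by
  have hsub : box P h y ⊆ box P h (y + 1) := fun p hp => by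
    rw [mem_box] at hp ⊢
    exact ⟨hp.1, hp.2.1, by omega⟩
  constructor
  · rintro ⟨p, hp, rfl⟩ heq
    have := eq_of_subset_of_card_le hsub heq.ge
    have h1 : p ∈ box P h (p.2 + 1) := mem_box.2 ⟨hp, hP p hp rfl, by omega⟩
    rw [← this, mem_box] at h1
    omega
  · contrapose!
    intro hne
    congr 1
    ext p
    have := hne p
    simp only [mem_box]
    grind

theorem exists_fst_congr (hF : IsLowerSet (F : Set (ℕ × ℕ))) (hP : P ⊆ F) (hQ : Q ⊆ F)
    (h : ∀ v, Bd F v → #(box P v.1 v.2) = #(box Q v.1 v.2)) (x : ℕ) :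
    (∃ p ∈ P, p.1 = x) ↔ ∃ p ∈ Q, p.1 = x := by
  obtain ⟨k, h1, h2, h3⟩ := exists_bd_right hF x
  rw [exists_fst_iff (fun p hp => h3 p (hP hp)), exists_fst_iff (fun p hp => h3 p (hQ hp)),
    h _ h1, h _ h2]

theorem exists_snd_congr (hF : IsLowerSet (F : Set (ℕ × ℕ))) (hP : P ⊆ F) (hQ : Q ⊆ F)
    (h : ∀ v, Bd F v → #(box P v.1 v.2) = #(box Q v.1 v.2)) (y : ℕ) :
    (∃ p ∈ P, p.2 = y) ↔ ∃ p ∈ Q, p.2 = y := by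
  obtain ⟨k, h1, h2, h3⟩ := exists_bd_up hF y
  rw [exists_snd_iff (fun p hp => h3 p (hP hp)), exists_snd_iff (fun p hp => h3 p (hQ hp)),
    h _ h1, h _ h2]

theorem IsPartialPerm.injOn_fst (hP : IsPartialPerm P) : Set.InjOn Prod.fst (P : Set (ℕ × ℕ)) :=
  fun p hp q hq h => hP p hp q hq (Or.inl h)

theorem card_congr_of_exists_fst (hP : IsPartialPerm P) (hQ : IsPartialPerm Q)
    (h : ∀ x, (∃ p ∈ P, p.1 = x) ↔ ∃ p ∈ Q, p.1 = x) : #P = #Q := by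
  rw [← card_image_of_injOn hP.injOn_fst, ← card_image_of_injOn hQ.injOn_fst]
  congr 1
  ext x
  simpa only [mem_image] using h x

end occupancy

section transfer

/-- Two cells of `P` lie strictly above and to the right of `c`. -/
def NE2 (P : Finset (ℕ × ℕ)) (c : ℕ × ℕ) : Prop :=
  ∃ u ∈ P, ∃ v ∈ P, u.1 < v.1 ∧ c.1 < u.1 ∧ c.2 < u.2 ∧ c.2 < v.2

theorem NE2.anti {P : Finset (ℕ × ℕ)} {c d : ℕ × ℕ} (h : NE2 P c) (h1 : d.1 ≤ c.1)
    (h2 : d.2 ≤ c.2) : NE2 P d := by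
  obtain ⟨u, hu, v, hv, h3, h4, h5, h6⟩ := h
  exact ⟨u, hu, v, hv, h3, by omega, by omega, by omega⟩

theorem NE2.mono {P Q : Finset (ℕ × ℕ)} {c : ℕ × ℕ} (h : NE2 P c) (hPQ : P ⊆ Q) : NE2 Q c := by
  obtain ⟨u, hu, v, hv, h⟩ := h
  exact ⟨u, hPQ hu, v, hPQ hv, h⟩

open Classical in
/-- The cells of the `n × n` square with two cells of `P` above and to the right. -/
noncomputable def shape (n : ℕ) (P : Finset (ℕ × ℕ)) : Finset (ℕ × ℕ) :=
  (range n ×ˢ range n).filter (NE2 P)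

variable {n : ℕ} {P Q : Finset (ℕ × ℕ)}

theorem mem_shape {c : ℕ × ℕ} : c ∈ shape n P ↔ (c.1 < n ∧ c.2 < n) ∧ NE2 P c := by
  simp [shape]

theorem shape_subset : shape n P ⊆ range n ×ˢ range n := by
  classical
  exact filter_subset _ _

theorem isLowerSet_shape : IsLowerSet (shape n P : Set (ℕ × ℕ)) := by
  intro p q hqp hp
  rw [mem_coe, mem_shape] at hp ⊢
  have h1 : q.1 ≤ p.1 := hqp.1
  have h2 : q.2 ≤ p.2 := hqp.2
  exact ⟨⟨by omega, by omega⟩, hp.2.anti h1 h2⟩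

/-- The two rightmost cells above and to the right of `c` are outside the shape. -/
theorem NE2.sdiff_shape {c : ℕ × ℕ} (h : NE2 P c) : NE2 (P \ shape n P) c := by
  classical
  obtain ⟨u, hu, v, hv, h3, h4, h5, h6⟩ := h
  obtain ⟨v', hv', hvmax⟩ := (P.filter (fun p => c.1 < p.1 ∧ c.2 < p.2)).exists_max_image Prod.fst
    ⟨v, by simp only [mem_filter]; exact ⟨hv, by omega, h6⟩⟩
  obtain ⟨u', hu', humax⟩ := (P.filter (fun p => (c.1 < p.1 ∧ c.2 < p.2) ∧ p.1 < v'.1)).exists_max_image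
    Prod.fst ⟨u, by
      have := hvmax v (by simp only [mem_filter]; exact ⟨hv, by omega, h6⟩)
      simp only [mem_filter]
      exact ⟨hu, ⟨h4, h5⟩, by omega⟩⟩
  simp only [mem_filter] at hv' hu' hvmax humax
  refine ⟨u', ?_, v', ?_, hu'.2.2, hu'.2.1.1, hu'.2.1.2, hv'.2.2⟩ <;>
    simp only [mem_sdiff, mem_shape, not_and]
  · refine ⟨hu'.1, fun _ => ?_⟩
    rintro ⟨x, hx, y, hy, h7, h8, h9, h10⟩
    have h11 := hvmax y ⟨hy, by omega, by omega⟩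
    have h12 := humax x ⟨hx, ⟨by omega, by omega⟩, by omega⟩
    omega
  · refine ⟨hv'.1, fun _ => ?_⟩
    rintro ⟨x, hx, y, hy, h7, h8, h9, h10⟩
    have h11 := hvmax x ⟨hx, by omega, by omega⟩
    omega

theorem shape_union (hQ : Q ⊆ shape n P) : shape n (Q ∪ P \ shape n P) = shape n P := by
  ext c
  rw [mem_shape, mem_shape]
  refine and_congr_right fun hc => ⟨fun h => ?_, fun h => h.sdiff_shape.mono subset_union_right⟩
  by_contra hcP
  have key : ∀ p ∈ Q ∪ P \ shape n P, c.1 < p.1 → c.2 < p.2 → p ∈ P := by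
    intro p hp h1 h2
    rcases mem_union.1 hp with hp | hp
    · exact absurd ((mem_shape.1 (hQ hp)).2.anti h1.le h2.le) hcP
    · exact (mem_sdiff.1 hp).1
  obtain ⟨u, hu, v, hv, h3, h4, h5, h6⟩ := h
  exact hcP ⟨u, key u hu h4 h5, v, key v hv (by omega) h6, h3, h4, h5, h6⟩

/-- The placements of `n` cells in the `n × n` square, one in each row and each column. -/
structure IsFull (n : ℕ) (P : Finset (ℕ × ℕ)) : Prop where
  perm : IsPartialPerm P
  subset : P ⊆ range n ×ˢ range n
  card : #P = n

def GoodFull (G : Growth) (n : ℕ) (P : Finset (ℕ × ℕ)) : Prop :=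
  IsFull n P ∧ IsFilling G (shape n P) (P ∩ shape n P)

/-- The two placements agree off their common shape, and have the same boundary statistics. -/
def Related (G H : Growth) (n : ℕ) (P P' : Finset (ℕ × ℕ)) : Prop :=
  shape n P' = shape n P ∧ P' \ shape n P = P \ shape n P ∧
    ∀ v, Bd (shape n P) v → H.stat (P' ∩ shape n P) v = G.stat (P ∩ shape n P) v

theorem GoodFull.exists_related {G : Growth} (hP : GoodFull G n P) (H : Growth) :
    ∃ P', GoodFull H n P' ∧ Related G H n P P' := by
  obtain ⟨hfull, hfill⟩ := hP
  obtain ⟨Q, hQ, hQs⟩ := hfill.labelling.exists_filling H isLowerSet_shape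
  have hF : IsLowerSet (shape n P : Set (ℕ × ℕ)) := isLowerSet_shape
  have hcard : ∀ v, Bd (shape n P) v →
      #(box Q v.1 v.2) = #(box (P ∩ shape n P) v.1 v.2) := fun v hv =>
    congrArg Prod.snd (hQs v hv)
  have hfst := exists_fst_congr hF hQ.subset hfill.subset hcard
  have hsnd := exists_snd_congr hF hQ.subset hfill.subset hcard
  have hQP := card_congr_of_exists_fst hQ.perm hfill.perm hfst
  have hdisj : Disjoint Q (P \ shape n P) :=
    disjoint_of_subset_left hQ.subset disjoint_sdiff
  have hshape := shape_union hQ.subset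
  have hinter : (Q ∪ P \ shape n P) ∩ shape n P = Q := by
    ext p
    have := @hQ.subset p
    simp only [mem_inter, mem_union, mem_sdiff]
    tauto
  have hsdiff : (Q ∪ P \ shape n P) \ shape n P = P \ shape n P := by
    ext p
    have := @hQ.subset p
    simp only [mem_union, mem_sdiff]
    tauto
  have hcross : ∀ p ∈ Q, ∀ q ∈ P \ shape n P, ¬ (p.1 = q.1 ∨ p.2 = q.2) := by
    intro p hp q hq hpq
    rw [mem_sdiff] at hq
    rcases hpq with h | h
    · obtain ⟨p', hp', h'⟩ := (hfst p.1).1 ⟨p, hp, rfl⟩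
      rw [mem_inter] at hp'
      have := hfull.perm p' hp'.1 q hq.1 (Or.inl (h'.trans h))
      exact hq.2 (this ▸ hp'.2)
    · obtain ⟨p', hp', h'⟩ := (hsnd p.2).1 ⟨p, hp, rfl⟩
      rw [mem_inter] at hp'
      have := hfull.perm p' hp'.1 q hq.1 (Or.inr (h'.trans h))
      exact hq.2 (this ▸ hp'.2)
  refine ⟨Q ∪ P \ shape n P, ⟨⟨?_, ?_, ?_⟩, ?_⟩, hshape, hsdiff, ?_⟩
  · intro p hp q hq hpq
    rcases mem_union.1 hp with hp | hp <;> rcases mem_union.1 hq with hq | hq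
    · exact hQ.perm p hp q hq hpq
    · exact absurd hpq (hcross p hp q hq)
    · exact absurd (hpq.imp Eq.symm Eq.symm) (hcross q hq p hp)
    · exact hfull.perm p (mem_sdiff.1 hp).1 q (mem_sdiff.1 hq).1 hpq
  · exact union_subset (hQ.subset.trans shape_subset) (sdiff_subset.trans hfull.subset)
  · rw [card_union_of_disjoint hdisj, hQP, card_inter_add_card_sdiff, hfull.card]
  · rwa [hshape, hinter]
  · rwa [hinter]

theorem Related.left_unique {G H : Growth} {P₁ P₂ P' : Finset (ℕ × ℕ)} (h₁ : GoodFull G n P₁)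
    (h₂ : GoodFull G n P₂) (h₁' : Related G H n P₁ P') (h₂' : Related G H n P₂ P') : P₁ = P₂ := by
  obtain ⟨hs₁, hd₁, hb₁⟩ := h₁'
  obtain ⟨hs₂, hd₂, hb₂⟩ := h₂'
  have hs : shape n P₁ = shape n P₂ := hs₁.symm.trans hs₂
  have hf₁ := h₁.2
  rw [hs] at hd₁ hb₁ hf₁
  have h := hf₁.eq isLowerSet_shape h₂.2 (fun v hv => (hb₁ v hv).symm.trans (hb₂ v hv))
  calc P₁ = P₁ \ shape n P₂ ∪ P₁ ∩ shape n P₂ := (sdiff_union_inter _ _).symm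
    _ = P₂ \ shape n P₂ ∪ P₂ ∩ shape n P₂ := by rw [← hd₁, hd₂, h]
    _ = P₂ := sdiff_union_inter _ _

instance finite_goodFull (G : Growth) (n : ℕ) : Finite {P // GoodFull G n P} :=
  Finite.of_injective
    (fun P => (⟨P.1, mem_powerset.2 P.2.1.subset⟩ : (range n ×ˢ range n).powerset))
    fun _ _ h => Subtype.ext (Subtype.mk.inj h)

theorem card_goodFull_le (G H : Growth) (n : ℕ) :
    Nat.card {P // GoodFull G n P} ≤ Nat.card {P // GoodFull H n P} := by
  choose f hf hr using fun P : {P // GoodFull G n P} => P.2.exists_related H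
  refine Nat.card_le_card_of_injective (fun P => (⟨f P, hf P⟩ : {P // GoodFull H n P})) ?_
  intro P Q hPQ
  have h : f P = f Q := congrArg Subtype.val hPQ
  exact Subtype.ext (Related.left_unique P.2 Q.2 (hr P) (h ▸ hr Q))

end transfer

section patterns

variable {n : ℕ}

theorem permContains_iff (π : Equiv.Perm (Fin n)) (v : Fin 5 → Fin 5) (h : v.Bijective)
    (hv : ∀ k, v (v k) = k) :
    PermContains π (mkPattern v h) ↔ ∃ f : Fin 5 → Fin n,
      (f 0 < f 1 ∧ f 1 < f 2 ∧ f 2 < f 3 ∧ f 3 < f 4) ∧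
      π (f (v 0)) < π (f (v 1)) ∧ π (f (v 1)) < π (f (v 2)) ∧ π (f (v 2)) < π (f (v 3)) ∧
      π (f (v 3)) < π (f (v 4)) := by
  have key : ∀ g : Fin 5 → Fin n,
      StrictMono g ↔ g 0 < g 1 ∧ g 1 < g 2 ∧ g 2 < g 3 ∧ g 3 < g 4 := by
    intro g
    rw [Fin.strictMono_iff_lt_succ]
    exact ⟨fun h => ⟨h 0, h 1, h 2, h 3⟩, fun ⟨h0, h1, h2, h3⟩ i => by
      fin_cases i
      exacts [h0, h1, h2, h3]⟩
  change (∃ f : Fin 5 → Fin n, StrictMono f ∧ ∀ a b, π (f a) < π (f b) ↔ v a < v b) ↔ _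
  refine exists_congr fun f => and_congr (key f) ?_
  rw [← key (fun k => π (f (v k)))]
  constructor
  · intro h a b hab
    exact (h _ _).2 (by rwa [hv, hv])
  · intro h a b
    have := h.lt_iff_lt (a := v a) (b := v b)
    simpa only [hv] using this

/-- The placement of a permutation, rotated by a half turn. -/
def points (π : Equiv.Perm (Fin n)) : Finset (ℕ × ℕ) :=
  univ.image fun i => ((i.rev : ℕ), ((π i).rev : ℕ))

theorem mem_points {π : Equiv.Perm (Fin n)} {p : ℕ × ℕ} :
    p ∈ points π ↔ ∃ i, ((i.rev : ℕ), ((π i).rev : ℕ)) = p := by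
  simp [points]

theorem mk_mem_points (π : Equiv.Perm (Fin n)) (i : Fin n) :
    ((i.rev : ℕ), ((π i).rev : ℕ)) ∈ points π :=
  mem_points.2 ⟨i, rfl⟩

theorem isFull_points (π : Equiv.Perm (Fin n)) : IsFull n (points π) := by
  refine ⟨?_, ?_, ?_⟩
  · intro p hp q hq hpq
    obtain ⟨i, rfl⟩ := mem_points.1 hp
    obtain ⟨j, rfl⟩ := mem_points.1 hq
    have : i = j := by
      rcases hpq with h | h
      · exact Fin.rev_injective (Fin.ext h)
      · exact π.injective (Fin.rev_injective (Fin.ext h))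
    rw [this]
  · intro p hp
    obtain ⟨i, rfl⟩ := mem_points.1 hp
    simp [i.pos]
  · rw [points, card_image_of_injective, card_univ, Fintype.card_fin]
    intro i j hij
    exact Fin.rev_injective (Fin.ext (congrArg Prod.fst hij))

theorem points_injective : Function.Injective (points (n := n)) := by
  intro π σ h
  ext i
  have h1 := mk_mem_points π i
  rw [h] at h1
  obtain ⟨j, hj⟩ := mem_points.1 h1
  rw [Prod.mk.injEq] at hj
  have h2 : j = i := Fin.rev_injective (Fin.ext hj.1)
  rw [h2] at hj
  exact congrArg Fin.val (Fin.rev_injective (Fin.ext hj.2)).symm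

theorem IsFull.exists_points {P : Finset (ℕ × ℕ)} (hP : IsFull n P) :
    ∃ π : Equiv.Perm (Fin n), points π = P := by
  have himg : P.image Prod.fst = range n := by
    refine eq_of_subset_of_card_le ?_ ?_
    · intro x hx
      obtain ⟨p, hp, rfl⟩ := mem_image.1 hx
      exact (mem_product.1 (hP.subset hp)).1
    · rw [card_image_of_injOn hP.perm.injOn_fst, hP.card, card_range]
  have hex : ∀ i : Fin n, ∃ j : Fin n, ((i.rev : ℕ), (j.rev : ℕ)) ∈ P := by
    intro i
    have h1 : (i.rev : ℕ) ∈ P.image Prod.fst := by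
      rw [himg, mem_range]
      exact i.rev.2
    obtain ⟨p, hp, h2⟩ := mem_image.1 h1
    have h3 := mem_range.1 (mem_product.1 (hP.subset hp)).2
    refine ⟨Fin.rev ⟨p.2, h3⟩, ?_⟩
    rwa [Fin.rev_rev, ← h2]
  choose f hf using hex
  have hinj : Function.Injective f := by
    intro i j hij
    have := hP.perm _ (hf i) _ (hf j) (Or.inr (by rw [hij]))
    exact Fin.rev_injective (Fin.ext (congrArg Prod.fst this))
  refine ⟨Equiv.ofBijective f (Finite.injective_iff_bijective.1 hinj), ?_⟩
  refine eq_of_subset_of_card_le ?_ ?_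
  · intro p hp
    obtain ⟨i, rfl⟩ := mem_points.1 hp
    exact hf i
  · rw [hP.card, (isFull_points _).card]

theorem forall_free_shape_iff {r : ℕ → ℕ → Prop} {P : Finset (ℕ × ℕ)}
    (hr : ∀ {x y z}, r x y → r y z → y ≤ max x z) (hP : P ⊆ range n ×ˢ range n) :
    (∀ c ∈ shape n P, Free r (box (P ∩ shape n P) (c.1 + 1) (c.2 + 1))) ↔
      ∀ p ∈ P, ∀ q ∈ P, ∀ t ∈ P, p.1 < q.1 → q.1 < t.1 → r p.2 q.2 → r q.2 t.2 →
        ¬ NE2 P (t.1, max p.2 t.2) := by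
  constructor
  · intro h p hp q hq t ht hpq hqt h1 h2 h3
    have hp' := mem_product.1 (hP hp)
    have ht' := mem_product.1 (hP ht)
    rw [mem_range, mem_range] at hp' ht'
    have hc : (t.1, max p.2 t.2) ∈ shape n P := mem_shape.2 ⟨⟨ht'.1, max_lt hp'.2 ht'.2⟩, h3⟩
    have key : ∀ x ∈ P, x.1 ≤ t.1 → x.2 ≤ max p.2 t.2 →
        x ∈ box (P ∩ shape n P) (t.1 + 1) (max p.2 t.2 + 1) := fun x hx hx1 hx2 =>
      mem_box.2 ⟨mem_inter.2 ⟨hx, isLowerSet_shape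
        (show x ≤ (t.1, max p.2 t.2) from ⟨hx1, hx2⟩) hc⟩, by omega, by omega⟩
    exact h _ hc p (key p hp (by omega) (by omega)) q (key q hq (by omega) (hr h1 h2)) t
      (key t ht le_rfl (by omega)) hpq hqt h1 h2
  · intro h c hc p hp q hq t ht hpq hqt h1 h2
    rw [mem_box, mem_inter] at hp hq ht
    refine h p hp.1.1 q hq.1.1 t ht.1.1 hpq hqt h1 h2 ((mem_shape.1 hc).2.anti ?_ ?_)
    · dsimp only
      omega
    · dsimp only
      omega

theorem goodFull_points_iff (G : Growth) (π : Equiv.Perm (Fin n)) :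
    GoodFull G n (points π) ↔ ∀ c ∈ shape n (points π),
      G.Av (box (points π ∩ shape n (points π)) (c.1 + 1) (c.2 + 1)) :=
  ⟨fun h => h.2.av, fun h => ⟨isFull_points π, inter_subset_right,
    (isFull_points π).perm.subset inter_subset_left, h⟩⟩

theorem goodFull_dec_iff (π : Equiv.Perm (Fin n)) : GoodFull decGrowth n (points π) ↔
    AvoidsSet π {mkPattern ![0,1,4,3,2], mkPattern ![1,0,4,3,2]} := by
  rw [goodFull_points_iff]
  refine (forall_free_shape_iff (r := (· > ·)) (by omega) (isFull_points π).subset).trans ?_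
  simp only [AvoidsSet, Set.mem_insert_iff, Set.mem_singleton_iff, forall_eq_or_imp, forall_eq]
  rw [permContains_iff _ _ _ (by decide), permContains_iff _ _ _ (by decide)]
  constructor
  · intro h
    have key : ∀ f : Fin 5 → Fin n, f 0 < f 1 → f 1 < f 2 → f 2 < f 3 → f 3 < f 4 →
        π (f 0) < π (f 4) → π (f 1) < π (f 4) → π (f 4) < π (f 3) → π (f 3) < π (f 2) → False := by
      intro f h1 h2 h3 h4 h5 h6 h7 h8
      rw [Fin.lt_def] at *
      refine h _ (mk_mem_points π (f 4)) _ (mk_mem_points π (f 3)) _ (mk_mem_points π (f 2))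
        ?_ ?_ ?_ ?_ ⟨_, mk_mem_points π (f 1), _, mk_mem_points π (f 0), ?_, ?_, ?_, ?_⟩ <;>
        simp only [Fin.val_rev] <;> omega
    constructor
    · rintro ⟨f, ⟨h1, h2, h3, h4⟩, h5, h6, h7, h8⟩
      simp at h5 h6 h7 h8
      exact key f h1 h2 h3 h4 (h5.trans h6) h6 h7 h8
    · rintro ⟨f, ⟨h1, h2, h3, h4⟩, h5, h6, h7, h8⟩
      simp at h5 h6 h7 h8
      exact key f h1 h2 h3 h4 h6 (h5.trans h6) h7 h8
  · rintro ⟨hA, hB⟩ p hp q hq t ht h1 h2 h3 h4 ⟨u, hu, v, hv, h5, h6, h7, h8⟩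
    obtain ⟨p, rfl⟩ := mem_points.1 hp
    obtain ⟨q, rfl⟩ := mem_points.1 hq
    obtain ⟨t, rfl⟩ := mem_points.1 ht
    obtain ⟨u, rfl⟩ := mem_points.1 hu
    obtain ⟨v, rfl⟩ := mem_points.1 hv
    simp only [Fin.val_rev, max_lt_iff] at h1 h2 h3 h4 h5 h6 h7 h8
    have hne : π u ≠ π v := fun h => by
      have := π.injective h
      subst this
      omega
    have hi : v < u ∧ u < t ∧ t < q ∧ q < p := by
      simp only [Fin.lt_def]
      omega
    have hj : (π v < π p ∧ π u < π p) ∧ π p < π q ∧ π q < π t := by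
      simp only [Fin.lt_def]
      omega
    rcases lt_or_gt_of_ne hne with h9 | h9
    · exact hB ⟨![v, u, t, q, p], hi, h9, hj.1.1, hj.2⟩
    · exact hA ⟨![v, u, t, q, p], hi, h9, hj.1.2, hj.2⟩

theorem goodFull_inc_iff (π : Equiv.Perm (Fin n)) : GoodFull incGrowth n (points π) ↔
    AvoidsSet π {mkPattern ![0,1,2,3,4], mkPattern ![1,0,2,3,4]} := by
  rw [goodFull_points_iff]
  refine (forall_free_shape_iff (r := (· < ·)) (by omega) (isFull_points π).subset).trans ?_
  simp only [AvoidsSet, Set.mem_insert_iff, Set.mem_singleton_iff, forall_eq_or_imp, forall_eq]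
  rw [permContains_iff _ _ _ (by decide), permContains_iff _ _ _ (by decide)]
  constructor
  · intro h
    have key : ∀ f : Fin 5 → Fin n, f 0 < f 1 → f 1 < f 2 → f 2 < f 3 → f 3 < f 4 →
        π (f 0) < π (f 2) → π (f 1) < π (f 2) → π (f 2) < π (f 3) → π (f 3) < π (f 4) → False := by
      intro f h1 h2 h3 h4 h5 h6 h7 h8
      rw [Fin.lt_def] at *
      refine h _ (mk_mem_points π (f 4)) _ (mk_mem_points π (f 3)) _ (mk_mem_points π (f 2))
        ?_ ?_ ?_ ?_ ⟨_, mk_mem_points π (f 1), _, mk_mem_points π (f 0), ?_, ?_, ?_, ?_⟩ <;>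
        simp only [Fin.val_rev] <;> omega
    constructor
    · rintro ⟨f, ⟨h1, h2, h3, h4⟩, h5, h6, h7, h8⟩
      simp at h5 h6 h7 h8
      exact key f h1 h2 h3 h4 (h5.trans h6) h6 h7 h8
    · rintro ⟨f, ⟨h1, h2, h3, h4⟩, h5, h6, h7, h8⟩
      simp at h5 h6 h7 h8
      exact key f h1 h2 h3 h4 h6 (h5.trans h6) h7 h8
  · rintro ⟨hA, hB⟩ p hp q hq t ht h1 h2 h3 h4 ⟨u, hu, v, hv, h5, h6, h7, h8⟩
    obtain ⟨p, rfl⟩ := mem_points.1 hp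
    obtain ⟨q, rfl⟩ := mem_points.1 hq
    obtain ⟨t, rfl⟩ := mem_points.1 ht
    obtain ⟨u, rfl⟩ := mem_points.1 hu
    obtain ⟨v, rfl⟩ := mem_points.1 hv
    simp only [Fin.val_rev, max_lt_iff] at h1 h2 h3 h4 h5 h6 h7 h8
    have hne : π u ≠ π v := fun h => by
      have := π.injective h
      subst this
      omega
    have hi : v < u ∧ u < t ∧ t < q ∧ q < p := by
      simp only [Fin.lt_def]
      omega
    have hj : (π v < π t ∧ π u < π t) ∧ π t < π q ∧ π q < π p := by
      simp only [Fin.lt_def]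
      omega
    rcases lt_or_gt_of_ne hne with h9 | h9
    · exact hB ⟨![v, u, t, q, p], hi, h9, hj.1.1, hj.2⟩
    · exact hA ⟨![v, u, t, q, p], hi, h9, hj.1.2, hj.2⟩

theorem card_avoidsSet {G : Growth} {S : Set Pattern}
    (h : ∀ π : Equiv.Perm (Fin n), GoodFull G n (points π) ↔ AvoidsSet π S) :
    Nat.card {π : Equiv.Perm (Fin n) // AvoidsSet π S} = Nat.card {P // GoodFull G n P} := by
  refine Nat.card_eq_of_bijective (fun π => ⟨points π.1, (h _).2 π.2⟩) ⟨fun π σ hπ => ?_, ?_⟩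
  · exact Subtype.ext (points_injective (Subtype.mk.inj hπ))
  · rintro ⟨P, hP⟩
    obtain ⟨π, rfl⟩ := hP.1.exists_points
    exact ⟨⟨π, (h π).1 hP⟩, rfl⟩

end patterns

end ShapeWilf

/-- The pattern sets {12543, 21543} and {12345, 21345} are Wilf-equivalent. -/
theorem stmt15 : WilfEquiv {mkPattern ![0,1,4,3,2], mkPattern ![1,0,4,3,2]} {mkPattern ![0,1,2,3,4], mkPattern ![1,0,2,3,4]} := by
  intro n _
  rw [ShapeWilf.card_avoidsSet ShapeWilf.goodFull_dec_iff,
    ShapeWilf.card_avoidsSet ShapeWilf.goodFull_inc_iff]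
  exact le_antisymm (ShapeWilf.card_goodFull_le _ _ n) (ShapeWilf.card_goodFull_le _ _ n)
end
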